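/- Let Σ ⊆ ℝ^N (N ≥ 2) be an open convex cone with vertex at 0, written (after a rotation, which we assume already performed) as Σ = ℝ^k × Σ̃, where 0 ≤ k ≤ N and Σ̃ ⊂ ℝ^{N−k} is an open convex cone containing no lines. Let B = {x : H₀(x) < 1} be the unit Wulff ball of H centered at 0. Let E ⊆ ℝ^N be a measurable set with 0 < |Σ∩E| < ∞ and P_H(E;Σ) < ∞. Then equality holds in the anisotropic isoperimetric inequality, i.e. P_H(E;Σ) · |Σ∩B|^{(N−1)/N} = P_H(B;Σ) · |Σ∩E|^{(N−1)/N}, if and only if there exist r > 0 and x₀ ∈ ℝ^k × {0_{ℝ^{N−k}}} such that Σ∩E coincides with Σ ∩ B_r(x₀) up to a set of Lebesgue measure zero, where B_r(x₀) = {x : H₀(x−x₀) < r} is the Wulff ball of radius r centered at x₀. -/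

import Mathlib

open MeasureTheory Set Metric
open scoped ENNReal NNReal RealInnerProductSpace Topology Classical

noncomputable section

/-- Divergence of a vector field on `ℝ^N`, computed coordinatewise. -/
def vdiv {N : ℕ} (σ : EuclideanSpace ℝ (Fin N) → EuclideanSpace ℝ (Fin N))
    (x : EuclideanSpace ℝ (Fin N)) : ℝ :=
  ∑ i, fderiv ℝ σ x (EuclideanSpace.single i 1) i

/-- The dual norm `H₀(x) = sup_{ξ ≠ 0} ⟨x, ξ⟩ / H(ξ)`. -/
def dualNorm {N : ℕ} (H : EuclideanSpace ℝ (Fin N) → ℝ) (x : EuclideanSpace ℝ (Fin N)) : ℝ :=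
  sSup ((fun ξ => ⟪x, ξ⟫ / H ξ) '' {ξ : EuclideanSpace ℝ (Fin N) | ξ ≠ 0})

/-- `H` is a norm on `ℝ^N`: convex, positive away from `0`, absolutely homogeneous. -/
structure IsAnisoNorm {N : ℕ} (H : EuclideanSpace ℝ (Fin N) → ℝ) : Prop where
  conv : ConvexOn ℝ Set.univ H
  pos : ∀ ξ, ξ ≠ 0 → 0 < H ξ
  hom : ∀ (t : ℝ) (ξ : EuclideanSpace ℝ (Fin N)), H (t • ξ) = |t| * H ξ

/-- `H` is `C²` away from the origin and uniformly elliptic: the Hessian of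
`ξ ↦ ½ H(ξ)²` is positive definite at every `ξ ≠ 0`. -/
def UniformlyElliptic {N : ℕ} (H : EuclideanSpace ℝ (Fin N) → ℝ) : Prop :=
  ContDiffOn ℝ 2 H {(0 : EuclideanSpace ℝ (Fin N))}ᶜ ∧
  ∀ ξ : EuclideanSpace ℝ (Fin N), ξ ≠ 0 → ∀ v : EuclideanSpace ℝ (Fin N), v ≠ 0 →
    0 < ⟪fderiv ℝ (gradient (fun z => H z ^ 2 / 2)) ξ v, v⟫

/-- The anisotropic vector field `H(∇u)^{p-1} ∇H(∇u)`, understood to be `0`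
at points where `∇u = 0`. -/
def aField {N : ℕ} (H : EuclideanSpace ℝ (Fin N) → ℝ) (p : ℝ)
    (u : EuclideanSpace ℝ (Fin N) → ℝ) (x : EuclideanSpace ℝ (Fin N)) :
    EuclideanSpace ℝ (Fin N) :=
  if gradient u x = 0 then 0 else H (gradient u x) ^ (p - 1) • gradient H (gradient u x)

/-- Weighted anisotropic perimeter of `E` relative to `S`:
`sup { ∫_E div σ : σ ∈ C¹_c(S; ℝ^N), ρ(σ(x)) ≤ w(x) for all x }`, valued in `[0,∞]`. -/
def periW {N : ℕ} (ρ w : EuclideanSpace ℝ (Fin N) → ℝ)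
    (E S : Set (EuclideanSpace ℝ (Fin N))) : ℝ≥0∞ :=
  ⨆ σ ∈ {σ : EuclideanSpace ℝ (Fin N) → EuclideanSpace ℝ (Fin N) |
      ContDiff ℝ 1 σ ∧ HasCompactSupport σ ∧ tsupport σ ⊆ S ∧ ∀ x, ρ (σ x) ≤ w x},
    ENNReal.ofReal (∫ x in E, vdiv σ x)

/-- Open convex cone with vertex at the origin (the case `S = ℝ^N` is allowed). -/
def IsOpenConvexCone {N : ℕ} (S : Set (EuclideanSpace ℝ (Fin N))) : Prop :=
  IsOpen S ∧ Convex ℝ S ∧ ∀ x ∈ S, ∀ t : ℝ, 0 < t → t • x ∈ S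

/-- The lineality space of `S`: directions along which `S` is translation invariant.
For a convex cone `Σ = ℝ^k × Σ̃` with `Σ̃` containing no lines this is `ℝ^k × {0}`. -/
def lineality {N : ℕ} (S : Set (EuclideanSpace ℝ (Fin N))) :
    Set (EuclideanSpace ℝ (Fin N)) :=
  {v | ∀ x ∈ S, ∀ t : ℝ, x + t • v ∈ S}

section
open scoped Pointwise

section

lemma volume_add_le_of_isCompact {A B : Set ℝ} (hA : IsCompact A) (hB : IsCompact B)
    (hA0 : A.Nonempty) (hB0 : B.Nonempty) : volume A + volume B ≤ volume (A + B) := by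
  set a := sSup A
  set b := sInf B
  have ha : a ∈ A := hA.sSup_mem hA0
  have hb : b ∈ B := hB.sInf_mem hB0
  have h1 : volume ((fun x => x + b) '' A) = volume A := by
    simp [Set.image_add_right]
  have h2 : volume ((fun x => a + x) '' B) = volume B := by
    simp [Set.image_add_left]
  have hmeas : MeasurableSet ((fun x => a + x) '' B) :=
    (hB.image (by fun_prop)).measurableSet
  have h3 : volume (((fun x => x + b) '' A) ∩ ((fun x => a + x) '' B)) = 0 := by
    refine measure_mono_null (t := {a + b}) ?_ (by simp)
    rintro _ ⟨⟨x, hx, rfl⟩, ⟨y, hy, hxy⟩⟩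
    have h4 : x ≤ a := le_csSup hA.bddAbove hx
    have h5 : b ≤ y := csInf_le hB.bddBelow hy
    simp only [mem_singleton_iff] at hxy ⊢
    linarith
  have h6 := measure_union_add_inter (μ := (volume : Measure ℝ)) ((fun x => x + b) '' A) hmeas
  rw [h3, h1, h2, add_zero] at h6
  rw [← h6]
  refine measure_mono (union_subset ?_ ?_)
  · rintro _ ⟨x, hx, rfl⟩
    exact add_mem_add hx hb
  · rintro _ ⟨x, hx, rfl⟩
    exact add_mem_add ha hx

lemma volume_combo_le {A B C : Set ℝ} (hA : MeasurableSet A) (hB : MeasurableSet B)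
    (hA0 : A.Nonempty) (hB0 : B.Nonempty) {a b : ℝ≥0}
    (h : ∀ x ∈ A, ∀ y ∈ B, (a : ℝ) * x + b * y ∈ C) :
    (a : ℝ≥0∞) * volume A + b * volume B ≤ volume C := by
  have key : ∀ K ⊆ A, IsCompact K → ∀ L ⊆ B, IsCompact L →
      (a : ℝ≥0∞) * volume K + b * volume L ≤ volume C := by
    intro K hKA hK L hLB hL
    obtain ⟨x0, hx0⟩ := hA0
    obtain ⟨y0, hy0⟩ := hB0
    have hK' := hK.insert x0
    have hL' := hL.insert y0
    have e1 : volume ((a : ℝ) • (insert x0 K)) = (a : ℝ≥0∞) * volume (insert x0 K) := by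
      rw [Measure.addHaar_smul]; simp
    have e2 : volume ((b : ℝ) • (insert y0 L)) = (b : ℝ≥0∞) * volume (insert y0 L) := by
      rw [Measure.addHaar_smul]; simp
    calc (a : ℝ≥0∞) * volume K + b * volume L
        ≤ a * volume (insert x0 K) + b * volume (insert y0 L) := by
          gcongr <;> exact subset_insert _ _
      _ ≤ volume ((a : ℝ) • (insert x0 K) + (b : ℝ) • (insert y0 L)) := by
          rw [← e1, ← e2]
          exact volume_add_le_of_isCompact (hK'.smul _) (hL'.smul _)
            ((insert_nonempty _ _).smul_set) ((insert_nonempty _ _).smul_set)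
      _ ≤ volume C := by
          refine measure_mono ?_
          rintro _ ⟨_, ⟨x, hx, rfl⟩, _, ⟨y, hy, rfl⟩, rfl⟩
          refine h x ?_ y ?_
          · rcases hx with rfl | hx; exacts [hx0, hKA hx]
          · rcases hy with rfl | hy; exacts [hy0, hLB hy]
  rw [hA.measure_eq_iSup_isCompact, hB.measure_eq_iSup_isCompact]
  simp only [ENNReal.mul_iSup]
  refine ENNReal.biSup_add_biSup_le' (p := fun K => K ⊆ A) (q := fun L => L ⊆ B)
    (f := fun K => ⨆ (_ : IsCompact K), (a : ℝ≥0∞) * volume K)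
    (g := fun K => ⨆ (_ : IsCompact K), (b : ℝ≥0∞) * volume K)
    ⟨∅, empty_subset _⟩ ⟨∅, empty_subset _⟩ ?_
  intro K hK L hL
  by_cases cK : IsCompact K <;> by_cases cL : IsCompact L
  · simpa [cK, cL] using key K hK cK L hL cL
  · simpa [cK, cL] using key K hK cK ∅ (empty_subset _) isCompact_empty
  · simpa [cK, cL] using key ∅ (empty_subset _) isCompact_empty L hL cL
  · simp [cK, cL]

lemma ennreal_geom_mean_le {w₁ w₂ : ℝ≥0} (h1 : w₁ ≠ 0) (h2 : w₂ ≠ 0) (hw : w₁ + w₂ = 1)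
    (a b : ℝ≥0∞) : a ^ (w₁ : ℝ) * b ^ (w₂ : ℝ) ≤ w₁ * a + w₂ * b := by
  by_cases ha : a = ⊤
  · simp [ha, h1]
  by_cases hb : b = ⊤
  · simp [hb, h2]
  lift a to ℝ≥0 using ha
  lift b to ℝ≥0 using hb
  rw [← ENNReal.coe_rpow_of_nonneg a w₁.coe_nonneg, ← ENNReal.coe_rpow_of_nonneg b w₂.coe_nonneg]
  exact_mod_cast NNReal.geom_mean_le_arith_mean2_weighted w₁ w₂ a b hw

lemma lintegral_eq_lintegral_level {α : Type*} [MeasurableSpace α] {μ : Measure α}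
    {f : α → ℝ≥0∞} (hf : Measurable f) (h : ∀ x, f x ≠ ⊤) :
    ∫⁻ x, f x ∂μ = ∫⁻ t in Ioi (0 : ℝ), μ {x | ENNReal.ofReal t < f x} := by
  have := lintegral_eq_lintegral_meas_lt (f := fun x => (f x).toReal) μ
    (Filter.Eventually.of_forall fun x => ENNReal.toReal_nonneg) hf.ennreal_toReal.aemeasurable
  simp only [ENNReal.ofReal_toReal (h _)] at this
  rw [this]
  refine setLIntegral_congr_fun measurableSet_Ioi fun t ht => ?_
  congr 1
  ext x
  simp only [Set.mem_ofPred_eq]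
  rw [ENNReal.ofReal_lt_iff_lt_toReal (le_of_lt ht) (h x)]

lemma prekopa_leindler_real_normalized {w₁ w₂ : ℝ≥0} (h1 : w₁ ≠ 0) (h2 : w₂ ≠ 0)
    (hw : w₁ + w₂ = 1)
    {f g h : ℝ → ℝ≥0∞} (hf : Measurable f) (hg : Measurable g) (hh : Measurable h)
    (hf1 : ⨆ x, f x = 1) (hg1 : ⨆ x, g x = 1)
    (hfgh : ∀ x y, f x ^ (w₁ : ℝ) * g y ^ (w₂ : ℝ) ≤ h (w₁ * x + w₂ * y)) :
    (∫⁻ x, f x) ^ (w₁ : ℝ) * (∫⁻ x, g x) ^ (w₂ : ℝ) ≤ ∫⁻ x, h x := by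
  have hf1' : ∀ x, f x ≤ 1 := fun x => hf1 ▸ le_iSup f x
  have hg1' : ∀ x, g x ≤ 1 := fun x => hg1 ▸ le_iSup g x
  refine (ennreal_geom_mean_le h1 h2 hw _ _).trans ?_
  rw [lintegral_eq_lintegral_level hf fun x => ((hf1' x).trans_lt ENNReal.one_lt_top).ne,
    lintegral_eq_lintegral_level hg fun x => ((hg1' x).trans_lt ENNReal.one_lt_top).ne]
  have hmin : ∫⁻ x, min (h x) 1 ≤ ∫⁻ x, h x := lintegral_mono fun x => min_le_left _ _
  refine le_trans ?_ hmin
  rw [lintegral_eq_lintegral_level (hh.min measurable_const)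
    fun x => ((min_le_right _ _).trans_lt ENNReal.one_lt_top).ne]
  have mf : Measurable fun t : ℝ => volume {x | ENNReal.ofReal t < f x} :=
    Antitone.measurable fun s t hst => measure_mono fun x hx =>
      lt_of_le_of_lt (ENNReal.ofReal_le_ofReal hst) hx
  rw [← lintegral_const_mul' _ _ (by simp), ← lintegral_const_mul' _ _ (by simp),
    ← lintegral_add_left (mf.const_mul _)]
  refine setLIntegral_mono' measurableSet_Ioi fun t ht => ?_
  rcases lt_or_ge t 1 with ht1 | ht1
  · have ht1' : ENNReal.ofReal t < 1 := by simpa using ht1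
    have ht0 : ENNReal.ofReal t ≠ 0 := by simpa using ht
    refine volume_combo_le (measurableSet_lt measurable_const hf)
      (measurableSet_lt measurable_const hg) ?_ ?_ ?_
    · exact lt_iSup_iff.1 (hf1 ▸ ht1')
    · exact lt_iSup_iff.1 (hg1 ▸ ht1')
    · intro x hx y hy
      simp only [Set.mem_ofPred_eq] at hx hy ⊢
      refine lt_min (lt_of_lt_of_le ?_ (hfgh x y)) ht1'
      calc ENNReal.ofReal t = ENNReal.ofReal t ^ (w₁ : ℝ) * ENNReal.ofReal t ^ (w₂ : ℝ) := by
            rw [← ENNReal.rpow_add _ _ ht0 (by simp)]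
            have : (w₁ : ℝ) + w₂ = 1 := by exact_mod_cast hw
            rw [this, ENNReal.rpow_one]
        _ < _ := ENNReal.mul_lt_mul
              (ENNReal.rpow_lt_rpow hx (by positivity)) (ENNReal.rpow_lt_rpow hy (by positivity))
  · have e1 : {x | ENNReal.ofReal t < f x} = ∅ := by
      ext x
      simp only [Set.mem_ofPred_eq, mem_empty_iff_false, iff_false, not_lt]
      exact (hf1' x).trans (by simpa using ht1)
    have e2 : {x | ENNReal.ofReal t < g x} = ∅ := by
      ext x
      simp only [Set.mem_ofPred_eq, mem_empty_iff_false, iff_false, not_lt]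
      exact (hg1' x).trans (by simpa using ht1)
    simp [e1, e2]

lemma prekopa_leindler_real_bounded {w₁ w₂ : ℝ≥0} (h1 : w₁ ≠ 0) (h2 : w₂ ≠ 0) (hw : w₁ + w₂ = 1)
    {f g h : ℝ → ℝ≥0∞} (hf : Measurable f) (hg : Measurable g) (hh : Measurable h)
    (hf1 : ⨆ x, f x ≠ ⊤) (hg1 : ⨆ x, g x ≠ ⊤)
    (hfgh : ∀ x y, f x ^ (w₁ : ℝ) * g y ^ (w₂ : ℝ) ≤ h (w₁ * x + w₂ * y)) :
    (∫⁻ x, f x) ^ (w₁ : ℝ) * (∫⁻ x, g x) ^ (w₂ : ℝ) ≤ ∫⁻ x, h x := by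
  have p1 : (0 : ℝ) < w₁ := by positivity
  have p2 : (0 : ℝ) < w₂ := by positivity
  by_cases F0 : ⨆ x, f x = 0
  · have : ∀ x, f x = 0 := by simpa using F0
    simp [this, p1]
  by_cases G0 : ⨆ x, g x = 0
  · have : ∀ x, g x = 0 := by simpa using G0
    simp [this, p2]
  set F := ⨆ x, f x
  set G := ⨆ x, g x
  have F1 : F ^ (w₁ : ℝ) ≠ 0 := by simp [F0, p1]
  have F2 : F ^ (w₁ : ℝ) ≠ ⊤ := by simp [hf1, F0]
  have G1 : G ^ (w₂ : ℝ) ≠ 0 := by simp [G0, p2]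
  have G2 : G ^ (w₂ : ℝ) ≠ ⊤ := by simp [hg1, G0]
  have := prekopa_leindler_real_normalized h1 h2 hw (f := fun x => F⁻¹ * f x)
    (g := fun x => G⁻¹ * g x) (h := fun x => (F ^ (w₁ : ℝ))⁻¹ * (G ^ (w₂ : ℝ))⁻¹ * h x)
    (hf.const_mul _) (hg.const_mul _) (hh.const_mul _)
    (by rw [← ENNReal.mul_iSup]; exact ENNReal.inv_mul_cancel F0 hf1)
    (by rw [← ENNReal.mul_iSup]; exact ENNReal.inv_mul_cancel G0 hg1)
    (fun x y => by
      rw [ENNReal.mul_rpow_of_nonneg _ _ p1.le, ENNReal.mul_rpow_of_nonneg _ _ p2.le,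
        ENNReal.inv_rpow, ENNReal.inv_rpow, mul_mul_mul_comm]
      gcongr
      exact hfgh x y)
  rw [lintegral_const_mul _ hf, lintegral_const_mul _ hg, lintegral_const_mul _ hh,
      ENNReal.mul_rpow_of_nonneg _ _ p1.le, ENNReal.mul_rpow_of_nonneg _ _ p2.le,
        ENNReal.inv_rpow, ENNReal.inv_rpow, mul_mul_mul_comm] at this
  refine (ENNReal.mul_le_mul_iff_right ?_ ?_).1 this
  · exact mul_ne_zero (ENNReal.inv_ne_zero.2 F2) (ENNReal.inv_ne_zero.2 G2)
  · exact ENNReal.mul_ne_top (ENNReal.inv_ne_top.2 F1) (ENNReal.inv_ne_top.2 G1)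

lemma tendsto_lintegral_min_natCast {α : Type*} [MeasurableSpace α] {μ : Measure α}
    {f : α → ℝ≥0∞} (hf : Measurable f) :
    Filter.Tendsto (fun n : ℕ => ∫⁻ x, min (f x) n ∂μ) Filter.atTop (𝓝 (∫⁻ x, f x ∂μ)) := by
  refine lintegral_tendsto_of_tendsto_of_monotone
    (fun n => (hf.min measurable_const).aemeasurable) ?_ ?_
  · refine Filter.Eventually.of_forall fun x m n hmn => ?_
    have : (m : ℝ≥0∞) ≤ n := by exact_mod_cast hmn
    exact min_le_min le_rfl this
  · refine Filter.Eventually.of_forall fun x => ?_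
    have := (tendsto_const_nhds (x := f x)).min ENNReal.tendsto_nat_nhds_top
    simpa using this

lemma prekopa_leindler_real {w₁ w₂ : ℝ≥0} (h1 : w₁ ≠ 0) (h2 : w₂ ≠ 0) (hw : w₁ + w₂ = 1)
    {f g h : ℝ → ℝ≥0∞} (hf : Measurable f) (hg : Measurable g) (hh : Measurable h)
    (hfgh : ∀ x y, f x ^ (w₁ : ℝ) * g y ^ (w₂ : ℝ) ≤ h (w₁ * x + w₂ * y)) :
    (∫⁻ x, f x) ^ (w₁ : ℝ) * (∫⁻ x, g x) ^ (w₂ : ℝ) ≤ ∫⁻ x, h x := by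
  have p1 : (0 : ℝ) < w₁ := by positivity
  have p2 : (0 : ℝ) < w₂ := by positivity
  by_cases F0 : ∫⁻ x, f x = 0
  · simp [F0, p1]
  by_cases G0 : ∫⁻ x, g x = 0
  · simp [G0, p2]
  have tf := ((ENNReal.continuous_rpow_const (y := (w₁ : ℝ))).tendsto _).comp
    (tendsto_lintegral_min_natCast (μ := volume) hf)
  have tg := ((ENNReal.continuous_rpow_const (y := (w₂ : ℝ))).tendsto _).comp
    (tendsto_lintegral_min_natCast (μ := volume) hg)
  have := ENNReal.Tendsto.mul tf (Or.inl (by simp [F0, p1, p1.not_gt])) tg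
    (Or.inl (by simp [G0, p2, p2.not_gt]))
  refine le_of_tendsto this (Filter.Eventually.of_forall fun n => ?_)
  refine prekopa_leindler_real_bounded h1 h2 hw (hf.min measurable_const)
    (hg.min measurable_const) hh ?_ ?_ ?_
  · exact ((iSup_le fun x => min_le_right (f x) (n : ℝ≥0∞)).trans_lt (ENNReal.natCast_lt_top n)).ne
  · exact ((iSup_le fun x => min_le_right (g x) (n : ℝ≥0∞)).trans_lt (ENNReal.natCast_lt_top n)).ne
  · intro x y
    refine le_trans ?_ (hfgh x y)
    gcongr <;> exact min_le_left _ _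

lemma prekopa_leindler_pi {w₁ w₂ : ℝ≥0} (h1 : w₁ ≠ 0) (h2 : w₂ ≠ 0) (hw : w₁ + w₂ = 1) (n : ℕ) :
    ∀ {f g h : (Fin n → ℝ) → ℝ≥0∞}, Measurable f → Measurable g → Measurable h →
    (∀ x y, f x ^ (w₁ : ℝ) * g y ^ (w₂ : ℝ) ≤ h ((w₁ : ℝ) • x + (w₂ : ℝ) • y)) →
    (∫⁻ x, f x) ^ (w₁ : ℝ) * (∫⁻ x, g x) ^ (w₂ : ℝ) ≤ ∫⁻ x, h x := by
  induction n with
  | zero =>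
    intro f g h hf hg hh hfgh
    have := hfgh default default
    rw [Subsingleton.elim ((w₁ : ℝ) • (default : Fin 0 → ℝ) + (w₂ : ℝ) • default) default] at this
    rw [volume_pi, Measure.pi_of_empty (fun _ => volume) (default : Fin 0 → ℝ)]
    simpa using this
  | succ n ih =>
    intro f g h hf hg hh hfgh
    set e := (MeasurableEquiv.piFinSuccAbove (fun _ : Fin (n + 1) => ℝ) 0).symm
    have hvp : MeasurePreserving e volume volume :=
      (volume_preserving_piFinSuccAbove (fun _ : Fin (n + 1) => ℝ) 0).symm _
    have key : ∀ {f : (Fin (n + 1) → ℝ) → ℝ≥0∞}, Measurable f →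
        ∫⁻ x, f x = ∫⁻ s, ∫⁻ y, f (e (s, y)) := by
      intro f hf
      rw [← hvp.lintegral_comp hf]
      exact lintegral_prod _ (hf.comp e.measurable).aemeasurable
    rw [key hf, key hg, key hh]
    refine prekopa_leindler_real h1 h2 hw
      (hf.comp e.measurable).lintegral_prod_right'
      (hg.comp e.measurable).lintegral_prod_right'
      (hh.comp e.measurable).lintegral_prod_right' ?_
    intro s t
    refine ih (by fun_prop) (by fun_prop) (by fun_prop) ?_
    intro x y
    convert hfgh (e (s, x)) (e (t, y)) using 2
    ext i
    refine Fin.cases ?_ (fun j => ?_) i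
    · simp [e, MeasurableEquiv.piFinSuccAbove]
    · simp [e, MeasurableEquiv.piFinSuccAbove]


lemma prekopa_leindler_measure {N : ℕ} {w₁ w₂ : ℝ≥0} (h1 : w₁ ≠ 0) (h2 : w₂ ≠ 0)
    (hw : w₁ + w₂ = 1) {A B C : Set (EuclideanSpace ℝ (Fin N))} (hA : MeasurableSet A)
    (hB : MeasurableSet B) (hC : MeasurableSet C)
    (h : ∀ x ∈ A, ∀ y ∈ B, (w₁ : ℝ) • x + (w₂ : ℝ) • y ∈ C) :
    volume A ^ (w₁ : ℝ) * volume B ^ (w₂ : ℝ) ≤ volume C := by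
  have p1 : (0 : ℝ) < w₁ := by positivity
  have p2 : (0 : ℝ) < w₂ := by positivity
  have hvp := PiLp.volume_preserving_toLp (Fin N)
  have key : ∀ {D : Set (EuclideanSpace ℝ (Fin N))}, MeasurableSet D →
      ∫⁻ x : Fin N → ℝ, D.indicator 1 (WithLp.toLp 2 x) = volume D := by
    intro D hD
    rw [hvp.lintegral_comp (measurable_one.indicator hD)]
    simp [lintegral_indicator hD]
  rw [← key hA, ← key hB, ← key hC]
  have hm := hvp.measurable
  refine prekopa_leindler_pi h1 h2 hw N ((measurable_one.indicator hA).comp hm)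
    ((measurable_one.indicator hB).comp hm) ((measurable_one.indicator hC).comp hm) ?_
  intro x y
  by_cases hx : WithLp.toLp 2 x ∈ A
  · by_cases hy : WithLp.toLp 2 y ∈ B
    · have := h _ hx _ hy
      simp [hx, hy, this]
    · simp [hy, p2]
  · simp [hx, p1]

lemma brunn_minkowski_of_add_mem {N : ℕ} {A K C : Set (EuclideanSpace ℝ (Fin N))} {a k : ℝ}
    (ha : 0 < a) (hk : 0 < k) (hA : MeasurableSet A) (hK : MeasurableSet K)
    (hC : MeasurableSet C) (hAa : volume A = ENNReal.ofReal (a ^ N))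
    (hKk : volume K = ENNReal.ofReal (k ^ N)) {t : ℝ} (ht : 0 < t)
    (h : ∀ x ∈ A, ∀ y ∈ K, x + t • y ∈ C) :
    ENNReal.ofReal (a ^ N + t * (N * k * a ^ (N - 1))) ≤ volume C := by
  have hs : 0 < a + t * k := by positivity
  set w₁ : ℝ≥0 := ⟨a / (a + t * k), by positivity⟩ with hw1
  set w₂ : ℝ≥0 := ⟨t * k / (a + t * k), by positivity⟩ with hw2
  have c1 : (w₁ : ℝ) = a / (a + t * k) := rfl
  have c2 : (w₂ : ℝ) = t * k / (a + t * k) := rfl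
  have p1 : (0 : ℝ) < w₁ := by rw [c1]; positivity
  have p2 : (0 : ℝ) < w₂ := by rw [c2]; positivity
  have hw : w₁ + w₂ = 1 := by
    apply NNReal.coe_injective
    push_cast
    rw [c1, c2]
    field_simp
  have n1 : (w₁ : ℝ)⁻¹ ≠ 0 := by positivity
  have n2 : t * (w₂ : ℝ)⁻¹ ≠ 0 := by positivity
  have hwR : (w₁ : ℝ) + w₂ = 1 := by exact_mod_cast hw
  have key := prekopa_leindler_measure (by exact_mod_cast p1.ne') (by exact_mod_cast p2.ne') hw
    (hA.const_smul_of_ne_zero n1) (hK.const_smul_of_ne_zero n2) hC (by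
      rintro _ ⟨x, hx, rfl⟩ _ ⟨y, hy, rfl⟩
      simp only [smul_smul]
      rw [mul_inv_cancel₀ p1.ne', one_smul, mul_left_comm, mul_inv_cancel₀ p2.ne', mul_one]
      exact h x hx y hy)
  have v1 : volume ((w₁ : ℝ)⁻¹ • A) = ENNReal.ofReal ((a + t * k) ^ N) := by
    rw [Measure.addHaar_smul, hAa, ← ENNReal.ofReal_mul (by positivity),
      abs_of_nonneg (by positivity), finrank_euclideanSpace_fin, ← mul_pow, c1]
    congr 2
    field_simp
  have v2 : volume ((t * (w₂ : ℝ)⁻¹) • K) = ENNReal.ofReal ((a + t * k) ^ N) := by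
    rw [Measure.addHaar_smul, hKk, ← ENNReal.ofReal_mul (by positivity),
      abs_of_nonneg (by positivity), finrank_euclideanSpace_fin, ← mul_pow, c2]
    congr 2
    field_simp
  rw [v1, v2, ← ENNReal.rpow_add _ _ (by simpa using pow_pos hs N) (by simp), hwR,
    ENNReal.rpow_one] at key
  refine le_trans (ENNReal.ofReal_le_ofReal ?_) key
  rcases Nat.eq_zero_or_pos N with rfl | hN
  · simp
  have hp : 0 < t * k / a := by positivity
  have hb := one_add_mul_le_pow (a := t * k / a) (by linarith) N
  have e1 : a + t * k = a * (1 + t * k / a) := by field_simp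
  rw [e1, mul_pow]
  refine le_trans (le_of_eq ?_) (mul_le_mul_of_nonneg_left hb (by positivity))
  obtain ⟨m, rfl⟩ : ∃ m, N = m + 1 := ⟨N - 1, by omega⟩
  simp only [Nat.add_sub_cancel]
  field_simp
  ring

end

section

/-- `C¹` vector fields with values in `K` and bounded derivative. -/
structure AdmissibleField {N : ℕ} (K : Set (EuclideanSpace ℝ (Fin N)))
    (σ : EuclideanSpace ℝ (Fin N) → EuclideanSpace ℝ (Fin N)) : Prop where
  contDiff : ContDiff ℝ 1 σ
  mem : ∀ x, σ x ∈ K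
  bounded : ∃ C, ∀ x, ‖fderiv ℝ σ x‖ ≤ C

section
variable {N : ℕ} {σ τ : EuclideanSpace ℝ (Fin N) → EuclideanSpace ℝ (Fin N)}
  {x : EuclideanSpace ℝ (Fin N)}

lemma sum_apply_single_mul (L : EuclideanSpace ℝ (Fin N) →L[ℝ] ℝ) (v : EuclideanSpace ℝ (Fin N)) :
    ∑ i, L (EuclideanSpace.single i 1) * v i = L v := by
  conv_rhs => rw [← (EuclideanSpace.basisFun (Fin N) ℝ).sum_repr v]
  simp [mul_comm]

lemma vdiv_add (hσ : DifferentiableAt ℝ σ x) (hτ : DifferentiableAt ℝ τ x) :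
    vdiv (fun y => σ y + τ y) x = vdiv σ x + vdiv τ x := by
  simp [vdiv, fderiv_fun_add hσ hτ, Finset.sum_add_distrib]

lemma vdiv_const (c : EuclideanSpace ℝ (Fin N)) : vdiv (fun _ => c) x = 0 := by
  simp [vdiv]

lemma vdiv_smul {φ : EuclideanSpace ℝ (Fin N) → ℝ} (hφ : DifferentiableAt ℝ φ x)
    (hσ : DifferentiableAt ℝ σ x) :
    vdiv (fun y => φ y • σ y) x = φ x * vdiv σ x + fderiv ℝ φ x (σ x) := by
  rw [← sum_apply_single_mul]
  simp [vdiv, fderiv_fun_smul hφ hσ, Finset.sum_add_distrib, Finset.mul_sum]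

lemma vdiv_const_smul (c : ℝ) (hσ : DifferentiableAt ℝ σ x) :
    vdiv (fun y => c • σ y) x = c * vdiv σ x := by
  rw [vdiv_smul (differentiableAt_const c) hσ]; simp

lemma abs_vdiv_le (σ : EuclideanSpace ℝ (Fin N) → EuclideanSpace ℝ (Fin N))
    (x : EuclideanSpace ℝ (Fin N)) : |vdiv σ x| ≤ N * ‖fderiv ℝ σ x‖ := by
  refine (Finset.abs_sum_le_sum_abs _ _).trans ?_
  refine (Finset.sum_le_card_nsmul _ _ ‖fderiv ℝ σ x‖ fun i _ => ?_).trans (by simp)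
  rw [← Real.norm_eq_abs]
  refine (PiLp.norm_apply_le _ i).trans ?_
  simpa using (fderiv ℝ σ x).le_opNorm (EuclideanSpace.single i 1)

lemma continuous_vdiv (hσ : ContDiff ℝ 1 σ) : Continuous (vdiv σ) := by
  have := hσ.continuous_fderiv one_ne_zero
  unfold vdiv
  fun_prop

lemma AdmissibleField.integrableOn_vdiv {K : Set (EuclideanSpace ℝ (Fin N))}
    (h : AdmissibleField K σ) {E : Set (EuclideanSpace ℝ (Fin N))} (hE : volume E < ⊤) :
    IntegrableOn (vdiv σ) E := by
  obtain ⟨C, hC⟩ := h.bounded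
  refine Measure.integrableOn_of_bounded (M := N * C) hE.ne
    (continuous_vdiv h.contDiff).aestronglyMeasurable ?_
  refine Filter.Eventually.of_forall fun x => ?_
  rw [Real.norm_eq_abs]
  exact (abs_vdiv_le σ x).trans (by gcongr; exact hC x)

lemma AdmissibleField.mono {K L : Set (EuclideanSpace ℝ (Fin N))} (h : AdmissibleField K σ)
    (hKL : K ⊆ L) : AdmissibleField L σ :=
  ⟨h.contDiff, fun x => hKL (h.mem x), h.bounded⟩

end

lemma exists_approx_maximizer {N : ℕ} {K : Set (EuclideanSpace ℝ (Fin N))}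
    (hKb : Bornology.IsBounded K) (hKc : Convex ℝ K) (hK0 : K.Nonempty)
    {G : EuclideanSpace ℝ (Fin N) → EuclideanSpace ℝ (Fin N) →L[ℝ] ℝ} (hG : Continuous G)
    {η : ℝ} (hη : 0 < η) :
    ∃ σ : EuclideanSpace ℝ (Fin N) → EuclideanSpace ℝ (Fin N), Continuous σ ∧
      (∀ x, σ x ∈ K) ∧ ∀ x, ∀ b ∈ K, G x b ≤ G x (σ x) + η := by
  obtain ⟨R, hR0, hR⟩ := hKb.exists_pos_norm_le
  suffices h : ∃ g : C(EuclideanSpace ℝ (Fin N), EuclideanSpace ℝ (Fin N)),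
      ∀ x, g x ∈ {c | c ∈ K ∧ ∀ b ∈ K, G x b ≤ G x c + η} by
    obtain ⟨g, hg⟩ := h
    exact ⟨g, g.continuous, fun x => (hg x).1, fun x => (hg x).2⟩
  apply exists_continuous_forall_mem_convex_of_local_const
  · intro x c hc d hd s t hs ht hst
    refine ⟨hKc hc.1 hd.1 hs ht hst, fun b hb => ?_⟩
    have h1 := hc.2 b hb
    have h2 := hd.2 b hb
    simp only [map_add, map_smul, smul_eq_mul]
    have : G x b = s * G x b + t * G x b := by rw [← add_mul, hst, one_mul]
    have : η = s * η + t * η := by rw [← add_mul, hst, one_mul]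
    nlinarith
  · intro x
    have hbdd : BddAbove (G x '' K) := by
      refine ⟨‖G x‖ * R, ?_⟩
      rintro _ ⟨b, hb, rfl⟩
      exact (le_abs_self _).trans (((G x).le_opNorm b).trans (by gcongr; exact hR b hb))
    obtain ⟨_, ⟨c, hc, rfl⟩, hcs⟩ := exists_lt_of_lt_csSup (hK0.image (G x))
      (show sSup (G x '' K) - η / 2 < sSup (G x '' K) by linarith)
    refine ⟨c, ?_⟩
    have hn : ∀ᶠ y in 𝓝 x, ‖G y - G x‖ < η / (4 * R) := by
      have := (hG.tendsto x).sub_const (G x)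
      rw [sub_self] at this
      have := this.norm
      rw [norm_zero] at this
      exact this.eventually_lt_const (by positivity)
    filter_upwards [hn] with y hy
    refine ⟨hc, fun b hb => ?_⟩
    have h1 : G x b ≤ sSup (G x '' K) := le_csSup hbdd (mem_image_of_mem _ hb)
    have h2 : ∀ b ∈ K, |G y b - G x b| ≤ η / 4 := by
      intro b hb
      calc |G y b - G x b| = ‖(G y - G x) b‖ := rfl
        _ ≤ ‖G y - G x‖ * ‖b‖ := (G y - G x).le_opNorm b
        _ ≤ η / (4 * R) * R := by gcongr; exact hR b hb
        _ = η / 4 := by field_simp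
    have h3 := abs_le.1 (h2 b hb)
    have h4 := abs_le.1 (h2 c hc)
    linarith [h3.1, h3.2, h4.1, h4.2]

lemma abs_sub_fderiv_le_of_hasCompactSupport {N : ℕ} {u : EuclideanSpace ℝ (Fin N) → ℝ}
    (hu : ContDiff ℝ 1 u) (hc : HasCompactSupport u) {R η : ℝ} (hR : 0 < R) (hη : 0 < η) :
    ∃ t, 0 < t ∧ t ≤ 1 ∧ ∀ y b, ‖b‖ ≤ R →
      |u (y - t • b) - u y + t * fderiv ℝ u y b| ≤ t * η := by
  have huc : UniformContinuous (fderiv ℝ u) :=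
    (hc.fderiv ℝ).uniformContinuous_of_continuous (hu.continuous_fderiv one_ne_zero)
  obtain ⟨δ, hδ, hδ'⟩ := Metric.uniformContinuous_iff.1 huc (η / R) (by positivity)
  refine ⟨min 1 (δ / (2 * R)), by positivity, min_le_left _ _, fun y b hb => ?_⟩
  set t := min 1 (δ / (2 * R))
  have ht : 0 < t := by positivity
  have htb : ‖t • b‖ < δ := by
    rw [norm_smul, Real.norm_of_nonneg ht.le]
    calc t * ‖b‖ ≤ δ / (2 * R) * R := by gcongr; exact min_le_right _ _
      _ = δ / 2 := by field_simp
      _ < δ := by linarith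
  have := (convex_ball y δ).norm_image_sub_le_of_norm_fderiv_le' (f := u) (φ := fderiv ℝ u y)
    (C := η / R) (x := y) (y := y - t • b)
    (fun z _ => (hu.differentiable one_ne_zero) z)
    (fun z hz => by rw [← dist_eq_norm]; exact (hδ' hz).le) (mem_ball_self hδ) (by simpa using htb)
  have e1 : y - t • b - y = -(t • b) := by abel
  rw [e1, map_neg, map_smul, norm_neg, norm_smul, Real.norm_of_nonneg ht.le, Real.norm_eq_abs,
    sub_neg_eq_add, smul_eq_mul] at this
  refine this.trans ?_
  calc η / R * (t * ‖b‖) ≤ η / R * (t * R) := by gcongr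
    _ = t * η := by field_simp

lemma ofReal_pow_rpow_inv {N : ℕ} (hN : N ≠ 0) {a : ℝ≥0∞} (ha : a ≠ ⊤) :
    a = ENNReal.ofReal ((a.toReal ^ (1 / (N : ℝ))) ^ N) := by
  rw [← Real.rpow_natCast, ← Real.rpow_mul ENNReal.toReal_nonneg,
    one_div_mul_cancel (by exact_mod_cast hN), Real.rpow_one, ENNReal.ofReal_toReal ha]

end

section

lemma exists_field_of_superlevel {N : ℕ} (hN : N ≠ 0) {K : Set (EuclideanSpace ℝ (Fin N))}
    (hKo : IsOpen K) (hKb : Bornology.IsBounded K) (hKc : Convex ℝ K) (hK0 : 0 ∈ K) {k : ℝ}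
    (hk : 0 < k) (hKk : volume K = ENNReal.ofReal (k ^ N)) {u : EuclideanSpace ℝ (Fin N) → ℝ}
    (hu : ContDiff ℝ 1 u) (hc : HasCompactSupport u) (hu0 : ∀ x, 0 ≤ u x) {s₀ α : ℝ} (hs₀ : 0 < s₀)
    (hα : 0 < α) (huα : ENNReal.ofReal (α ^ N) ≤ volume {x | s₀ < u x}) {ε : ℝ} (hε : 0 < ε) :
    ∃ σ : EuclideanSpace ℝ (Fin N) → EuclideanSpace ℝ (Fin N), Continuous σ ∧
      (∀ x, σ x ∈ K) ∧ s₀ * (N * k * α ^ (N - 1)) - ε ≤ -∫ x, fderiv ℝ u x (σ x) := by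
  obtain ⟨R, hR0, hR⟩ := hKb.exists_pos_norm_le
  obtain ⟨R₀, hR₀0, hR₀⟩ := hc.isCompact.isBounded.exists_pos_norm_le
  set D : Set (EuclideanSpace ℝ (Fin N)) := closedBall 0 (R₀ + R) with hD
  set m := volume.real D with hm
  have hm0 : 0 ≤ m := measureReal_nonneg
  have hDfin : volume D ≠ ⊤ := measure_closedBall_lt_top.ne
  set η := ε / (2 * (m + 1)) with hη
  have hη0 : 0 < η := by positivity
  have hcu' := hu.continuous_fderiv one_ne_zero
  obtain ⟨σ, hσc, hσK, hσ⟩ := exists_approx_maximizer hKb hKc ⟨0, hK0⟩ hcu'.neg hη0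
  obtain ⟨t, ht0, ht1, ht⟩ := abs_sub_fderiv_le_of_hasCompactSupport hu hc hR0 hη0
  have hGc : Continuous fun x => fderiv ℝ u x (σ x) := hcu'.clm_apply hσc
  have hGs : HasCompactSupport fun x => fderiv ℝ u x (σ x) := by
    refine (hc.fderiv ℝ).mono ?_
    intro x hx h
    simp [h] at hx
  have hGi : Integrable fun x => fderiv ℝ u x (σ x) := hGc.integrable_of_hasCompactSupport hGs
  have hui : Integrable u := hu.continuous.integrable_of_hasCompactSupport hc
  have hDi : Integrable (D.indicator fun _ => (2 * η : ℝ)) :=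
    (integrableOn_const hDfin).integrable_indicator isClosed_closedBall.measurableSet
  have hgi : Integrable fun y => -(fderiv ℝ u y (σ y)) + D.indicator (fun _ => 2 * η) y :=
    hGi.neg.add hDi
  set w : EuclideanSpace ℝ (Fin N) → ℝ := fun y =>
    u y + t * (-(fderiv ℝ u y (σ y)) + D.indicator (fun _ => 2 * η) y) with hw
  have hwi : Integrable w := hui.add (hgi.const_mul t)
  have hwint : ∫ y, w y = (∫ y, u y) + t * (-(∫ y, fderiv ℝ u y (σ y)) + 2 * η * m) := by
    have h1 : ∫ y, -(fderiv ℝ u y (σ y)) + D.indicator (fun _ => 2 * η) y =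
        (∫ y, -(fderiv ℝ u y (σ y))) + ∫ y, D.indicator (fun _ => 2 * η) y :=
      integral_add hGi.neg hDi
    rw [integral_add hui (hgi.const_mul t), integral_const_mul, h1, integral_neg,
      integral_indicator isClosed_closedBall.measurableSet]
    rw [setIntegral_const, smul_eq_mul, mul_comm (volume.real _)]
  have huw : ∀ y ∈ D, ∀ b ∈ K, u (y - t • b) ≤ w y := by
    intro y hy b hb
    have h1 := abs_le.1 (ht y b (hR b hb))
    have h2 := hσ y b hb
    have h4 : t * ((-fderiv ℝ u y) b) ≤ t * ((-fderiv ℝ u y) (σ y) + η) :=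
      mul_le_mul_of_nonneg_left h2 ht0.le
    simp only [neg_apply] at h4
    simp only [hw, indicator_of_mem hy]
    linarith [h1.1, h1.2]
  have hout : ∀ y, y ∉ D → y ∉ tsupport u := by
    intro y hy hyu
    refine hy ?_
    simp only [hD, mem_closedBall, dist_zero_right]
    linarith [hR₀ y hyu]
  have hw0 : ∀ y, 0 ≤ w y := by
    intro y
    by_cases hy : y ∈ D
    · refine (hu0 y).trans ?_
      simpa using huw y hy 0 hK0
    · have h1 : u y = 0 := image_eq_zero_of_notMem_tsupport (hout y hy)
      have h2 : fderiv ℝ u y = 0 :=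
        image_eq_zero_of_notMem_tsupport fun h => hout y hy (tsupport_fderiv_subset ℝ h)
      simp [hw, h1, h2, hy]
  have hlevel : ∀ s : ℝ, 0 < s → s < s₀ → volume {y | s < u y} +
      ENNReal.ofReal (t * (N * k * α ^ (N - 1))) ≤ volume {y | s < w y} := by
    intro s hs hs'
    have hsub : {y | s < u y} ⊆ tsupport u := fun y hy => by
      refine subset_tsupport _ ?_
      simp only [Function.mem_support]
      exact (hs.trans hy).ne'
    have hfin : volume {y | s < u y} ≠ ⊤ :=
      ((measure_mono hsub).trans_lt hc.isCompact.measure_lt_top).ne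
    have ha := ofReal_pow_rpow_inv hN hfin
    set a := (volume {y | s < u y}).toReal ^ (1 / (N : ℝ)) with ha'
    have ha0 : 0 ≤ a := by positivity
    have hαa : α ≤ a := by
      have h1 : ENNReal.ofReal (α ^ N) ≤ ENNReal.ofReal (a ^ N) := by
        rw [← ha]
        exact huα.trans (measure_mono fun x hx => hs'.trans hx)
      rw [ENNReal.ofReal_le_ofReal_iff (by positivity)] at h1
      exact le_of_pow_le_pow_left₀ hN ha0 h1
    refine le_trans ?_ (brunn_minkowski_of_add_mem (hα.trans_le hαa) hk
      (isOpen_lt continuous_const hu.continuous).measurableSet hKo.measurableSet ?_ ha hKk ht0 ?_)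
    · rw [ENNReal.ofReal_add (by positivity) (by positivity), ← ha]
      gcongr
    · exact measurableSet_lt measurable_const (by
        refine hu.continuous.measurable.add (measurable_const.mul (hGc.measurable.neg.add ?_))
        exact measurable_const.indicator isClosed_closedBall.measurableSet)
    · intro x hx b hb
      have hxD : x + t • b ∈ D := by
        simp only [hD, mem_closedBall, dist_zero_right]
        refine (norm_add_le _ _).trans (add_le_add (hR₀ x (hsub hx)) ?_)
        rw [norm_smul, Real.norm_of_nonneg ht0.le]
        calc t * ‖b‖ ≤ 1 * R := by gcongr; exact hR b hb
          _ = R := one_mul R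
      have := huw _ hxD b hb
      rw [add_sub_cancel_right] at this
      exact lt_of_lt_of_le hx this
  have hmono : ∀ s : ℝ, 0 < s → volume {y | s < u y} ≤ volume {y | s < w y} := by
    intro s hs
    refine measure_mono fun y hy => ?_
    have hyD : y ∈ D := by
      by_contra h
      have : u y = 0 := image_eq_zero_of_notMem_tsupport (hout y h)
      rw [Set.mem_ofPred_eq, this] at hy
      exact lt_asymm hs hy
    have := huw y hyD 0 hK0
    rw [smul_zero, sub_zero] at this
    exact lt_of_lt_of_le hy this
  have hmain : (∫ y, u y) + s₀ * (t * (N * k * α ^ (N - 1))) ≤ ∫ y, w y := by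
    have hp : 0 ≤ t * (N * k * α ^ (N - 1)) := by positivity
    rw [← ENNReal.ofReal_le_ofReal_iff (integral_nonneg hw0),
      ENNReal.ofReal_add (integral_nonneg hu0) (by positivity),
      ofReal_integral_eq_lintegral_ofReal hui (Filter.Eventually.of_forall hu0),
      ofReal_integral_eq_lintegral_ofReal hwi (Filter.Eventually.of_forall hw0),
      lintegral_eq_lintegral_meas_lt _ (Filter.Eventually.of_forall hu0) hui.1.aemeasurable,
      lintegral_eq_lintegral_meas_lt _ (Filter.Eventually.of_forall hw0) hwi.1.aemeasurable]
    have e1 : ENNReal.ofReal (s₀ * (t * (N * k * α ^ (N - 1)))) = ∫⁻ s in Ioi (0 : ℝ),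
        (Iio s₀).indicator (fun _ => ENNReal.ofReal (t * (N * k * α ^ (N - 1)))) s := by
      rw [lintegral_indicator measurableSet_Iio, Measure.restrict_restrict measurableSet_Iio,
        setLIntegral_const, Iio_inter_Ioi, Real.volume_Ioo, sub_zero, mul_comm s₀,
        ENNReal.ofReal_mul hp]
    rw [e1, ← lintegral_add_right _ (measurable_const.indicator measurableSet_Iio)]
    refine setLIntegral_mono' measurableSet_Ioi fun s hs => ?_
    by_cases hs' : s < s₀
    · rw [indicator_of_mem (by exact hs')]
      exact hlevel s hs hs'
    · rw [indicator_of_notMem (by simpa using hs'), add_zero]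
      exact hmono s hs
  refine ⟨σ, hσc, hσK, ?_⟩
  rw [hwint] at hmain
  have h5 : t * (s₀ * (N * k * α ^ (N - 1))) ≤ t * (-(∫ y, fderiv ℝ u y (σ y)) + 2 * η * m) := by
    linarith
  have h6 := le_of_mul_le_mul_left h5 ht0
  have h7 : 2 * η * m ≤ ε := by
    rw [hη]
    have : 2 * (ε / (2 * (m + 1))) * m = ε * (m / (m + 1)) := by field_simp
    rw [this]
    refine mul_le_of_le_one_right hε.le ?_
    rw [div_le_one (by positivity)]
    linarith
  linarith

end

section
open scoped Convolution
open ContinuousLinearMap (lsmul)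

section Mollify
variable {N : ℕ} {F : Type*} [NormedAddCommGroup F] [NormedSpace ℝ F]

lemma hasFDerivAt_lsmul_convolution {ρ : EuclideanSpace ℝ (Fin N) → ℝ} (hρ : ContDiff ℝ 1 ρ)
    (hρc : HasCompactSupport ρ) {g : EuclideanSpace ℝ (Fin N) → F} (hg : LocallyIntegrable g)
    (x : EuclideanSpace ℝ (Fin N)) :
    HasFDerivAt (ρ ⋆[lsmul ℝ ℝ, volume] g)
      ((fderiv ℝ ρ ⋆[(lsmul ℝ ℝ).precompL (EuclideanSpace ℝ (Fin N)), volume] g) x) x :=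
  hρc.hasFDerivAt_convolution_left _ hρ hg x

lemma integrable_fderiv_smul {ρ : EuclideanSpace ℝ (Fin N) → ℝ} (hρ : ContDiff ℝ 1 ρ)
    (hρc : HasCompactSupport ρ) {g : EuclideanSpace ℝ (Fin N) → F} (hg : LocallyIntegrable g)
    (x : EuclideanSpace ℝ (Fin N)) :
    Integrable fun y =>
      ((lsmul ℝ ℝ).precompL (EuclideanSpace ℝ (Fin N)) (fderiv ℝ ρ (x - y))) (g y) := by
  have := ((hρc.fderiv ℝ).convolutionExists_left ((lsmul ℝ ℝ).precompL (EuclideanSpace ℝ (Fin N)))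
    (hρ.continuous_fderiv one_ne_zero) hg x).comp_sub_left x
  simpa using this

lemma fderiv_lsmul_convolution_apply [CompleteSpace F]
    {ρ : EuclideanSpace ℝ (Fin N) → ℝ} (hρ : ContDiff ℝ 1 ρ)
    (hρc : HasCompactSupport ρ) {g : EuclideanSpace ℝ (Fin N) → F} (hg : LocallyIntegrable g)
    (x v : EuclideanSpace ℝ (Fin N)) :
    fderiv ℝ (ρ ⋆[lsmul ℝ ℝ, volume] g) x v = ∫ y, fderiv ℝ ρ (x - y) v • g y := by
  rw [(hasFDerivAt_lsmul_convolution hρ hρc hg x).fderiv, convolution_eq_swap,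
    ContinuousLinearMap.integral_apply (integrable_fderiv_smul hρ hρc hg x)]
  simp

lemma vdiv_lsmul_convolution {ρ : EuclideanSpace ℝ (Fin N) → ℝ} (hρ : ContDiff ℝ 1 ρ)
    (hρc : HasCompactSupport ρ) {ζ : EuclideanSpace ℝ (Fin N) → EuclideanSpace ℝ (Fin N)}
    (hζ : LocallyIntegrable ζ) (x : EuclideanSpace ℝ (Fin N)) :
    vdiv (ρ ⋆[lsmul ℝ ℝ, volume] ζ) x = ∫ y, fderiv ℝ ρ (x - y) (ζ y) := by
  have hi : ∀ i : Fin N,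
      Integrable fun y => fderiv ℝ ρ (x - y) (EuclideanSpace.single i 1) • ζ y := by
    intro i
    have := (integrable_fderiv_smul hρ hρc hζ x).apply_continuousLinearMap
      (EuclideanSpace.single i 1)
    simpa using this
  have hi' : ∀ i : Fin N, Integrable fun y =>
      fderiv ℝ ρ (x - y) (EuclideanSpace.single i 1) * ζ y i := by
    intro i
    exact (EuclideanSpace.proj (𝕜 := ℝ) i).integrable_comp (hi i)
  have h1 : ∀ i : Fin N, fderiv ℝ (ρ ⋆[lsmul ℝ ℝ, volume] ζ) x (EuclideanSpace.single i 1) i =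
      ∫ y, fderiv ℝ ρ (x - y) (EuclideanSpace.single i 1) * ζ y i := by
    intro i
    rw [fderiv_lsmul_convolution_apply hρ hρc hζ]
    exact ((EuclideanSpace.proj (𝕜 := ℝ) i).integral_comp_comm (hi i)).symm
  unfold vdiv
  simp_rw [h1]
  rw [← integral_finsetSum _ fun i _ => hi' i]
  simp_rw [sum_apply_single_mul]

lemma setIntegral_vdiv_lsmul_convolution {ρ : EuclideanSpace ℝ (Fin N) → ℝ} (hρ : ContDiff ℝ 1 ρ)
    (hρc : HasCompactSupport ρ) (hρe : ∀ x, ρ (-x) = ρ x)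
    {ζ : EuclideanSpace ℝ (Fin N) → EuclideanSpace ℝ (Fin N)} (hζ : Integrable ζ)
    {E : Set (EuclideanSpace ℝ (Fin N))} (hE : MeasurableSet E) (hEf : volume E < ⊤) :
    ∫ x in E, vdiv (ρ ⋆[lsmul ℝ ℝ, volume] ζ) x =
      -∫ y, fderiv ℝ (ρ ⋆[lsmul ℝ ℝ, volume] E.indicator fun _ => (1 : ℝ)) y (ζ y) := by
  have hEi : Integrable (E.indicator fun _ => (1 : ℝ)) :=
    (integrableOn_const hEf.ne).integrable_indicator hE
  have hρ'i : Integrable (fderiv ℝ ρ) :=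
    (hρ.continuous_fderiv one_ne_zero).integrable_of_hasCompactSupport (hρc.fderiv ℝ)
  have hodd : ∀ x, fderiv ℝ ρ (-x) = -fderiv ℝ ρ x := by
    intro x
    have h1 : HasFDerivAt (fun y => ρ (-y))
        ((fderiv ℝ ρ (-x)).comp (-ContinuousLinearMap.id ℝ _)) x :=
      ((hρ.differentiable one_ne_zero (-x)).hasFDerivAt).comp x (hasFDerivAt_id x).neg
    simp only [hρe] at h1
    rw [h1.fderiv]
    ext v
    simp
  simp_rw [vdiv_lsmul_convolution hρ hρc hζ.locallyIntegrable,
    fderiv_lsmul_convolution_apply hρ hρc hEi.locallyIntegrable]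
  have hintg := hζ.convolution_integrand (ContinuousLinearMap.apply ℝ ℝ) hρ'i (μ := volume)
  simp only [ContinuousLinearMap.apply_apply] at hintg
  have hintg' : Integrable (fun p : EuclideanSpace ℝ (Fin N) × EuclideanSpace ℝ (Fin N) =>
      fderiv ℝ ρ (p.1 - p.2) (ζ p.2)) ((volume.restrict E).prod volume) := by
    have h1 : (volume.restrict E).prod (volume : Measure (EuclideanSpace ℝ (Fin N))) =
        (volume.prod volume).restrict (E ×ˢ univ) := by
      rw [← Measure.prod_restrict, Measure.restrict_univ]
    rw [h1]
    exact hintg.restrict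
  rw [integral_integral_swap hintg', ← integral_neg]
  refine integral_congr_ae (Filter.Eventually.of_forall fun y => ?_)
  simp only
  rw [← integral_indicator hE, ← integral_neg]
  refine integral_congr_ae (Filter.Eventually.of_forall fun x => ?_)
  by_cases hx : x ∈ E
  · have h2 := hodd (y - x)
    rw [neg_sub] at h2
    simp [hx, h2]
  · simp [hx]

end Mollify

end

section
open scoped Convolution
open ContinuousLinearMap (lsmul)

lemma exists_cutoff (N : ℕ) : ∃ C : ℝ, 0 ≤ C ∧ ∀ L : ℝ, 0 < L →
    ∃ χ : EuclideanSpace ℝ (Fin N) → ℝ, ContDiff ℝ 1 χ ∧ HasCompactSupport χ ∧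
      (∀ x, χ x ∈ Icc (0 : ℝ) 1) ∧ (∀ x ∈ ball 0 L, χ x = 1) ∧ ∀ x, ‖fderiv ℝ χ x‖ ≤ C / L := by
  let b : ContDiffBump (0 : EuclideanSpace ℝ (Fin N)) := ⟨1, 2, one_pos, one_lt_two⟩
  have hb : ContDiff ℝ 1 b := b.contDiff
  obtain ⟨C, hC⟩ := (b.hasCompactSupport.fderiv ℝ).exists_bound_of_continuous
    (hb.continuous_fderiv one_ne_zero)
  have hC0 : 0 ≤ C := (norm_nonneg _).trans (hC 0)
  refine ⟨C, hC0, fun L hL => ⟨fun x => b (L⁻¹ • x), hb.comp (by fun_prop), ?_, ?_, ?_, ?_⟩⟩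
  · exact b.hasCompactSupport.comp_smul (inv_ne_zero hL.ne')
  · exact fun x => ⟨b.nonneg, b.le_one⟩
  · intro x hx
    refine b.one_of_mem_closedBall ?_
    simp only [mem_ball, dist_zero_right] at hx
    simp only [mem_closedBall, dist_zero_right, norm_smul, norm_inv, Real.norm_of_nonneg hL.le]
    show L⁻¹ * ‖x‖ ≤ 1
    rw [inv_mul_le_one₀ hL]
    exact hx.le
  · intro x
    rw [fderiv_comp_smul, norm_smul, norm_inv, Real.norm_of_nonneg hL.le, div_eq_inv_mul]
    gcongr
    exact hC _

lemma exists_lt_one_approx (N : ℕ) {k a ε : ℝ} (ha : 0 < a) (hε : 0 < ε) :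
    ∃ s α : ℝ, 0 < s ∧ s < 1 ∧ 0 < α ∧ α < a ∧
      N * k * a ^ (N - 1) - ε ≤ s * (N * k * α ^ (N - 1)) := by
  have hcont : ContinuousAt (fun s : ℝ => s * (N * k * (s * a) ^ (N - 1))) 1 := by fun_prop
  have h1 : ∀ᶠ s in 𝓝 (1 : ℝ), N * k * a ^ (N - 1) - ε < s * (N * k * (s * a) ^ (N - 1)) := by
    refine hcont.eventually_const_lt ?_
    simp only [one_mul]
    linarith
  have h2 := (h1.filter_mono nhdsWithin_le_nhds).and
    (Ioo_mem_nhdsLT (zero_lt_one (α := ℝ)))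
  obtain ⟨s, hs, hs0, hs1⟩ := h2.exists
  exact ⟨s, s * a, hs0, hs1, by positivity, by nlinarith, hs.le⟩

section WulffField
variable {N : ℕ} {K : Set (EuclideanSpace ℝ (Fin N))}

lemma convolution_normed_mem {φ : ContDiffBump (0 : EuclideanSpace ℝ (Fin N))}
    {F : Type*} [NormedAddCommGroup F] [NormedSpace ℝ F] [CompleteSpace F] {K : Set F}
    (hKc : Convex ℝ K) (hKcl : IsClosed K) {ζ : EuclideanSpace ℝ (Fin N) → F}
    (hζ : LocallyIntegrable ζ) (hK : ∀ x, ζ x ∈ K) (x : EuclideanSpace ℝ (Fin N)) :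
    (φ.normed volume ⋆[lsmul ℝ ℝ, volume] ζ) x ∈ K := by
  have hm : Measurable fun y => (φ.normed volume y).toNNReal :=
    φ.continuous_normed.measurable.real_toNNReal
  set μ := (volume : Measure (EuclideanSpace ℝ (Fin N))).withDensity
    fun y => ((φ.normed volume y).toNNReal : ℝ≥0∞) with hμ
  have hprob : IsProbabilityMeasure μ := by
    refine ⟨?_⟩
    rw [hμ, withDensity_apply _ MeasurableSet.univ, Measure.restrict_univ]
    have := ofReal_integral_eq_lintegral_ofReal (φ.integrable_normed (μ := volume))
      (Filter.Eventually.of_forall φ.nonneg_normed)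
    rw [φ.integral_normed, ENNReal.ofReal_one] at this
    exact this.symm
  have hintg : Integrable (fun y => φ.normed volume y • ζ (x - y)) := by
    have := φ.hasCompactSupport_normed.convolutionExists_left (lsmul ℝ ℝ)
      (φ.continuous_normed (μ := volume)) hζ x
    exact this
  have hnn : ∀ y, (((φ.normed volume y).toNNReal : ℝ≥0) : ℝ) = φ.normed volume y := fun y =>
    Real.coe_toNNReal _ (φ.nonneg_normed y)
  have h2 := hKc.integral_mem (μ := μ) (f := fun y => ζ (x - y)) hKcl
    (Filter.Eventually.of_forall fun y => hK _)
    (by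
      rw [hμ, integrable_withDensity_iff_integrable_smul hm]
      simpa [NNReal.smul_def, hnn] using hintg)
  rw [hμ, integral_withDensity_eq_integral_smul hm] at h2
  simpa [NNReal.smul_def, hnn, convolution] using h2

lemma exists_bump_superlevel {E : Set (EuclideanSpace ℝ (Fin N))} (hE : MeasurableSet E)
    (hEf : volume E < ⊤) {m : ℝ≥0∞} {D : Set (EuclideanSpace ℝ (Fin N))}
    (hm : m < volume (E ∩ D)) {s : ℝ} (hs : s < 1) :
    ∃ φ : ContDiffBump (0 : EuclideanSpace ℝ (Fin N)), m ≤ volume {x | x ∈ D ∧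
      s < (φ.normed volume ⋆[lsmul ℝ ℝ, volume] E.indicator fun _ => (1 : ℝ)) x} := by
  let φ : ℕ → ContDiffBump (0 : EuclideanSpace ℝ (Fin N)) := fun n =>
    ⟨1 / ((n : ℝ) + 1), 2 * (1 / ((n : ℝ) + 1)), by positivity, by
      have : 0 < 1 / ((n : ℝ) + 1) := by positivity
      linarith⟩
  set f : ℕ → EuclideanSpace ℝ (Fin N) → ℝ := fun n =>
    (φ n).normed volume ⋆[lsmul ℝ ℝ, volume] E.indicator fun _ => (1 : ℝ)
  have hEi : Integrable (E.indicator fun _ => (1 : ℝ)) :=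
    (integrableOn_const hEf.ne).integrable_indicator hE
  have hae : ∀ᵐ x, Filter.Tendsto (fun n => f n x) Filter.atTop
      (𝓝 (E.indicator (fun _ => (1 : ℝ)) x)) := by
    refine ContDiffBump.ae_convolution_tendsto_right_of_locallyIntegrable
      (K := 2) (μ := volume) ?_ ?_
      hEi.locallyIntegrable
    · have := (tendsto_one_div_add_atTop_nhds_zero_nat (𝕜 := ℝ)).const_mul 2
      rw [mul_zero] at this
      exact this
    · exact Filter.Eventually.of_forall fun n => le_rfl
  have hfc : ∀ n, Continuous (f n) := fun n =>
    (φ n).hasCompactSupport_normed.continuous_convolution_left _ (φ n).continuous_normed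
      hEi.locallyIntegrable
  have hfin : IsFiniteMeasure (volume.restrict (E ∩ D)) :=
    ⟨by simpa using (measure_mono inter_subset_left).trans_lt hEf⟩
  have htm := tendstoInMeasure_of_tendsto_ae (μ := volume.restrict (E ∩ D))
    (fun n => (hfc n).aestronglyMeasurable) (ae_restrict_of_ae hae)
  have h1 := htm (ENNReal.ofReal (1 - s)) (by simpa using hs)
  obtain ⟨n, hn⟩ := (h1.eventually_lt_const (tsub_pos_of_lt hm)).exists
  refine ⟨φ n, ?_⟩
  set P := {x | ENNReal.ofReal (1 - s) ≤ edist (f n x) (E.indicator (fun _ => (1 : ℝ)) x)}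
  have hsub : E ∩ D ⊆ {x | x ∈ D ∧ s < f n x} ∪ (P ∩ (E ∩ D)) := by
    intro x hx
    by_cases h : s < f n x
    · exact Or.inl ⟨hx.2, h⟩
    · refine Or.inr ⟨?_, hx⟩
      simp only [P, Set.mem_ofPred_eq, indicator_of_mem hx.1, edist_dist]
      refine ENNReal.ofReal_le_ofReal ?_
      rw [Real.dist_eq, abs_sub_comm]
      exact le_trans (by linarith) (le_abs_self _)
  have hle : volume (P ∩ (E ∩ D)) ≤ volume.restrict (E ∩ D) P :=
    Measure.le_restrict_apply _ _
  have h2 : volume (E ∩ D) ≤ volume {x | x ∈ D ∧ s < f n x} + volume (P ∩ (E ∩ D)) :=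
    (measure_mono hsub).trans (measure_union_le _ _)
  have h3 : volume (E ∩ D) ≤ volume {x | x ∈ D ∧ s < f n x} + (volume (E ∩ D) - m) :=
    h2.trans (by gcongr; exact hle.trans hn.le)
  have hne : volume (E ∩ D) ≠ ⊤ := ((measure_mono inter_subset_left).trans_lt hEf).ne
  have h4 : m + (volume (E ∩ D) - m) ≤ volume {x | x ∈ D ∧ s < f n x} + (volume (E ∩ D) - m) := by
    rwa [add_tsub_cancel_of_le hm.le]
  exact (ENNReal.add_le_add_iff_right (ENNReal.sub_ne_top hne)).1 h4

end WulffField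

end

section
open scoped Convolution
open ContinuousLinearMap (lsmul)

variable {N : ℕ} {K : Set (EuclideanSpace ℝ (Fin N))}

lemma exists_ball_lt_measure_inter {E : Set (EuclideanSpace ℝ (Fin N))} {m : ℝ≥0∞}
    (hm : m < volume E) (L₀ : ℝ) : ∃ L, L₀ ≤ L ∧ m < volume (E ∩ ball 0 L) := by
  have h1 : Filter.Tendsto (fun n : ℕ => volume (E ∩ ball 0 n)) Filter.atTop
      (𝓝 (volume (⋃ n : ℕ, E ∩ ball 0 (n : ℝ)))) :=
    tendsto_measure_iUnion_atTop fun i j hij =>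
      inter_subset_inter_right _ (ball_subset_ball (by exact_mod_cast hij))
  rw [← inter_iUnion, iUnion_ball_nat, inter_univ] at h1
  obtain ⟨n, hn, hn'⟩ := ((h1.eventually_const_lt hm).and
    (Filter.eventually_ge_atTop ⌈L₀⌉₊)).exists
  exact ⟨n, Nat.ceil_le.1 hn', hn⟩

lemma neg_integral_fderiv_smul_cutoff_ge {χ f : EuclideanSpace ℝ (Fin N) → ℝ}
    {σ : EuclideanSpace ℝ (Fin N) → EuclideanSpace ℝ (Fin N)} (hχ : ContDiff ℝ 1 χ)
    (hχc : HasCompactSupport χ) {c R : ℝ} (hχd : ∀ x, ‖fderiv ℝ χ x‖ ≤ c) (hf : ContDiff ℝ 1 f)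
    (hf0 : ∀ x, 0 ≤ f x) (hfi : Integrable f) (hσc : Continuous σ) (hσR : ∀ x, ‖σ x‖ ≤ R) :
    -(∫ x, fderiv ℝ (fun y => χ y * f y) x (σ x)) - c * R * (∫ x, f x) ≤
      -∫ x, fderiv ℝ f x (χ x • σ x) := by
  have hc0 : 0 ≤ c := (norm_nonneg _).trans (hχd 0)
  have hprod : ∀ x, fderiv ℝ f x (χ x • σ x) =
      fderiv ℝ (fun y => χ y * f y) x (σ x) - f x * fderiv ℝ χ x (σ x) := by
    intro x
    rw [fderiv_fun_mul (hχ.differentiable one_ne_zero x) (hf.differentiable one_ne_zero x)]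
    simp
  have hi1 : Integrable fun x => fderiv ℝ (fun y => χ y * f y) x (σ x) := by
    refine (((hχ.mul hf).continuous_fderiv one_ne_zero).clm_apply
      hσc).integrable_of_hasCompactSupport ?_
    refine ((hχc.mul_right (f' := f)).fderiv ℝ).mono fun x hx h => ?_
    refine hx ?_
    have : fderiv ℝ (fun y => χ y * f y) x = 0 := h
    simp [this]
  have hbd : ∀ x, ‖f x * fderiv ℝ χ x (σ x)‖ ≤ c * R * f x := by
    intro x
    rw [norm_mul, Real.norm_of_nonneg (hf0 x), mul_comm]
    have := ((fderiv ℝ χ x).le_opNorm (σ x)).trans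
      (mul_le_mul (hχd x) (hσR x) (norm_nonneg _) hc0)
    exact mul_le_mul_of_nonneg_right this (hf0 x)
  have hi2 : Integrable fun x => f x * fderiv ℝ χ x (σ x) := by
    refine (hfi.const_mul (c * R)).mono' ?_ (Filter.Eventually.of_forall hbd)
    exact (hf.continuous.mul
      ((hχ.continuous_fderiv one_ne_zero).clm_apply hσc)).aestronglyMeasurable
  simp_rw [hprod]
  rw [integral_sub hi1 hi2]
  have h2 : |∫ x, f x * fderiv ℝ χ x (σ x)| ≤ c * R * ∫ x, f x := by
    rw [← integral_const_mul]
    exact norm_integral_le_of_norm_le (hfi.const_mul _) (Filter.Eventually.of_forall hbd)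
  linarith [(abs_le.1 h2).1]

lemma admissibleField_normed_convolution (φ : ContDiffBump (0 : EuclideanSpace ℝ (Fin N)))
    (hKc : Convex ℝ K) {ζ : EuclideanSpace ℝ (Fin N) → EuclideanSpace ℝ (Fin N)}
    (hζc : Continuous ζ) (hζs : HasCompactSupport ζ) (hζK : ∀ x, ζ x ∈ K) :
    AdmissibleField (closure K) (φ.normed volume ⋆[lsmul ℝ ℝ, volume] ζ) := by
  have hζi : Integrable ζ := hζc.integrable_of_hasCompactSupport hζs
  have hg : ContDiff ℝ 1 (φ.normed volume ⋆[lsmul ℝ ℝ, volume] ζ) :=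
    φ.hasCompactSupport_normed.contDiff_convolution_left (lsmul ℝ ℝ)
      (φ.contDiff_normed (μ := volume) (n := 1)) hζi.locallyIntegrable
  have hs : HasCompactSupport (φ.normed volume ⋆[lsmul ℝ ℝ, volume] ζ) :=
    φ.hasCompactSupport_normed.convolution _ hζs
  have hb : ∃ C, ∀ x, ‖fderiv ℝ (φ.normed volume ⋆[lsmul ℝ ℝ, volume] ζ) x‖ ≤ C :=
    (hs.fderiv ℝ).exists_bound_of_continuous (hg.continuous_fderiv one_ne_zero)
  have hm : ∀ x, (φ.normed volume ⋆[lsmul ℝ ℝ, volume] ζ) x ∈ closure K := by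
    have h1 : ∀ x, ζ x ∈ closure K := fun x => subset_closure (hζK x)
    have h2 := @convolution_normed_mem N φ (EuclideanSpace ℝ (Fin N)) _ _ _ (closure K)
      hKc.closure isClosed_closure ζ
    exact h2 hζi.locallyIntegrable h1
  exact .mk hg hm hb

lemma exists_field_closure_of_zero_mem (hN : N ≠ 0) (hKo : IsOpen K)
    (hKb : Bornology.IsBounded K) (hKc : Convex ℝ K) (hK0 : 0 ∈ K) {k : ℝ} (hk : 0 < k)
    (hKk : volume K = ENNReal.ofReal (k ^ N)) {E : Set (EuclideanSpace ℝ (Fin N))}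
    (hE : MeasurableSet E) {a : ℝ} (ha : 0 < a) (hEa : volume E = ENNReal.ofReal (a ^ N))
    {ε : ℝ} (hε : 0 < ε) :
    ∃ σ, AdmissibleField (closure K) σ ∧ N * k * a ^ (N - 1) - ε ≤ ∫ x in E, vdiv σ x := by
  have hEf : volume E < ⊤ := hEa ▸ ENNReal.ofReal_lt_top
  obtain ⟨s, α, hs0, hs1, hα0, hαa, hsα⟩ := exists_lt_one_approx N (k := k) ha
    (show 0 < ε / 3 by positivity)
  obtain ⟨R, hR0, hR⟩ := hKb.exists_pos_norm_le
  obtain ⟨C, hC0, hC⟩ := exists_cutoff N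
  set m := volume.real E with hm
  have hm0 : 0 ≤ m := measureReal_nonneg
  have hlt : ENNReal.ofReal (α ^ N) < volume E := by
    rw [hEa]
    exact (ENNReal.ofReal_lt_ofReal_iff (by positivity)).2 (pow_lt_pow_left₀ hαa hα0.le hN)
  obtain ⟨L, hL, hLm⟩ := exists_ball_lt_measure_inter hlt (3 * (C + 1) * R * (m + 1) / ε)
  have hL0 : 0 < L := lt_of_lt_of_le (by positivity) hL
  obtain ⟨χ, hχ, hχc, hχI, hχ1, hχd⟩ := hC L hL0
  obtain ⟨φ, hφ⟩ := exists_bump_superlevel hE hEf hLm hs1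
  set ρ := φ.normed (volume : Measure (EuclideanSpace ℝ (Fin N)))
  have hρ : ContDiff ℝ 1 ρ := φ.contDiff_normed
  have hρc : HasCompactSupport ρ := φ.hasCompactSupport_normed
  have hEi : Integrable (E.indicator fun _ => (1 : ℝ)) :=
    (integrableOn_const hEf.ne).integrable_indicator hE
  set f := ρ ⋆[lsmul ℝ ℝ, volume] E.indicator fun _ => (1 : ℝ)
  have hf : ContDiff ℝ 1 f := hρc.contDiff_convolution_left _ hρ hEi.locallyIntegrable
  have hfI : ∀ x, f x ∈ Icc (0 : ℝ) 1 := fun x => by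
    refine convolution_normed_mem (convex_Icc 0 1) isClosed_Icc hEi.locallyIntegrable ?_ x
    intro y
    by_cases hy : y ∈ E <;> simp [hy]
  have hfi : Integrable f := φ.integrable_normed.integrable_convolution _ hEi
  have hfm : ∫ x, f x = m := by
    rw [integral_convolution _ φ.integrable_normed hEi, φ.integral_normed, integral_indicator hE]
    simp [hm]
  set u := fun x => χ x * f x with hu
  have hu1 : ContDiff ℝ 1 u := hχ.mul hf
  have huc : HasCompactSupport u := hχc.mul_right
  have huα : ENNReal.ofReal (α ^ N) ≤ volume {x | s < u x} := by
    refine hφ.trans (measure_mono ?_)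
    rintro x ⟨hxL, hx⟩
    simp only [hu, Set.mem_ofPred_eq, hχ1 x hxL, one_mul]
    exact hx
  obtain ⟨σ, hσc, hσK, hσ⟩ := exists_field_of_superlevel hN hKo hKb hKc hK0 hk hKk hu1 huc
    (fun x => mul_nonneg (hχI x).1 (hfI x).1) hs0 hα0 huα (show 0 < ε / 3 by positivity)
  set ζ := fun x => χ x • σ x with hζ
  have hζc : Continuous ζ := hχ.continuous.smul hσc
  have hζs : HasCompactSupport ζ := hχc.smul_right
  have hζi : Integrable ζ := hζc.integrable_of_hasCompactSupport hζs
  have hζK : ∀ x, ζ x ∈ K := fun x =>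
    hKc.smul_mem_of_zero_mem hK0 (hσK x) (hχI x)
  refine ⟨ρ ⋆[lsmul ℝ ℝ, volume] ζ, admissibleField_normed_convolution φ hKc hζc hζs hζK, ?_⟩
  · rw [setIntegral_vdiv_lsmul_convolution hρ hρc φ.normed_neg hζi hE hEf]
    have h2 := neg_integral_fderiv_smul_cutoff_ge hχ hχc hχd hf (fun x => (hfI x).1) hfi hσc
      fun x => hR _ (hσK x)
    rw [hfm] at h2
    have h3 : C / L * R * m ≤ ε / 3 := by
      rw [div_le_iff₀ hε] at hL
      have : C * R * m ≤ (C + 1) * R * (m + 1) := by gcongr <;> linarith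
      rw [div_mul_eq_mul_div, div_mul_eq_mul_div, div_le_iff₀ hL0]
      linarith
    linarith

/-- Fields with values in an open bounded convex set `K` almost attain, on any set `E`, the
right-hand side of the Wulff inequality. -/
lemma exists_admissibleField_le_integral_vdiv (hN : N ≠ 0) (hKo : IsOpen K)
    (hKb : Bornology.IsBounded K) (hKc : Convex ℝ K) {k : ℝ} (hk : 0 < k)
    (hKk : volume K = ENNReal.ofReal (k ^ N)) {E : Set (EuclideanSpace ℝ (Fin N))}
    (hE : MeasurableSet E) {a : ℝ} (ha : 0 < a) (hEa : volume E = ENNReal.ofReal (a ^ N))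
    {ε : ℝ} (hε : 0 < ε) :
    ∃ σ, AdmissibleField K σ ∧ N * k * a ^ (N - 1) - ε ≤ ∫ x in E, vdiv σ x := by
  have hEf : volume E < ⊤ := hEa ▸ ENNReal.ofReal_lt_top
  obtain ⟨b, hb⟩ : K.Nonempty := by
    rw [nonempty_iff_ne_empty]
    rintro rfl
    have : 0 < k ^ N := by positivity
    simp at hKk
    linarith
  set K' := (fun x => x + b) ⁻¹' K with hK'
  have hK'o : IsOpen K' := hKo.preimage (by fun_prop)
  have hK'c : Convex ℝ K' := hKc.translate_preimage_left b
  have hK'b : Bornology.IsBounded K' := by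
    obtain ⟨R, hR0, hR⟩ := hKb.exists_pos_norm_le
    refine (Metric.isBounded_closedBall (x := -b) (r := R)).subset fun x hx => ?_
    rw [mem_closedBall, dist_eq_norm, sub_neg_eq_add]
    exact hR _ hx
  have hK'k : volume K' = ENNReal.ofReal (k ^ N) := by
    rw [hK', measure_preimage_add_right, hKk]
  have h0 : (0 : EuclideanSpace ℝ (Fin N)) ∈ K' := by simpa [hK'] using hb
  obtain ⟨τ, hτ, hτE⟩ := exists_field_closure_of_zero_mem hN hK'o hK'b hK'c h0 hk hK'k hE ha hEa
    (show 0 < ε / 2 by positivity)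
  set X := ∫ x in E, vdiv τ x
  set δ := min (1 / 2) (ε / (2 * (|X| + 1))) with hδ
  have hδ0 : 0 < δ := by positivity
  have hδ1 : δ ≤ 1 / 2 := min_le_left _ _
  have hτd := hτ.contDiff.differentiable one_ne_zero
  have hcd : ContDiff ℝ 1 fun x => (1 - δ) • τ x := hτ.contDiff.const_smul _
  refine ⟨fun x => (1 - δ) • τ x + b, ⟨hcd.add contDiff_const, fun x => ?_, ?_⟩, ?_⟩
  · have := hK'c.combo_interior_closure_mem_interior (x := 0) (y := τ x)
      (by rwa [hK'o.interior_eq]) (hτ.mem x) hδ0 (show 0 ≤ 1 - δ by linarith) (by ring)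
    rw [smul_zero, zero_add] at this
    exact (interior_subset this : _ ∈ K')
  · obtain ⟨C, hC⟩ := hτ.bounded
    refine ⟨(1 - δ) * C, fun x => ?_⟩
    rw [fderiv_add_const, fderiv_fun_const_smul (hτd x), norm_smul,
      Real.norm_of_nonneg (by linarith)]
    have := hC x
    gcongr
    linarith
  · have h1 : ∀ x, vdiv (fun x => (1 - δ) • τ x + b) x = (1 - δ) * vdiv τ x := by
      intro x
      rw [vdiv_add (hcd.differentiable one_ne_zero x) (differentiableAt_const _), vdiv_const,
        vdiv_const_smul _ (hτd x), add_zero]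
    simp_rw [h1]
    rw [integral_const_mul]
    have h2 : δ * |X| ≤ ε / 2 := by
      calc δ * |X| ≤ ε / (2 * (|X| + 1)) * (|X| + 1) := by
            gcongr
            · exact min_le_right _ _
            · linarith
        _ = ε / 2 := by field_simp
    have h3 : δ * X ≤ δ * |X| := by gcongr; exact le_abs_self X
    linarith

end

section Hyperplane
variable {N : ℕ} {e : EuclideanSpace ℝ (Fin N)}

lemma volume_inner_eq (he : e ≠ 0) (s : ℝ) :
    volume {x : EuclideanSpace ℝ (Fin N) | ⟪e, x⟫ = s} = 0 := by
  rcases eq_empty_or_nonempty {x : EuclideanSpace ℝ (Fin N) | ⟪e, x⟫ = s} with h | ⟨y, hy⟩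
  · simp [h]
  · have h1 : {x : EuclideanSpace ℝ (Fin N) | ⟪e, x⟫ = s} =
        (fun x => x + (-y)) ⁻¹' (LinearMap.ker (innerSL ℝ e).toLinearMap : Set _) := by
      ext x
      have hy' : ⟪e, y⟫ = s := hy
      simp [inner_sub_right, ← sub_eq_add_neg, hy', sub_eq_zero]
    rw [h1, measure_preimage_add_right]
    refine Measure.addHaar_submodule _ _ fun h => he ?_
    have : e ∈ LinearMap.ker (innerSL ℝ e).toLinearMap := h ▸ Submodule.mem_top
    simpa using this

lemma volume_real_inter_inner_lt_sub (he : e ≠ 0) {E : Set (EuclideanSpace ℝ (Fin N))}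
    (hEf : volume E < ⊤) {s t : ℝ} (hst : s ≤ t) :
    volume.real (E ∩ {x | ⟪e, x⟫ < t}) - volume.real (E ∩ {x | ⟪e, x⟫ < s}) =
      volume.real (E ∩ {x | s < ⟪e, x⟫ ∧ ⟪e, x⟫ < t}) := by
  have hm : MeasurableSet {x : EuclideanSpace ℝ (Fin N) | ⟪e, x⟫ < s} :=
    (isOpen_lt (by fun_prop) (by fun_prop)).measurableSet
  have hf : volume (E ∩ {x | ⟪e, x⟫ < t}) ≠ ⊤ := measure_ne_top_of_subset inter_subset_left hEf.ne
  rw [← measureReal_inter_add_sdiff (s := E ∩ {x | ⟪e, x⟫ < t}) hm hf]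
  have h1 : E ∩ {x | ⟪e, x⟫ < t} ∩ {x | ⟪e, x⟫ < s} = E ∩ {x | ⟪e, x⟫ < s} := by
    ext x
    simp only [mem_inter_iff, Set.mem_ofPred_eq]
    exact ⟨fun h => ⟨h.1.1, h.2⟩, fun h => ⟨⟨h.1, h.2.trans_le hst⟩, h.2⟩⟩
  rw [h1, add_sub_cancel_left]
  refine measureReal_congr ?_
  have h2 : ∀ᵐ x : EuclideanSpace ℝ (Fin N), ⟪e, x⟫ ≠ s := by
    rw [ae_iff]
    simpa using volume_inner_eq he s
  filter_upwards [h2] with x hx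
  apply propext
  change (x ∈ (E ∩ {x | ⟪e, x⟫ < t}) \ {x | ⟪e, x⟫ < s}) ↔ (x ∈ E ∩ {x | s < ⟪e, x⟫ ∧ ⟪e, x⟫ < t})
  simp only [mem_inter_iff, mem_sdiff, Set.mem_ofPred_eq, not_lt]
  constructor
  · rintro ⟨⟨h1, h2⟩, h3⟩
    exact ⟨h1, lt_of_le_of_ne h3 (Ne.symm hx), h2⟩
  · rintro ⟨h1, h2, h3⟩
    exact ⟨⟨h1, h3⟩, h2.le⟩

lemma volume_real_inter_inner_lt_add (he : e ≠ 0) {E : Set (EuclideanSpace ℝ (Fin N))}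
    (hEf : volume E < ⊤) (s : ℝ) :
    volume.real (E ∩ {x | ⟪e, x⟫ < s}) + volume.real (E ∩ {x | s < ⟪e, x⟫}) =
      volume.real E := by
  have hm : MeasurableSet {x : EuclideanSpace ℝ (Fin N) | ⟪e, x⟫ < s} :=
    (isOpen_lt (by fun_prop) (by fun_prop)).measurableSet
  rw [← measureReal_inter_add_sdiff (s := E) hm hEf.ne]
  congr 1
  refine measureReal_congr ?_
  have h2 : ∀ᵐ x : EuclideanSpace ℝ (Fin N), ⟪e, x⟫ ≠ s := by
    rw [ae_iff]
    simpa using volume_inner_eq he s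
  filter_upwards [h2] with x hx
  apply propext
  change (x ∈ E ∩ {x | s < ⟪e, x⟫}) ↔ (x ∈ E \ {x | ⟪e, x⟫ < s})
  simp only [mem_inter_iff, mem_sdiff, Set.mem_ofPred_eq, not_lt]
  exact ⟨fun h => ⟨h.1, h.2.le⟩, fun h => ⟨h.1, lt_of_le_of_ne h.2 (Ne.symm hx)⟩⟩

lemma monotone_volume_real_inter_inner_lt {E : Set (EuclideanSpace ℝ (Fin N))}
    (hEf : volume E < ⊤) : Monotone fun s => volume.real (E ∩ {x | ⟪e, x⟫ < s}) := by
  intro s t hst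
  refine measureReal_mono (fun x hx => ⟨hx.1, lt_of_lt_of_le hx.2 hst⟩)
    (measure_ne_top_of_subset inter_subset_left hEf.ne)

lemma continuous_volume_real_inter_inner_lt (he : e ≠ 0) {E : Set (EuclideanSpace ℝ (Fin N))}
    (hEf : volume E < ⊤) :
    Continuous fun s => volume.real (E ∩ {x | ⟪e, x⟫ < s}) := by
  have hm : ∀ s, MeasurableSet {x : EuclideanSpace ℝ (Fin N) | ⟪e, x⟫ < s} := fun s =>
    (isOpen_lt (by fun_prop) (by fun_prop)).measurableSet
  have h1 : ∀ s, volume.real (E ∩ {x | ⟪e, x⟫ < s}) =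
      ∫ x in E, ({x | ⟪e, x⟫ < s} : Set (EuclideanSpace ℝ (Fin N))).indicator
        (fun _ => (1 : ℝ)) x := by
    intro s
    rw [integral_indicator (hm s), Measure.restrict_restrict (hm s), inter_comm]
    simp
  simp_rw [h1]
  rw [continuous_iff_continuousAt]
  intro s
  refine tendsto_integral_filter_of_dominated_convergence (fun _ => 1)
    (Filter.Eventually.of_forall fun t =>
      (measurable_const.indicator (hm t)).aestronglyMeasurable)
    (Filter.Eventually.of_forall fun t => Filter.Eventually.of_forall fun x => ?_)
    (integrableOn_const hEf.ne) ?_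
  · by_cases h : x ∈ {x : EuclideanSpace ℝ (Fin N) | ⟪e, x⟫ < t} <;> simp [h]
  · have h2 : ∀ᵐ x : EuclideanSpace ℝ (Fin N), ⟪e, x⟫ ≠ s := by
      rw [ae_iff]
      simpa using volume_inner_eq he s
    filter_upwards [ae_restrict_of_ae h2] with x hx
    refine tendsto_const_nhds.congr' ?_
    rcases lt_or_gt_of_ne hx with h | h
    · filter_upwards [lt_mem_nhds h] with t ht
      simp [h, ht]
    · filter_upwards [gt_mem_nhds h] with t ht
      simp [not_lt.2 h.le, not_lt.2 (le_of_lt ht)]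

lemma tendsto_volume_real_inter_inner_lt_atTop {E : Set (EuclideanSpace ℝ (Fin N))}
    (hEf : volume E < ⊤) :
    Filter.Tendsto (fun s => volume.real (E ∩ {x | ⟪e, x⟫ < s})) Filter.atTop
      (𝓝 (volume.real E)) := by
  have h1 : Monotone fun s : ℝ => E ∩ {x | ⟪e, x⟫ < s} :=
    fun s t hst x hx => ⟨hx.1, lt_of_lt_of_le hx.2 hst⟩
  have h2 := tendsto_measure_iUnion_atTop (μ := volume) h1
  have h3 : ⋃ s : ℝ, E ∩ {x | ⟪e, x⟫ < s} = E := by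
    refine subset_antisymm (iUnion_subset fun _ => inter_subset_left) fun x hx => ?_
    exact mem_iUnion.2 ⟨⟪e, x⟫ + 1, hx, by simp⟩
  rw [h3] at h2
  exact (ENNReal.tendsto_toReal hEf.ne).comp h2

lemma tendsto_volume_real_inter_inner_lt_atBot {E : Set (EuclideanSpace ℝ (Fin N))}
    (hE : MeasurableSet E) (hEf : volume E < ⊤) :
    Filter.Tendsto (fun s => volume.real (E ∩ {x | ⟪e, x⟫ < s})) Filter.atBot (𝓝 0) := by
  have hm : ∀ s, MeasurableSet {x : EuclideanSpace ℝ (Fin N) | ⟪e, x⟫ < s} := fun s =>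
    (isOpen_lt (by fun_prop) (by fun_prop)).measurableSet
  have h1 : Monotone fun s : ℝ => E ∩ {x | ⟪e, x⟫ < s} :=
    fun s t hst x hx => ⟨hx.1, lt_of_lt_of_le hx.2 hst⟩
  have h2 := tendsto_measure_iInter_atBot (μ := volume)
    (fun s => (hE.inter (hm s)).nullMeasurableSet) h1
    ⟨0, measure_ne_top_of_subset inter_subset_left hEf.ne⟩
  have h3 : ⋂ s : ℝ, E ∩ {x | ⟪e, x⟫ < s} = ∅ := by
    refine eq_empty_of_forall_notMem fun x hx => ?_
    have := (mem_iInter.1 hx ⟪e, x⟫).2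
    simp at this
  rw [h3, measure_empty] at h2
  exact (ENNReal.tendsto_toReal ENNReal.zero_ne_top).comp h2

end Hyperplane

section Glue
variable {N : ℕ} {K : Set (EuclideanSpace ℝ (Fin N))} {e : EuclideanSpace ℝ (Fin N)}
  {σ₁ σ₂ : EuclideanSpace ℝ (Fin N) → EuclideanSpace ℝ (Fin N)} {u₁ u₂ : ℝ}

lemma AdmissibleField.glue (hKb : Bornology.IsBounded K) (hKc : Convex ℝ K)
    (h₁ : AdmissibleField K σ₁) (h₂ : AdmissibleField K σ₂)
    {η : EuclideanSpace ℝ (Fin N) → ℝ} (hη : ContDiff ℝ 1 η) (hηI : ∀ x, η x ∈ Icc (0 : ℝ) 1)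
    {C : ℝ} (hηd : ∀ x, ‖fderiv ℝ η x‖ ≤ C) :
    AdmissibleField K (fun x => σ₁ x + η x • (σ₂ x - σ₁ x)) := by
  have hd1 := h₁.contDiff.differentiable one_ne_zero
  have hd2 := h₂.contDiff.differentiable one_ne_zero
  have hdη := hη.differentiable one_ne_zero
  refine ⟨h₁.contDiff.add (hη.smul (h₂.contDiff.sub h₁.contDiff)), fun x => ?_, ?_⟩
  · have := hKc (h₁.mem x) (h₂.mem x) (sub_nonneg.2 (hηI x).2) (hηI x).1 (by ring)
    convert this using 1
    module
  · obtain ⟨C₁, hC₁⟩ := h₁.bounded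
    obtain ⟨C₂, hC₂⟩ := h₂.bounded
    obtain ⟨R, hR0, hR⟩ := hKb.exists_pos_norm_le
    refine ⟨C₁ + (C₂ + C₁ + C * (R + R)), fun x => ?_⟩
    have h0 : 0 ≤ C := (norm_nonneg _).trans (hηd x)
    rw [fderiv_fun_add (hd1 x) ((hdη x).fun_smul ((hd2 x).fun_sub (hd1 x))),
      fderiv_fun_smul (hdη x) ((hd2 x).fun_sub (hd1 x)), fderiv_fun_sub (hd2 x) (hd1 x)]
    refine (norm_add_le _ _).trans (add_le_add (hC₁ x) ((norm_add_le _ _).trans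
      (add_le_add ?_ ?_)))
    · rw [norm_smul, Real.norm_of_nonneg (hηI x).1]
      calc η x * ‖fderiv ℝ σ₂ x - fderiv ℝ σ₁ x‖ ≤ 1 * ‖fderiv ℝ σ₂ x - fderiv ℝ σ₁ x‖ := by
            gcongr
            exact (hηI x).2
        _ ≤ C₂ + C₁ := by
            rw [one_mul]
            exact (norm_sub_le _ _).trans (add_le_add (hC₂ x) (hC₁ x))
    · rw [ContinuousLinearMap.norm_smulRight_apply]
      gcongr
      · exact hηd x
      · exact (norm_sub_le _ _).trans (add_le_add (hR _ (h₂.mem x)) (hR _ (h₁.mem x)))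

lemma vdiv_glue (h₁ : ContDiff ℝ 1 σ₁) (h₂ : ContDiff ℝ 1 σ₂)
    {η : EuclideanSpace ℝ (Fin N) → ℝ} (hη : ContDiff ℝ 1 η) (x : EuclideanSpace ℝ (Fin N)) :
    vdiv (fun x => σ₁ x + η x • (σ₂ x - σ₁ x)) x =
      (1 - η x) * vdiv σ₁ x + η x * vdiv σ₂ x + fderiv ℝ η x (σ₂ x - σ₁ x) := by
  have hd1 := h₁.differentiable one_ne_zero x
  have hd2 := h₂.differentiable one_ne_zero x
  have hdη := hη.differentiable one_ne_zero x
  have h3 : vdiv (fun x => σ₂ x - σ₁ x) x = vdiv σ₂ x - vdiv σ₁ x := by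
    have := vdiv_add (σ := σ₂) (τ := fun y => (-1 : ℝ) • σ₁ y) hd2 (hd1.fun_const_smul _)
    rw [vdiv_const_smul _ hd1] at this
    simpa [← sub_eq_add_neg] using this
  rw [vdiv_add hd1 (hdη.fun_smul (hd2.fun_sub hd1)), vdiv_smul hdη (hd2.fun_sub hd1), h3]
  ring

/-- Gluing two admissible fields across a slab, with a smooth transition function. -/
lemma integral_glue_le (hKb : Bornology.IsBounded K) (hKc : Convex ℝ K)
    {E : Set (EuclideanSpace ℝ (Fin N))} (hE : MeasurableSet E) (hEf : volume E < ⊤) {M : ℝ}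
    (hM : ∀ σ, AdmissibleField K σ → ∫ x in E, vdiv σ x ≤ M)
    (h₁ : AdmissibleField (K ∩ {x | ⟪e, x⟫ < u₁}) σ₁)
    (h₂ : AdmissibleField (K ∩ {x | u₂ < ⟪e, x⟫}) σ₂)
    {θ p : ℝ → ℝ} (hp : Continuous p) (hθ : ∀ r, HasDerivAt θ (p r) r)
    (hθI : ∀ r, θ r ∈ Icc (0 : ℝ) 1) (hpI : ∀ r, p r ∈ Icc (0 : ℝ) 1) {s h : ℝ} (hh : 0 < h) :
    ∫ x in E, ((1 - θ ((⟪e, x⟫ - s) / h)) * vdiv σ₁ x + θ ((⟪e, x⟫ - s) / h) * vdiv σ₂ x +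
      (u₂ - u₁) * (p ((⟪e, x⟫ - s) / h) / h)) ≤ M := by
  have hθ1 : ContDiff ℝ 1 θ := by
    rw [contDiff_one_iff_deriv]
    refine ⟨fun r => (hθ r).differentiableAt, ?_⟩
    rwa [funext fun r => (hθ r).deriv]
  set η : EuclideanSpace ℝ (Fin N) → ℝ := fun x => θ ((⟪e, x⟫ - s) / h) with hηdef
  have hη : ContDiff ℝ 1 η := hθ1.comp
    (((contDiff_const.inner ℝ contDiff_id).sub contDiff_const).div_const _)
  have hηd : ∀ x, HasFDerivAt η ((p ((⟪e, x⟫ - s) / h) / h) • innerSL ℝ e) x := by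
    intro x
    have h1 : HasFDerivAt (fun x : EuclideanSpace ℝ (Fin N) => (⟪e, x⟫ - s) / h)
        (h⁻¹ • innerSL ℝ e) x := by
      simp_rw [div_eq_inv_mul]
      exact (((innerSL ℝ e).hasFDerivAt).sub_const s).const_mul h⁻¹
    have := (hθ ((⟪e, x⟫ - s) / h)).comp_hasFDerivAt x h1
    rwa [smul_smul, ← div_eq_mul_inv] at this
  have hA := (h₁.mono inter_subset_left).glue hKb hKc (h₂.mono inter_subset_left) hη
    (fun x => hθI _) (C := 1 / h * ‖e‖) (fun x => by
      rw [(hηd x).fderiv, norm_smul, innerSL_apply_norm, Real.norm_of_nonneg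
        (div_nonneg (hpI _).1 hh.le)]
      gcongr
      exact (hpI _).2)
  have hb : ∀ (q : ℝ → ℝ), Continuous q → (∀ r, q r ∈ Icc (0 : ℝ) 1) → ∀ g : _ → ℝ,
      IntegrableOn g E → IntegrableOn (fun x => q ((⟪e, x⟫ - s) / h) * g x) E := by
    intro q hq hqI g hg
    refine hg.bdd_mul (c := 1) ?_ (Filter.Eventually.of_forall fun x => ?_)
    · exact (Continuous.aestronglyMeasurable (by fun_prop))
    · rw [Real.norm_of_nonneg (hqI _).1]
      exact (hqI _).2
  have hc := hθ1.continuous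
  refine (setIntegral_mono_on ?_ (hA.integrableOn_vdiv hEf) hE fun x _ => ?_).trans (hM _ hA)
  · refine ((hb (fun r => 1 - θ r) (by fun_prop) (fun r => ?_) _
      (h₁.integrableOn_vdiv hEf)).add (hb θ hc hθI _ (h₂.integrableOn_vdiv hEf))).add ?_
    · have := hθI r
      exact ⟨by linarith [this.2], by linarith [this.1]⟩
    · simp_rw [div_eq_mul_inv _ h]
      have := (hb p hp hpI (fun _ => 1) (integrableOn_const hEf.ne)).const_mul ((u₂ - u₁) * h⁻¹)
      refine this.congr (Filter.Eventually.of_forall fun x => ?_)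
      simp only [div_eq_mul_inv]
      ring
  · rw [vdiv_glue h₁.contDiff h₂.contDiff hη, (hηd x).fderiv]
    simp only [hηdef, FunLike.coe_smul, Pi.smul_apply, innerSL_apply_apply, smul_eq_mul,
      inner_sub_right]
    have h1 : ⟪e, σ₁ x⟫ < u₁ := (h₁.mem x).2
    have h2 : u₂ < ⟪e, σ₂ x⟫ := (h₂.mem x).2
    have h3 : 0 ≤ p ((⟪e, x⟫ - s) / h) / h := div_nonneg (hpI _).1 hh.le
    nlinarith [mul_nonneg h3 (show 0 ≤ (⟪e, σ₂ x⟫ - ⟪e, σ₁ x⟫) - (u₂ - u₁) by linarith)]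

end Glue

lemma intervalIntegral_eq_clamp {p : ℝ → ℝ} (hp : Continuous p)
    (hp0 : ∀ r, r ∉ Ioo (0 : ℝ) 1 → p r = 0) (r : ℝ) :
    ∫ t in (0 : ℝ)..r, p t = ∫ t in (0 : ℝ)..(max 0 (min 1 r)), p t := by
  rcases le_total r 0 with h | h
  · rw [min_eq_right (h.trans zero_le_one), max_eq_left h, intervalIntegral.integral_same]
    refine (intervalIntegral.integral_congr (g := fun _ => 0) fun t ht => hp0 t fun ht' => ?_).trans
      (by simp)
    rw [uIcc_of_ge h] at ht
    exact ht'.1.not_ge ht.2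
  rcases le_total r 1 with h1 | h1
  · rw [min_eq_right h1, max_eq_right h]
  rw [min_eq_left h1, max_eq_right zero_le_one, ← sub_eq_zero,
    intervalIntegral.integral_interval_sub_left
      (hp.intervalIntegrable _ _) (hp.intervalIntegrable _ _)]
  refine (intervalIntegral.integral_congr (g := fun _ => 0) fun t ht => hp0 t fun ht' => ?_).trans
    (by simp)
  rw [uIcc_of_le h1] at ht
  exact ht'.2.not_ge ht.1

lemma exists_smooth_ramp : ∃ θ p : ℕ → ℝ → ℝ, (∀ m, Continuous (p m)) ∧
    (∀ m r, HasDerivAt (θ m) (p m r) r) ∧ (∀ m r, θ m r ∈ Icc (0 : ℝ) 1) ∧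
    (∀ m r, p m r ∈ Icc (0 : ℝ) 1) ∧
    (∀ r, Filter.Tendsto (fun m => p m r) Filter.atTop (𝓝 ((Ioo (0 : ℝ) 1).indicator 1 r))) ∧
    ∀ r, Filter.Tendsto (fun m => θ m r) Filter.atTop (𝓝 (max 0 (min 1 r))) := by
  set p : ℕ → ℝ → ℝ := fun m r => min 1 (m * max 0 (min r (1 - r))) with hp
  have hpc : ∀ m, Continuous (p m) := fun m => by fun_prop
  have hpI : ∀ m r, p m r ∈ Icc (0 : ℝ) 1 := fun m r =>
    ⟨le_min zero_le_one (by positivity), min_le_left _ _⟩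
  have hp0 : ∀ m r, r ∉ Ioo (0 : ℝ) 1 → p m r = 0 := by
    intro m r hr
    have : min r (1 - r) ≤ 0 := by
      by_contra! h
      exact hr ⟨(lt_min_iff.1 h).1, by linarith [(lt_min_iff.1 h).2]⟩
    simp [hp, max_eq_left this]
  have hp1 : ∀ r ∈ Ioo (0 : ℝ) 1, Filter.Tendsto (fun m => p m r) Filter.atTop (𝓝 1) := by
    intro r hr
    refine tendsto_const_nhds.congr' ?_
    have h0 : 0 < min r (1 - r) := lt_min hr.1 (by linarith [hr.2])
    filter_upwards [Filter.eventually_ge_atTop ⌈1 / min r (1 - r)⌉₊] with m hm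
    have := (div_le_iff₀ h0).1 (Nat.ceil_le.1 hm)
    simp [hp, max_eq_right h0.le, this]
  refine ⟨fun m r => ∫ t in (0 : ℝ)..r, p m t, p, hpc, fun m r =>
    intervalIntegral.integral_hasDerivAt_right ((hpc m).intervalIntegrable _ _)
      ((hpc m).stronglyMeasurableAtFilter volume _) (hpc m).continuousAt, ?_, hpI, ?_, ?_⟩
  · intro m r
    dsimp only
    rw [intervalIntegral_eq_clamp (hpc m) (hp0 m)]
    set c := max 0 (min 1 r)
    have hc0 : 0 ≤ c := le_max_left _ _
    have hc1 : c ≤ 1 := max_le zero_le_one (min_le_left _ _)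
    refine ⟨intervalIntegral.integral_nonneg hc0 fun t _ => (hpI m t).1, ?_⟩
    have := intervalIntegral.integral_mono_on (μ := volume) hc0 ((hpc m).intervalIntegrable _ _)
      (intervalIntegrable_const (c := (1 : ℝ))) fun t _ => (hpI m t).2
    refine this.trans ?_
    simpa using hc1
  · intro r
    by_cases hr : r ∈ Ioo (0 : ℝ) 1
    · simpa [indicator_of_mem hr] using hp1 r hr
    · simp [indicator_of_notMem hr, hp0 _ r hr]
  · intro r
    simp_rw [intervalIntegral_eq_clamp (hpc _) (hp0 _) r]
    set c := max 0 (min 1 r)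
    have hc0 : 0 ≤ c := le_max_left _ _
    have hc1 : c ≤ 1 := max_le zero_le_one (min_le_left _ _)
    have h1 : c = ∫ t in (0 : ℝ)..c, (1 : ℝ) := by simp
    conv_rhs => rw [h1]
    refine intervalIntegral.tendsto_integral_filter_of_dominated_convergence (fun _ => 1)
      (Filter.Eventually.of_forall fun m => (hpc m).aestronglyMeasurable)
      (Filter.Eventually.of_forall fun m => Filter.Eventually.of_forall fun t _ => ?_)
      intervalIntegrable_const ?_
    · rw [Real.norm_of_nonneg (hpI m t).1]
      exact (hpI m t).2
    · have : ∀ᵐ t : ℝ, t ≠ 1 := by simp [ae_iff]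
      filter_upwards [this] with t ht hts
      rw [uIoc_of_le hc0] at hts
      exact hp1 t ⟨hts.1, lt_of_le_of_ne (hts.2.trans hc1) ht⟩

section Cut
variable {N : ℕ} {K : Set (EuclideanSpace ℝ (Fin N))} {e : EuclideanSpace ℝ (Fin N)}
  {σ₁ σ₂ : EuclideanSpace ℝ (Fin N) → EuclideanSpace ℝ (Fin N)} {u₁ u₂ : ℝ}

lemma integral_glue_clamp_le (hKb : Bornology.IsBounded K) (hKc : Convex ℝ K)
    {E : Set (EuclideanSpace ℝ (Fin N))} (hE : MeasurableSet E) (hEf : volume E < ⊤) {M : ℝ}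
    (hM : ∀ σ, AdmissibleField K σ → ∫ x in E, vdiv σ x ≤ M)
    (h₁ : AdmissibleField (K ∩ {x | ⟪e, x⟫ < u₁}) σ₁)
    (h₂ : AdmissibleField (K ∩ {x | u₂ < ⟪e, x⟫}) σ₂) {s h : ℝ} (hh : 0 < h) :
    (∫ x in E, ((1 - max 0 (min 1 ((⟪e, x⟫ - s) / h))) * vdiv σ₁ x +
        max 0 (min 1 ((⟪e, x⟫ - s) / h)) * vdiv σ₂ x)) +
      (u₂ - u₁) * (volume.real (E ∩ {x | s < ⟪e, x⟫ ∧ ⟪e, x⟫ < s + h}) / h) ≤ M := by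
  obtain ⟨θ, p, hp, hθ, hθI, hpI, hp1, hθ1⟩ := exists_smooth_ramp
  have hi1 := h₁.integrableOn_vdiv hEf
  have hi2 := h₂.integrableOn_vdiv hEf
  set b : EuclideanSpace ℝ (Fin N) → ℝ := fun x => ‖vdiv σ₁ x‖ + ‖vdiv σ₂ x‖ + |u₂ - u₁| * h⁻¹
  have hθc : ∀ m, Continuous (θ m) := fun m =>
    continuous_iff_continuousAt.2 fun r => (hθ m r).continuousAt
  have hlim := tendsto_integral_filter_of_dominated_convergence (μ := volume.restrict E)
    (l := Filter.atTop)
    (F := fun m x => ((1 - θ m ((⟪e, x⟫ - s) / h)) * vdiv σ₁ x +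
      θ m ((⟪e, x⟫ - s) / h) * vdiv σ₂ x + (u₂ - u₁) * (p m ((⟪e, x⟫ - s) / h) / h)))
    (f := fun x => ((1 - max 0 (min 1 ((⟪e, x⟫ - s) / h))) * vdiv σ₁ x +
      max 0 (min 1 ((⟪e, x⟫ - s) / h)) * vdiv σ₂ x) +
      (u₂ - u₁) * ((Ioo (0 : ℝ) 1).indicator 1 ((⟪e, x⟫ - s) / h) / h)) b ?_ ?_ ?_ ?_
  · have hle := le_of_tendsto hlim (Filter.Eventually.of_forall fun m =>
      integral_glue_le hKb hKc hE hEf hM h₁ h₂ (hp m) (hθ m) (hθI m) (hpI m) hh)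
    have hset : (fun x : EuclideanSpace ℝ (Fin N) =>
        (u₂ - u₁) * ((Ioo (0 : ℝ) 1).indicator 1 ((⟪e, x⟫ - s) / h) / h)) =
        {x | s < ⟪e, x⟫ ∧ ⟪e, x⟫ < s + h}.indicator fun _ => (u₂ - u₁) * (1 / h) := by
      ext x
      have hiff : (⟪e, x⟫ - s) / h ∈ Ioo (0 : ℝ) 1 ↔
          x ∈ {x : EuclideanSpace ℝ (Fin N) | s < ⟪e, x⟫ ∧ ⟪e, x⟫ < s + h} := by
        simp only [mem_Ioo, Set.mem_ofPred_eq, div_pos_iff_of_pos_right hh, div_lt_one hh,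
          sub_pos, sub_lt_iff_lt_add']
      by_cases hx : (⟪e, x⟫ - s) / h ∈ Ioo (0 : ℝ) 1
      · rw [indicator_of_mem hx, indicator_of_mem (hiff.1 hx)]
        simp
      · rw [indicator_of_notMem hx, indicator_of_notMem fun h => hx (hiff.2 h)]
        simp
    have hms : MeasurableSet {x : EuclideanSpace ℝ (Fin N) | s < ⟪e, x⟫ ∧ ⟪e, x⟫ < s + h} :=
      ((isOpen_Ioo (a := s) (b := s + h)).preimage
        (show Continuous fun x : EuclideanSpace ℝ (Fin N) => ⟪e, x⟫ by fun_prop)).measurableSet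
    rw [integral_add] at hle
    · simp_rw [hset] at hle
      rw [integral_indicator hms, Measure.restrict_restrict hms, inter_comm] at hle
      simp only [integral_const, MeasurableSet.univ, measureReal_restrict_apply, univ_inter,
        smul_eq_mul] at hle
      linarith [show volume.real (E ∩ {x | s < ⟪e, x⟫ ∧ ⟪e, x⟫ < s + h}) * ((u₂ - u₁) * (1 / h)) =
        (u₂ - u₁) * (volume.real (E ∩ {x | s < ⟪e, x⟫ ∧ ⟪e, x⟫ < s + h}) / h) by ring]
    · refine Integrable.add ?_ ?_
      · refine hi1.bdd_mul (c := 1) (Continuous.aestronglyMeasurable (by fun_prop))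
          (Filter.Eventually.of_forall fun x => ?_)
        rw [Real.norm_of_nonneg] <;> simp
      · refine hi2.bdd_mul (c := 1) (Continuous.aestronglyMeasurable (by fun_prop))
          (Filter.Eventually.of_forall fun x => ?_)
        rw [Real.norm_of_nonneg] <;> simp
    · rw [hset]
      exact (integrableOn_const hEf.ne).indicator hms
  · refine Filter.Eventually.of_forall fun m => Continuous.aestronglyMeasurable ?_
    have := hθc m
    have := hp m
    have := continuous_vdiv h₁.contDiff
    have := continuous_vdiv h₂.contDiff
    fun_prop
  · refine Filter.Eventually.of_forall fun m => Filter.Eventually.of_forall fun x => ?_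
    refine (norm_add_le _ _).trans (add_le_add ((norm_add_le _ _).trans (add_le_add ?_ ?_)) ?_)
    · rw [norm_mul, Real.norm_of_nonneg (sub_nonneg.2 (hθI m _).2)]
      exact mul_le_of_le_one_left (norm_nonneg _) (by linarith [(hθI m ((⟪e, x⟫ - s) / h)).1])
    · rw [norm_mul, Real.norm_of_nonneg (hθI m _).1]
      exact mul_le_of_le_one_left (norm_nonneg _) (hθI m _).2
    · rw [norm_mul, norm_div, Real.norm_of_nonneg (hpI m _).1, Real.norm_eq_abs,
        Real.norm_of_nonneg hh.le, div_eq_mul_inv]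
      gcongr
      exact mul_le_of_le_one_left (by positivity) (hpI m _).2
  · exact (hi1.norm.add hi2.norm).add (integrableOn_const hEf.ne)
  · refine Filter.Eventually.of_forall fun x => ?_
    exact (((hθ1 _).const_sub 1 |>.mul_const _).add ((hθ1 _).mul_const _)).add
      (((hp1 _).div_const h).const_mul _)

end Cut

section Cut
variable {N : ℕ} {K : Set (EuclideanSpace ℝ (Fin N))} {e : EuclideanSpace ℝ (Fin N)}
  {σ₁ σ₂ : EuclideanSpace ℝ (Fin N) → EuclideanSpace ℝ (Fin N)} {u₁ u₂ : ℝ}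

lemma tendsto_integral_clamp {f g : EuclideanSpace ℝ (Fin N) → ℝ} (he : e ≠ 0)
    {E : Set (EuclideanSpace ℝ (Fin N))} (hf : IntegrableOn f E)
    (hg : IntegrableOn g E) (s : ℝ) :
    Filter.Tendsto (fun h : ℝ => ∫ x in E, ((1 - max 0 (min 1 ((⟪e, x⟫ - s) / h))) * f x +
        max 0 (min 1 ((⟪e, x⟫ - s) / h)) * g x)) (𝓝[>] 0)
      (𝓝 ((∫ x in E ∩ {x | ⟪e, x⟫ < s}, f x) + ∫ x in E ∩ {x | s < ⟪e, x⟫}, g x)) := by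
  have hm1 : MeasurableSet {x : EuclideanSpace ℝ (Fin N) | ⟪e, x⟫ < s} :=
    (isOpen_lt (by fun_prop) (by fun_prop)).measurableSet
  have hm2 : MeasurableSet {x : EuclideanSpace ℝ (Fin N) | s < ⟪e, x⟫} :=
    (isOpen_lt (by fun_prop) (by fun_prop)).measurableSet
  rw [inter_comm E, inter_comm E, ← Measure.restrict_restrict hm1, ← Measure.restrict_restrict hm2,
    ← integral_indicator hm1, ← integral_indicator hm2,
    ← integral_add (hf.indicator hm1) (hg.indicator hm2)]
  refine tendsto_integral_filter_of_dominated_convergence (fun x => ‖f x‖ + ‖g x‖)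
    (Filter.Eventually.of_forall fun h => ?_)
    (Filter.Eventually.of_forall fun h => Filter.Eventually.of_forall fun x => ?_)
    (hf.norm.add hg.norm) ?_
  · exact ((Continuous.aestronglyMeasurable (by fun_prop)).mul hf.aestronglyMeasurable).add
      ((Continuous.aestronglyMeasurable (by fun_prop)).mul hg.aestronglyMeasurable)
  · have h0 : 0 ≤ max 0 (min 1 ((⟪e, x⟫ - s) / h)) := le_max_left _ _
    have h1 : max 0 (min 1 ((⟪e, x⟫ - s) / h)) ≤ 1 := max_le zero_le_one (min_le_left _ _)
    refine (norm_add_le _ _).trans (add_le_add ?_ ?_)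
    · rw [norm_mul, Real.norm_of_nonneg (sub_nonneg.2 h1)]
      exact mul_le_of_le_one_left (norm_nonneg _) (by linarith)
    · rw [norm_mul, Real.norm_of_nonneg h0]
      exact mul_le_of_le_one_left (norm_nonneg _) h1
  · have h2 : ∀ᵐ x : EuclideanSpace ℝ (Fin N), ⟪e, x⟫ ≠ s := by
      rw [ae_iff]
      simpa using volume_inner_eq he s
    filter_upwards [ae_restrict_of_ae h2] with x hx
    refine tendsto_const_nhds.congr' ?_
    rcases lt_or_gt_of_ne hx with h | h
    · filter_upwards [self_mem_nhdsWithin] with t ht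
      have ht : 0 < t := ht
      have h3 : (⟪e, x⟫ - s) / t ≤ 0 := div_nonpos_of_nonpos_of_nonneg (by linarith) ht.le
      simp [h, h.le, min_eq_right (h3.trans zero_le_one), max_eq_left h3]
    · filter_upwards [Ioo_mem_nhdsGT (sub_pos.2 h)] with t ht
      have h3 : 1 ≤ (⟪e, x⟫ - s) / t := by
        rw [le_div_iff₀ ht.1, one_mul]
        exact ht.2.le
      simp [h, h.le, min_eq_left h3]

/-- If no admissible field has divergence integral larger than `M`, cutting both `K` and `E` by
parallel hyperplanes bounds the slope of the distribution function of `E`. -/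
lemma eventually_slab_le (hN : N ≠ 0) (hKo : IsOpen K) (hKb : Bornology.IsBounded K)
    (hKc : Convex ℝ K) {E : Set (EuclideanSpace ℝ (Fin N))} (hE : MeasurableSet E)
    (hEf : volume E < ⊤) {M : ℝ} (hM : ∀ σ, AdmissibleField K σ → ∫ x in E, vdiv σ x ≤ M)
    (he : e ≠ 0) {s k₁ k₂ a₁ a₂ : ℝ} (hk₁ : 0 < k₁) (hk₂ : 0 < k₂) (ha₁ : 0 < a₁) (ha₂ : 0 < a₂)
    (hK₁ : volume (K ∩ {x | ⟪e, x⟫ < u₁}) = ENNReal.ofReal (k₁ ^ N))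
    (hK₂ : volume (K ∩ {x | u₂ < ⟪e, x⟫}) = ENNReal.ofReal (k₂ ^ N))
    (hE₁ : volume (E ∩ {x | ⟪e, x⟫ < s}) = ENNReal.ofReal (a₁ ^ N))
    (hE₂ : volume (E ∩ {x | s < ⟪e, x⟫}) = ENNReal.ofReal (a₂ ^ N)) {ε : ℝ} (hε : 0 < ε) :
    ∀ᶠ h in 𝓝[>] (0 : ℝ), (u₂ - u₁) *
        (volume.real (E ∩ {x | s < ⟪e, x⟫ ∧ ⟪e, x⟫ < s + h}) / h) ≤
      M - N * k₁ * a₁ ^ (N - 1) - N * k₂ * a₂ ^ (N - 1) + ε := by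
  have ho1 : ∀ u, IsOpen {x : EuclideanSpace ℝ (Fin N) | ⟪e, x⟫ < u} := fun u =>
    isOpen_lt (by fun_prop) (by fun_prop)
  have ho2 : ∀ u, IsOpen {x : EuclideanSpace ℝ (Fin N) | u < ⟪e, x⟫} := fun u =>
    isOpen_lt (by fun_prop) (by fun_prop)
  have hc1 : Convex ℝ {x : EuclideanSpace ℝ (Fin N) | ⟪e, x⟫ < u₁} :=
    convex_halfSpace_lt (innerSL ℝ e).toLinearMap.isLinear u₁
  have hc2 : Convex ℝ {x : EuclideanSpace ℝ (Fin N) | u₂ < ⟪e, x⟫} :=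
    convex_halfSpace_gt (innerSL ℝ e).toLinearMap.isLinear u₂
  obtain ⟨σ₁, h₁, hσ₁⟩ := exists_admissibleField_le_integral_vdiv hN (hKo.inter (ho1 u₁))
    (hKb.subset inter_subset_left) (hKc.inter hc1) hk₁ hK₁ (hE.inter (ho1 s).measurableSet)
    ha₁ hE₁ (show 0 < ε / 3 by positivity)
  obtain ⟨σ₂, h₂, hσ₂⟩ := exists_admissibleField_le_integral_vdiv hN (hKo.inter (ho2 u₂))
    (hKb.subset inter_subset_left) (hKc.inter hc2) hk₂ hK₂ (hE.inter (ho2 s).measurableSet)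
    ha₂ hE₂ (show 0 < ε / 3 by positivity)
  have hlim := tendsto_integral_clamp he (h₁.integrableOn_vdiv hEf) (h₂.integrableOn_vdiv hEf) s
  filter_upwards [hlim.eventually_const_lt (sub_lt_self _ (show 0 < ε / 3 by positivity)),
    self_mem_nhdsWithin] with h hh h0
  have := integral_glue_clamp_le hKb hKc hE hEf hM h₁ h₂ (s := s) (h := h) h0
  linarith

end Cut

section

lemma tendsto_div_comp_of_eventually_le {q D τ : ℝ → ℝ}
    (hq : ∀ᶠ δ in 𝓝[>] (0 : ℝ), 0 < q δ)
    (h : ∀ η ∈ Ioo (0 : ℝ) 1, ∀ᶠ δ in 𝓝[>] (0 : ℝ), ∀ᶠ h in 𝓝[>] (0 : ℝ),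
      (1 - η) * q δ ≤ D h ∧ D h ≤ (1 + η) * q δ)
    (hτ : Filter.Tendsto τ (𝓝[>] 0) (𝓝[>] 0)) :
    Filter.Tendsto (fun h => D h / q (τ h)) (𝓝[>] 0) (𝓝 1) := by
  have hev : ∀ η ∈ Ioo (0 : ℝ) 1, ∀ᶠ h in 𝓝[>] (0 : ℝ),
      (1 - η) * (1 - η) / (1 + η) ≤ D h / q (τ h) ∧
        D h / q (τ h) ≤ (1 + η) * (1 + η) / (1 - η) := by
    intro η hη
    have h1 := (h η hη).and hq
    obtain ⟨δ₀, hδ₀, hq₀⟩ := h1.exists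
    have h1η : 0 < 1 - η := by linarith [hη.2]
    have h2η : 0 < 1 + η := by linarith [hη.1]
    filter_upwards [hδ₀, hτ.eventually h1] with t ht ⟨h2, hq2⟩
    obtain ⟨t', ht', ht''⟩ := (hδ₀.and h2).exists
    have e1 := ht'.1.trans ht''.2
    have e2 := ht''.1.trans ht'.2
    rw [le_div_iff₀ hq2, div_le_iff₀ hq2, div_mul_eq_mul_div, div_le_iff₀ h2η, div_mul_eq_mul_div,
      le_div_iff₀ h1η]
    constructor
    · nlinarith [mul_le_mul_of_nonneg_left e2 h1η.le, mul_le_mul_of_nonneg_right ht.1 h2η.le]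
    · nlinarith [mul_le_mul_of_nonneg_left e1 h2η.le, mul_le_mul_of_nonneg_right ht.2 h1η.le]
  have hc1 : ContinuousAt (fun η : ℝ => (1 - η) * (1 - η) / (1 + η)) 0 := by
    refine ContinuousAt.div (by fun_prop) (by fun_prop) (by norm_num)
  have hc2 : ContinuousAt (fun η : ℝ => (1 + η) * (1 + η) / (1 - η)) 0 := by
    refine ContinuousAt.div (by fun_prop) (by fun_prop) (by norm_num)
  rw [tendsto_order]
  constructor
  · intro a ha
    have h1 : ∀ᶠ η in 𝓝[>] (0 : ℝ), a < (1 - η) * (1 - η) / (1 + η) :=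
      (hc1.eventually_const_lt (by simpa using ha)).filter_mono nhdsWithin_le_nhds
    obtain ⟨η, hη, hηI⟩ := (h1.and (Ioo_mem_nhdsGT (zero_lt_one (α := ℝ)))).exists
    exact (hev η hηI).mono fun t ht => hη.trans_le ht.1
  · intro a ha
    have h1 : ∀ᶠ η in 𝓝[>] (0 : ℝ), (1 + η) * (1 + η) / (1 - η) < a :=
      (hc2.eventually_lt_const (by simpa using ha)).filter_mono nhdsWithin_le_nhds
    obtain ⟨η, hη, hηI⟩ := (h1.and (Ioo_mem_nhdsGT (zero_lt_one (α := ℝ)))).exists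
    exact (hev η hηI).mono fun t ht => ht.2.trans_lt hη

/-- Two distribution functions with asymptotically equal difference quotients at equal levels
are translates of one another. -/
lemma exists_eq_translate {F Φ : ℝ → ℝ} {V : ℝ} (hV : 0 < V) (hF : Continuous F)
    (hFm : Monotone F) (hF0 : Filter.Tendsto F Filter.atBot (𝓝 0))
    (hF1 : Filter.Tendsto F Filter.atTop (𝓝 V)) (hΦ : Continuous Φ)
    (hΦm : Monotone Φ) (hΦ0 : Filter.Tendsto Φ Filter.atBot (𝓝 0))
    (hΦ1 : Filter.Tendsto Φ Filter.atTop (𝓝 V))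
    (hstrict : ∀ u, 0 < Φ u → Φ u < V → ∀ v, u < v → Φ u < Φ v)
    (hstrict' : ∀ u, 0 < Φ u → Φ u < V → ∀ v, v < u → Φ v < Φ u)
    (h : ∀ s u, 0 < F s → F s < V → Φ u = F s → ∀ η ∈ Ioo (0 : ℝ) 1,
      ∀ᶠ δ in 𝓝[>] (0 : ℝ), ∀ᶠ t in 𝓝[>] (0 : ℝ),
        (1 - η) * ((Φ (u + δ) - Φ u) / δ) ≤ (F (s + t) - F s) / t ∧
          (F (s + t) - F s) / t ≤ (1 + η) * ((Φ (u + δ) - Φ u) / δ)) :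
    ∃ c, ∀ s, F s = Φ (s + c) := by
  have hivt : ∀ G : ℝ → ℝ, Continuous G → Filter.Tendsto G Filter.atBot (𝓝 0) →
      Filter.Tendsto G Filter.atTop (𝓝 V) → ∀ y, 0 < y → y < V → ∃ x, G x = y := by
    intro G hG h0 h1 y hy0 hy1
    obtain ⟨a, ha⟩ := (h0.eventually_lt_const hy0).exists
    obtain ⟨b, hb⟩ := (h1.eventually_const_lt hy1).exists
    exact mem_range_of_exists_le_of_exists_ge hG ⟨a, ha.le⟩ ⟨b, hb.le⟩
  have hT : ∀ s, ∃ u, (0 < F s → F s < V → Φ u = F s) := by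
    intro s
    by_cases hs : 0 < F s ∧ F s < V
    · obtain ⟨u, hu⟩ := hivt Φ hΦ hΦ0 hΦ1 _ hs.1 hs.2
      exact ⟨u, fun _ _ => hu⟩
    · exact ⟨0, fun h1 h2 => absurd ⟨h1, h2⟩ hs⟩
  choose T hT using hT
  have hlt : ∀ s s', 0 < F s → F s < V → 0 < F s' → F s' < V → F s < F s' → T s < T s' := by
    intro s s' h1 h2 h3 h4 h5
    by_contra! hle
    have := hΦm hle
    rw [hT s h1 h2, hT s' h3 h4] at this
    linarith
  have hev : ∀ s, 0 < F s → F s < V → ∀ᶠ s' in 𝓝 s, 0 < F s' ∧ F s' < V := fun s h1 h2 =>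
    (hF.continuousAt.eventually_const_lt h1).and (hF.continuousAt.eventually_lt_const h2)
  have hTc : ∀ s, 0 < F s → F s < V → ContinuousAt T s := by
    intro s h1 h2
    have hTs := hT s h1 h2
    rw [ContinuousAt, tendsto_order]
    constructor
    · intro a ha
      have h3 := hstrict' (T s) (hTs ▸ h1) (hTs ▸ h2) a ha
      rw [hTs] at h3
      filter_upwards [hev s h1 h2, hF.continuousAt.eventually_const_lt h3] with s' ⟨h4, h5⟩ h6
      by_contra! hle
      have := hΦm hle
      rw [hT s' h4 h5] at this
      linarith
    · intro a ha
      have h3 := hstrict (T s) (hTs ▸ h1) (hTs ▸ h2) a ha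
      rw [hTs] at h3
      filter_upwards [hev s h1 h2, hF.continuousAt.eventually_lt_const h3] with s' ⟨h4, h5⟩ h6
      by_contra! hle
      have := hΦm hle
      rw [hT s' h4 h5] at this
      linarith
  have hderiv : ∀ s, 0 < F s → F s < V → HasDerivWithinAt (fun x => T x - x) 0 (Ici s) s := by
    intro s h1 h2
    have hTs := hT s h1 h2
    have hq : ∀ᶠ δ in 𝓝[>] (0 : ℝ), 0 < (Φ (T s + δ) - Φ (T s)) / δ := by
      filter_upwards [self_mem_nhdsWithin] with δ hδ
      have hδ : 0 < δ := hδ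
      exact div_pos (sub_pos.2 (hstrict (T s) (hTs ▸ h1) (hTs ▸ h2) _ (by linarith))) hδ
    have hs := h s (T s) h1 h2 hTs
    have hadd : Filter.Tendsto (fun t => s + t) (𝓝[>] 0) (𝓝 s) := by
      have : Filter.Tendsto (fun t : ℝ => s + t) (𝓝 0) (𝓝 (s + 0)) :=
        (continuous_const.add continuous_id).tendsto 0
      rw [add_zero] at this
      exact this.mono_left nhdsWithin_le_nhds
    have hD0 : ∀ᶠ t in 𝓝[>] (0 : ℝ), F s < F (s + t) := by
      obtain ⟨δ, hδ, hδq⟩ := ((hs (1 / 2) (by norm_num)).and hq).exists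
      filter_upwards [hδ, self_mem_nhdsWithin] with t ht ht0
      have ht0 : 0 < t := ht0
      have h3 : 0 < (F (s + t) - F s) / t := lt_of_lt_of_le (by positivity) ht.1
      rw [div_pos_iff_of_pos_right ht0] at h3
      linarith
    have hτ : Filter.Tendsto (fun t => T (s + t) - T s) (𝓝[>] 0) (𝓝[>] 0) := by
      refine tendsto_nhdsWithin_iff.2 ⟨?_, ?_⟩
      · have h3 := ((hTc s h1 h2).tendsto.comp hadd).sub_const (T s)
        rwa [sub_self] at h3
      · filter_upwards [hD0, hadd.eventually (hev s h1 h2)] with t ht ⟨h3, h4⟩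
        exact sub_pos.2 (hlt s _ h1 h2 h3 h4 ht)
    have hlim := tendsto_div_comp_of_eventually_le hq hs hτ
    have hlim2 : Filter.Tendsto (fun t => (T (s + t) - T s) / t) (𝓝[>] 0) (𝓝 1) := by
      refine hlim.congr' ?_
      filter_upwards [hD0, hadd.eventually (hev s h1 h2), self_mem_nhdsWithin,
        hτ.eventually self_mem_nhdsWithin] with t ht ⟨h3, h4⟩ ht0 hτ0
      have ht0 : 0 < t := ht0
      have hτ0 : 0 < T (s + t) - T s := hτ0
      have h5 : F (s + t) - F s ≠ 0 := (sub_pos.2 ht).ne'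
      rw [add_sub_cancel, hT _ h3 h4, hTs]
      field_simp
    rw [hasDerivWithinAt_iff_tendsto_slope, Ici_sdiff_left]
    have hsub : Filter.Tendsto (fun x => x - s) (𝓝[>] s) (𝓝[>] 0) := by
      refine tendsto_nhdsWithin_iff.2 ⟨?_, ?_⟩
      · have : Filter.Tendsto (fun t : ℝ => t - s) (𝓝 s) (𝓝 (s - s)) :=
          (continuous_id.sub continuous_const).tendsto s
        rw [sub_self] at this
        exact this.mono_left nhdsWithin_le_nhds
      · filter_upwards [self_mem_nhdsWithin] with x hx
        exact sub_pos.2 (mem_Ioi.1 hx)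
    have h6 := (hlim2.comp hsub).sub_const 1
    rw [sub_self] at h6
    refine h6.congr' ?_
    filter_upwards [self_mem_nhdsWithin] with x hx
    have hx : 0 < x - s := sub_pos.2 hx
    simp only [Function.comp, slope_def_field, add_sub_cancel]
    field_simp
    ring
  obtain ⟨s₀, hs₀⟩ := hivt F hF hF0 hF1 (V / 2) (by linarith) (by linarith)
  have hconst : ∀ a b, a ≤ b → 0 < F a → F b < V → T b - b = T a - a := by
    intro a b hab ha hb
    have hJ : ∀ x ∈ Icc a b, 0 < F x ∧ F x < V := fun x hx =>
      ⟨ha.trans_le (hFm hx.1), (hFm hx.2).trans_lt hb⟩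
    exact constant_of_has_deriv_right_zero (f := fun x => T x - x)
      (fun x hx => ((hTc x (hJ x hx).1 (hJ x hx).2).sub continuousAt_id).continuousWithinAt)
      (fun x hx => hderiv x (hJ x (Ico_subset_Icc_self hx)).1 (hJ x (Ico_subset_Icc_self hx)).2)
      b (right_mem_Icc.2 hab)
  refine ⟨T s₀ - s₀, ?_⟩
  set c := T s₀ - s₀ with hc
  have hTJ : ∀ s, 0 < F s → F s < V → F s = Φ (s + c) := by
    intro s h1 h2
    have h3 : T s - s = c := by
      rcases le_total s s₀ with h4 | h4
      · exact (hconst s s₀ h4 h1 (by linarith)).symm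
      · exact hconst s₀ s h4 (by linarith) h2
    rw [← hT s h1 h2, ← h3, add_sub_cancel]
  have hF0' : ∀ s, 0 ≤ F s := fun s => hFm.le_of_tendsto hF0 s
  have hF1' : ∀ s, F s ≤ V := fun s => hFm.ge_of_tendsto hF1 s
  have hΦ0' : ∀ s, 0 ≤ Φ s := fun s => hΦm.le_of_tendsto hΦ0 s
  have hΦ1' : ∀ s, Φ s ≤ V := fun s => hΦm.ge_of_tendsto hΦ1 s
  intro s
  by_cases hΦs : 0 < Φ (s + c) ∧ Φ (s + c) < V
  · obtain ⟨s', hs'⟩ := hivt F hF hF0 hF1 _ hΦs.1 hΦs.2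
    have h1 := hTJ s' (hs' ▸ hΦs.1) (hs' ▸ hΦs.2)
    rw [hs'] at h1
    have h2 : s = s' := by
      rcases lt_trichotomy s s' with h3 | h3 | h3
      · exact absurd h1 (hstrict _ hΦs.1 hΦs.2 _ (by linarith)).ne
      · exact h3
      · exact absurd h1.symm (hstrict' _ hΦs.1 hΦs.2 _ (by linarith)).ne
    rw [h2, hs', ← h2]
  by_cases hs : 0 < F s ∧ F s < V
  · exact hTJ s hs.1 hs.2
  have hmid := hTJ s₀ (by linarith) (by linarith)
  rcases (hF0' s).eq_or_lt with h1 | h1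
  · rcases (hΦ0' (s + c)).eq_or_lt with h2 | h2
    · rw [← h1, ← h2]
    · have h3 : V ≤ Φ (s + c) := not_lt.1 fun h => hΦs ⟨h2, h⟩
      have h4 : s ≤ s₀ := by
        by_contra! hlt
        have := hFm hlt.le
        linarith
      have := hΦm (add_le_add_left h4 c)
      linarith
  · have h2 : V ≤ F s := not_lt.1 fun h => hs ⟨h1, h⟩
    rcases (hΦ1' (s + c)).eq_or_lt with h3 | h3
    · linarith [hF1' s]
    · have h4 : Φ (s + c) ≤ 0 := not_lt.1 fun h => hΦs ⟨h, h3⟩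
      have h5 : s₀ ≤ s := by
        by_contra! hlt
        have := hFm hlt.le
        linarith
      have := hΦm (add_le_add_left h5 c)
      linarith

end

lemma pow_sub_pow_le_mul {x y : ℝ} (hy : 0 ≤ y) (hxy : y ≤ x) (n : ℕ) :
    x ^ n - y ^ n ≤ n * x ^ (n - 1) * (x - y) := by
  induction n with
  | zero => simp
  | succ n ih =>
    rcases n with _ | n
    · simp
    · simp only [Nat.add_sub_cancel] at ih ⊢
      have h1 : y ^ (n + 1) * (x - y) ≤ x ^ (n + 1) * (x - y) := by
        gcongr
      have h2 := mul_le_mul_of_nonneg_left ih (hy.trans hxy)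
      push_cast at ih h2 ⊢
      calc x ^ (n + 1 + 1) - y ^ (n + 1 + 1) =
          x * (x ^ (n + 1) - y ^ (n + 1)) + y ^ (n + 1) * (x - y) := by ring
        _ ≤ x * ((n + 1) * x ^ n * (x - y)) + x ^ (n + 1) * (x - y) := add_le_add h2 h1
        _ = _ := by ring

lemma mul_le_pow_sub_pow {x y : ℝ} (hy : 0 ≤ y) (hxy : y ≤ x) (n : ℕ) :
    n * y ^ (n - 1) * (x - y) ≤ x ^ n - y ^ n := by
  induction n with
  | zero => simp
  | succ n ih =>
    rcases n with _ | n
    · simp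
    · simp only [Nat.add_sub_cancel] at ih ⊢
      have h1 : y ^ (n + 1) * (x - y) ≤ x ^ (n + 1) * (x - y) := by
        gcongr
      have h2 := mul_le_mul_of_nonneg_left ih hy
      push_cast at ih h2 ⊢
      calc (n + 1 + 1) * y ^ (n + 1) * (x - y) =
          y * ((n + 1) * y ^ n * (x - y)) + y ^ (n + 1) * (x - y) := by ring
        _ ≤ y * (x ^ (n + 1) - y ^ (n + 1)) + x ^ (n + 1) * (x - y) := add_le_add h2 h1
        _ = _ := by ring

section Rigidity
variable {N : ℕ} {K : Set (EuclideanSpace ℝ (Fin N))} {e : EuclideanSpace ℝ (Fin N)}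

lemma volume_real_slab_pos (hKo : IsOpen K) (hKb : Bornology.IsBounded K) (hKc : Convex ℝ K)
    {x y : EuclideanSpace ℝ (Fin N)} (hx : x ∈ K) (hy : y ∈ K) {a b : ℝ} (hab : a < b)
    (hxb : ⟪e, x⟫ < b) (hya : a < ⟪e, y⟫) (hxy : ⟪e, x⟫ < ⟪e, y⟫) :
    0 < volume.real (K ∩ {x | a < ⟪e, x⟫ ∧ ⟪e, x⟫ < b}) := by
  have hcont : Continuous fun x : EuclideanSpace ℝ (Fin N) => ⟪e, x⟫ := by fun_prop
  have ho : IsOpen (K ∩ {x | a < ⟪e, x⟫ ∧ ⟪e, x⟫ < b}) :=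
    hKo.inter ((isOpen_Ioo (a := a) (b := b)).preimage hcont)
  have hne : (K ∩ {x | a < ⟪e, x⟫ ∧ ⟪e, x⟫ < b}).Nonempty := by
    obtain ⟨w, hw1, hw2⟩ := exists_between
      (max_lt (lt_min hab hya) (lt_min hxb hxy) : max a ⟪e, x⟫ < min b ⟪e, y⟫)
    have hmem : w ∈ (fun x : EuclideanSpace ℝ (Fin N) => ⟪e, x⟫) '' K :=
      hKc.isPreconnected.intermediate_value hx hy hcont.continuousOn
        ⟨(le_max_right _ _).trans hw1.le, hw2.le.trans (min_le_right _ _)⟩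
    obtain ⟨z, hz, hzw⟩ := hmem
    refine ⟨z, hz, ?_, ?_⟩
    · simp only [hzw]
      exact (le_max_left _ _).trans_lt hw1
    · simp only [hzw]
      exact hw2.trans_le (min_le_left _ _)
  exact ENNReal.toReal_pos (ho.measure_pos _ hne).ne'
    (hKb.subset inter_subset_left).measure_lt_top.ne

lemma eventually_bounds_slope (hN : N ≠ 0) (hKo : IsOpen K) (hKb : Bornology.IsBounded K)
    (hKc : Convex ℝ K) {E : Set (EuclideanSpace ℝ (Fin N))} (hE : MeasurableSet E)
    (hEK : volume.real E = volume.real K) (hEf : volume E < ⊤)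
    (hM : ∀ σ, AdmissibleField K σ → ∫ x in E, vdiv σ x ≤ N * volume.real K) (he : e ≠ 0)
    {s u : ℝ} (hs0 : 0 < volume.real (E ∩ {x | ⟪e, x⟫ < s}))
    (hs1 : volume.real (E ∩ {x | ⟪e, x⟫ < s}) < volume.real K)
    (hsu : volume.real (K ∩ {x | ⟪e, x⟫ < u}) = volume.real (E ∩ {x | ⟪e, x⟫ < s}))
    (hlt : ∀ v, u < v →
      volume.real (K ∩ {x | ⟪e, x⟫ < u}) < volume.real (K ∩ {x | ⟪e, x⟫ < v}))
    {η : ℝ} (hη : η ∈ Ioo (0 : ℝ) 1) :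
    ∀ᶠ δ in 𝓝[>] (0 : ℝ), ∀ᶠ t in 𝓝[>] (0 : ℝ),
      (1 - η) * ((volume.real (K ∩ {x | ⟪e, x⟫ < u + δ}) -
        volume.real (K ∩ {x | ⟪e, x⟫ < u})) / δ) ≤
        (volume.real (E ∩ {x | ⟪e, x⟫ < s + t}) - volume.real (E ∩ {x | ⟪e, x⟫ < s})) / t ∧
      (volume.real (E ∩ {x | ⟪e, x⟫ < s + t}) - volume.real (E ∩ {x | ⟪e, x⟫ < s})) / t ≤
        (1 + η) * ((volume.real (K ∩ {x | ⟪e, x⟫ < u + δ}) -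
        volume.real (K ∩ {x | ⟪e, x⟫ < u})) / δ) := by
  have hKf : volume K < ⊤ := hKb.measure_lt_top
  set V := volume.real K with hV
  set Φ : ℝ → ℝ := fun v => volume.real (K ∩ {x | ⟪e, x⟫ < v}) with hΦ
  set r : ℝ → ℝ := fun y => y ^ (1 / (N : ℝ)) with hr
  have hrc : Continuous r := Real.continuous_rpow_const (by positivity)
  have hrp : ∀ y, 0 < y → 0 < r y := fun y hy => Real.rpow_pos_of_pos hy _
  have hrN : ∀ A : Set (EuclideanSpace ℝ (Fin N)), volume A < ⊤ →
      volume A = ENNReal.ofReal (r (volume.real A) ^ N) := fun A hA =>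
    ofReal_pow_rpow_inv hN hA.ne
  have hrN' : ∀ y, 0 ≤ y → r y ^ N = y := by
    intro y hy
    rw [hr, ← Real.rpow_natCast, ← Real.rpow_mul hy,
      one_div_mul_cancel (by exact_mod_cast hN), Real.rpow_one]
  have hΦc : Continuous Φ := continuous_volume_real_inter_inner_lt he hKf
  have hΦE : Φ u = volume.real (E ∩ {x | ⟪e, x⟫ < s}) := hsu
  have hΦu0 : 0 < Φ u := hΦE ▸ hs0
  have hΦu1 : Φ u < V := hΦE ▸ hs1
  have hKr : ∀ v, volume (K ∩ {x | v < ⟪e, x⟫}) = ENNReal.ofReal (r (V - Φ v) ^ N) := by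
    intro v
    have h : volume.real (K ∩ {x | v < ⟪e, x⟫}) = V - Φ v :=
      eq_sub_of_add_eq' (volume_real_inter_inner_lt_add he hKf v)
    rw [hrN _ (measure_lt_top_of_subset inter_subset_left hKf.ne), h]
  have hKl : ∀ v, volume (K ∩ {x | ⟪e, x⟫ < v}) = ENNReal.ofReal (r (Φ v) ^ N) := fun v =>
    hrN _ (measure_lt_top_of_subset inter_subset_left hKf.ne)
  have hEl : volume (E ∩ {x | ⟪e, x⟫ < s}) = ENNReal.ofReal (r (Φ u) ^ N) := by
    rw [hrN _ (measure_lt_top_of_subset inter_subset_left hEf.ne), hΦE]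
  have hEr : volume (E ∩ {x | s < ⟪e, x⟫}) = ENNReal.ofReal (r (V - Φ u) ^ N) := by
    have h : volume.real (E ∩ {x | s < ⟪e, x⟫}) = V - Φ u := by
      rw [hΦE, ← hEK]
      exact eq_sub_of_add_eq' (volume_real_inter_inner_lt_add he hEf s)
    rw [hrN _ (measure_lt_top_of_subset inter_subset_left hEf.ne), h]
  have hadd : Filter.Tendsto (fun δ : ℝ => u + δ) (𝓝[>] 0) (𝓝 u) := by
    have : Filter.Tendsto (fun t : ℝ => u + t) (𝓝 0) (𝓝 (u + 0)) :=
      (continuous_const.add continuous_id).tendsto 0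
    rw [add_zero] at this
    exact this.mono_left nhdsWithin_le_nhds
  have hα := hrp _ hΦu0
  have hβ := hrp _ (sub_pos.2 hΦu1)
  have hc1 : ∀ᶠ v in 𝓝 u, (1 - η / 2) * r (Φ v) ^ (N - 1) < r (Φ u) ^ (N - 1) := by
    have : ContinuousAt (fun v => (1 - η / 2) * r (Φ v) ^ (N - 1)) u := by fun_prop
    refine this.eventually_lt_const ?_
    have : 0 < r (Φ u) ^ (N - 1) := by positivity
    nlinarith [hη.1]
  have hc2 : ∀ᶠ v in 𝓝 u, r (V - Φ u) ^ (N - 1) < (1 + η / 2) * r (V - Φ v) ^ (N - 1) := by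
    have : ContinuousAt (fun v => (1 + η / 2) * r (V - Φ v) ^ (N - 1)) u := by fun_prop
    refine this.eventually_const_lt ?_
    have : 0 < r (V - Φ u) ^ (N - 1) := by positivity
    nlinarith [hη.1]
  filter_upwards [hadd.eventually hc1, hadd.eventually hc2,
    hadd.eventually (hΦc.continuousAt.eventually_lt_const hΦu1), self_mem_nhdsWithin]
    with δ h1 h2 h3 hδ
  have hδ : 0 < δ := hδ
  have h4 : Φ u < Φ (u + δ) := hlt _ (by linarith)
  have h5 : 0 < Φ (u + δ) := hΦu0.trans h4
  have hα' := hrp _ h5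
  have hβ' := hrp _ (sub_pos.2 h3)
  have hαα : r (Φ u) ≤ r (Φ (u + δ)) :=
    Real.rpow_le_rpow hΦu0.le h4.le (by positivity)
  have hββ : r (V - Φ (u + δ)) ≤ r (V - Φ u) :=
    Real.rpow_le_rpow (sub_pos.2 h3).le (by linarith) (by positivity)
  have hN0 : (0 : ℝ) ≤ N := N.cast_nonneg
  have hε : 0 < η / 2 * (Φ (u + δ) - Φ u) := mul_pos (by linarith [hη.1]) (sub_pos.2 h4)
  have hq1 := eventually_slab_le hN hKo hKb hKc hE hEf hM he hα' hβ hα hβ (hKl (u + δ)) (hKr u)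
    hEl hEr hε
  have hq2 := eventually_slab_le hN hKo hKb hKc hE hEf hM he hα hβ' hα hβ (hKl u) (hKr (u + δ))
    hEl hEr hε
  have hsum : ∀ y, 0 < y → N * y = N * r y * r y ^ (N - 1) := by
    intro y hy
    rw [mul_assoc, mul_pow_sub_one hN, hrN' y hy.le]
  have e1 := hsum _ hΦu0
  have e2 := hsum _ (sub_pos.2 hΦu1)
  have g1 := pow_sub_pow_le_mul hα.le hαα N
  have g2 := mul_le_pow_sub_pow hβ'.le hββ N
  rw [hrN' _ hΦu0.le, hrN' _ h5.le] at g1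
  rw [hrN' _ (sub_pos.2 hΦu1).le, hrN' _ (sub_pos.2 h3).le] at g2
  have k1 : (1 - η / 2) * (Φ (u + δ) - Φ u) ≤
      N * r (Φ u) ^ (N - 1) * (r (Φ (u + δ)) - r (Φ u)) := by
    calc (1 - η / 2) * (Φ (u + δ) - Φ u) ≤
        (1 - η / 2) * (N * r (Φ (u + δ)) ^ (N - 1) * (r (Φ (u + δ)) - r (Φ u))) := by
          gcongr
          linarith [hη.2]
      _ = N * ((1 - η / 2) * r (Φ (u + δ)) ^ (N - 1)) * (r (Φ (u + δ)) - r (Φ u)) := by ring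
      _ ≤ _ := by
          gcongr
  have k2 : N * r (V - Φ u) ^ (N - 1) * (r (V - Φ u) - r (V - Φ (u + δ))) ≤
      (1 + η / 2) * (Φ (u + δ) - Φ u) := by
    calc N * r (V - Φ u) ^ (N - 1) * (r (V - Φ u) - r (V - Φ (u + δ))) ≤
        N * ((1 + η / 2) * r (V - Φ (u + δ)) ^ (N - 1)) *
          (r (V - Φ u) - r (V - Φ (u + δ))) := by
          gcongr
      _ = (1 + η / 2) * (N * r (V - Φ (u + δ)) ^ (N - 1) *
          (r (V - Φ u) - r (V - Φ (u + δ)))) := by ring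
      _ ≤ (1 + η / 2) * (V - Φ u - (V - Φ (u + δ))) := by
          gcongr
          linarith [hη.1]
      _ = _ := by ring
  filter_upwards [hq1, hq2, self_mem_nhdsWithin] with t ht1 ht2 ht
  have ht : 0 < t := ht
  have hst := volume_real_inter_inner_lt_sub he hEf (s := s) (t := s + t) (by linarith)
  rw [hst]
  change (1 - η) * ((Φ (u + δ) - Φ u) / δ) ≤ _ ∧ _ ≤ (1 + η) * ((Φ (u + δ) - Φ u) / δ)
  rw [← mul_div_assoc, ← mul_div_assoc, div_le_iff₀ hδ, le_div_iff₀ hδ]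
  set D := volume.real (E ∩ {x | s < ⟪e, x⟫ ∧ ⟪e, x⟫ < s + t}) / t
  constructor
  · linarith
  · linarith

/-- A set of the same volume as `K` saturating the Wulff inequality has the same distribution as
`K`, up to translation, in every direction. -/
lemma exists_translate_distribution (hN : N ≠ 0) (hKo : IsOpen K) (hKb : Bornology.IsBounded K)
    (hKc : Convex ℝ K) (hKne : K.Nonempty) {E : Set (EuclideanSpace ℝ (Fin N))}
    (hE : MeasurableSet E) (hEK : volume.real E = volume.real K) (hEf : volume E < ⊤)
    (hM : ∀ σ, AdmissibleField K σ → ∫ x in E, vdiv σ x ≤ N * volume.real K) (he : e ≠ 0) :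
    ∃ c, ∀ s, volume.real (E ∩ {x | ⟪e, x⟫ < s}) = volume.real (K ∩ {x | ⟪e, x⟫ < s + c}) := by
  have hKf : volume K < ⊤ := hKb.measure_lt_top
  have hV : 0 < volume.real K := ENNReal.toReal_pos (hKo.measure_pos _ hKne).ne' hKf.ne
  have hpts : ∀ u, 0 < volume.real (K ∩ {x | ⟪e, x⟫ < u}) →
      volume.real (K ∩ {x | ⟪e, x⟫ < u}) < volume.real K →
      ∃ x ∈ K, ∃ y ∈ K, ⟪e, x⟫ < u ∧ u < ⟪e, y⟫ := by
    intro u h0 h1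
    have h2 : 0 < volume.real (K ∩ {x | u < ⟪e, x⟫}) := by
      linarith [volume_real_inter_inner_lt_add he hKf u]
    obtain ⟨x, hx⟩ := nonempty_of_measureReal_ne_zero h0.ne'
    obtain ⟨y, hy⟩ := nonempty_of_measureReal_ne_zero h2.ne'
    exact ⟨x, hx.1, y, hy.1, hx.2, hy.2⟩
  have hstrict : ∀ u, 0 < volume.real (K ∩ {x | ⟪e, x⟫ < u}) →
      volume.real (K ∩ {x | ⟪e, x⟫ < u}) < volume.real K → ∀ v, u < v →
      volume.real (K ∩ {x | ⟪e, x⟫ < u}) < volume.real (K ∩ {x | ⟪e, x⟫ < v}) := by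
    intro u h0 h1 v huv
    obtain ⟨x, hx, y, hy, hxu, hyu⟩ := hpts u h0 h1
    have := volume_real_slab_pos hKo hKb hKc hx hy huv (hxu.trans huv) hyu (hxu.trans hyu)
    rw [← volume_real_inter_inner_lt_sub he hKf huv.le] at this
    linarith
  refine exists_eq_translate hV (continuous_volume_real_inter_inner_lt he hEf)
    (monotone_volume_real_inter_inner_lt hEf) (tendsto_volume_real_inter_inner_lt_atBot hE hEf)
    (hEK ▸ tendsto_volume_real_inter_inner_lt_atTop hEf)
    (continuous_volume_real_inter_inner_lt he hKf)
    (monotone_volume_real_inter_inner_lt hKf)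
    (tendsto_volume_real_inter_inner_lt_atBot hKo.measurableSet hKf)
    (tendsto_volume_real_inter_inner_lt_atTop hKf) hstrict ?_ ?_
  · intro u h0 h1 v huv
    obtain ⟨x, hx, y, hy, hxu, hyu⟩ := hpts u h0 h1
    have := volume_real_slab_pos hKo hKb hKc hx hy huv hxu (huv.trans hyu) (hxu.trans hyu)
    rw [← volume_real_inter_inner_lt_sub he hKf huv.le] at this
    linarith
  · intro s u h0 h1 hsu η hη
    exact eventually_bounds_slope hN hKo hKb hKc hE hEK hEf hM he h0 h1 hsu
      (hstrict u (hsu ▸ h0) (hsu ▸ h1)) hη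

end Rigidity

section CharFun

variable {N : ℕ}

lemma map_inner_eq_of_distribution {K E : Set (EuclideanSpace ℝ (Fin N))}
    {e : EuclideanSpace ℝ (Fin N)} {c : ℝ} (hE : volume E < ⊤) (hK : volume K < ⊤)
    (hEK : volume.real E = volume.real K)
    (hc : ∀ s, volume.real (E ∩ {x | ⟪e, x⟫ < s}) = volume.real (K ∩ {x | ⟪e, x⟫ < s + c})) :
    (volume.restrict E).map (fun x => ⟪e, x⟫) =
      (volume.restrict K).map (fun x => ⟪e, x⟫ - c) := by
  have hcont : Continuous fun x : EuclideanSpace ℝ (Fin N) => ⟪e, x⟫ := by fun_prop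
  have hcont' : Continuous fun x : EuclideanSpace ℝ (Fin N) => ⟪e, x⟫ - c := by fun_prop
  have : IsFiniteMeasure (volume.restrict E) := ⟨by simpa using hE⟩
  have : IsFiniteMeasure (volume.restrict K) := ⟨by simpa using hK⟩
  refine Measure.ext_of_Ici _ _ fun s => ?_
  rw [Measure.map_apply hcont.measurable measurableSet_Ici,
    Measure.map_apply hcont'.measurable measurableSet_Ici,
    Measure.restrict_apply (hcont.measurable measurableSet_Ici),
    Measure.restrict_apply (hcont'.measurable measurableSet_Ici), inter_comm, inter_comm _ K]
  rw [← ENNReal.toReal_eq_toReal_iff' (measure_lt_top_of_subset inter_subset_left hE.ne).ne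
    (measure_lt_top_of_subset inter_subset_left hK.ne).ne]
  have h1 : E ∩ (fun x => ⟪e, x⟫) ⁻¹' Ici s = E \ {x | ⟪e, x⟫ < s} := by
    ext x; simp
  have h2 : K ∩ (fun x => ⟪e, x⟫ - c) ⁻¹' Ici s = K \ {x | ⟪e, x⟫ < s + c} := by
    ext x; simp [le_sub_iff_add_le]
  rw [h1, h2]
  have m1 := measureReal_inter_add_sdiff (μ := volume) (s := E)
    (hcont.measurable (measurableSet_Iio (a := s))) hE.ne
  have m2 := measureReal_inter_add_sdiff (μ := volume) (s := K)
    (hcont.measurable (measurableSet_Iio (a := s + c))) hK.ne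
  have := hc s
  simp only [Measure.real] at *
  change (volume (E ∩ {x | ⟪e, x⟫ < s})).toReal + (volume (E \ {x | ⟪e, x⟫ < s})).toReal = _ at m1
  change (volume (K ∩ {x | ⟪e, x⟫ < s + c})).toReal +
    (volume (K \ {x | ⟪e, x⟫ < s + c})).toReal = _ at m2
  linarith

/-- A set of finite measure whose one-dimensional marginals are translates of those of a bounded
set `K` of the same measure is a translate of `K`. -/
lemma exists_restrict_eq_translate_of_distribution {K E : Set (EuclideanSpace ℝ (Fin N))}
    (hKb : Bornology.IsBounded K) (hKm : MeasurableSet K) (hK0 : 0 < volume.real K)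
    (hE : volume E < ⊤) (hEK : volume.real E = volume.real K)
    (hc : ∀ e : EuclideanSpace ℝ (Fin N), e ≠ 0 → ∃ c, ∀ s,
      volume.real (E ∩ {x | ⟪e, x⟫ < s}) = volume.real (K ∩ {x | ⟪e, x⟫ < s + c})) :
    ∃ x₀, volume.restrict E = volume.restrict {x | x - x₀ ∈ K} := by
  have hK : volume K < ⊤ := hKb.measure_lt_top
  have : IsFiniteMeasure (volume.restrict E) := ⟨by simpa using hE⟩
  have : IsFiniteMeasure (volume.restrict K) := ⟨by simpa using hK⟩
  have hidK : Integrable (fun x : EuclideanSpace ℝ (Fin N) => x) (volume.restrict K) := by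
    obtain ⟨R, hR⟩ := hKb.exists_norm_le
    exact Measure.integrableOn_of_bounded (M := R) hK.ne continuous_id'.aestronglyMeasurable
      (ae_restrict_of_forall_mem hKm hR)
  have hlinK : ∀ e : EuclideanSpace ℝ (Fin N), Integrable (fun x => ⟪e, x⟫)
      (volume.restrict K) := fun e => hidK.const_inner e
  have hlinE : ∀ e : EuclideanSpace ℝ (Fin N), Integrable (fun x => ⟪e, x⟫)
      (volume.restrict E) := by
    intro e
    rcases eq_or_ne e 0 with rfl | he
    · simp
    obtain ⟨c, h⟩ := hc e he
    have hm := map_inner_eq_of_distribution hE hK hEK h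
    have h1 : Integrable (fun y : ℝ => y) ((volume.restrict E).map (fun x => ⟪e, x⟫)) := by
      rw [hm, integrable_map_measure continuous_id'.aestronglyMeasurable
        (Continuous.aemeasurable (by fun_prop))]
      exact (hlinK e).sub (integrable_const c)
    rwa [integrable_map_measure continuous_id'.aestronglyMeasurable
        (Continuous.aemeasurable (by fun_prop))] at h1
  have hidE : Integrable (fun x : EuclideanSpace ℝ (Fin N) => x) (volume.restrict E) := by
    rw [integrable_piLp_iff]
    intro i
    simpa [EuclideanSpace.inner_single_left] using hlinE (EuclideanSpace.single i 1)
  set V := volume.real K with hV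
  set x₀ : EuclideanSpace ℝ (Fin N) := V⁻¹ • ((∫ x in E, x) - ∫ x in K, x) with hx₀
  refine ⟨x₀, ?_⟩
  have hmp : MeasurePreserving (fun x : EuclideanSpace ℝ (Fin N) => x - x₀) volume volume :=
    measurePreserving_sub_right volume x₀
  have hTE : volume {x | x - x₀ ∈ K} = volume K :=
    hmp.measure_preimage hKm.nullMeasurableSet
  have : IsFiniteMeasure (volume.restrict {x | x - x₀ ∈ K}) := ⟨by simpa [hTE] using hK⟩
  refine Measure.ext_of_charFun (funext fun e => ?_)
  rw [charFun_apply, charFun_apply]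
  rcases eq_or_ne e 0 with rfl | he
  · simp [Measure.real, hTE]
    exact hEK
  obtain ⟨c, h⟩ := hc e he
  have hm := map_inner_eq_of_distribution hE hK hEK h
  have hcx : -c = ⟪e, x₀⟫ := by
    have h1 : ∫ x in E, ⟪e, x⟫ = ∫ x in K, (⟪e, x⟫ - c) := by
      have := congrArg (fun m : Measure ℝ => ∫ y, y ∂m) hm
      rwa [integral_map (Continuous.aemeasurable (by fun_prop))
        continuous_id'.aestronglyMeasurable, integral_map (Continuous.aemeasurable (by fun_prop))
        continuous_id'.aestronglyMeasurable] at this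
    rw [integral_inner hidE, integral_sub (hlinK e) (integrable_const c), integral_inner hidK] at h1
    simp only [integral_const, measureReal_restrict_apply_univ, smul_eq_mul] at h1
    rw [hx₀, inner_smul_right, inner_sub_right, h1]
    field_simp
    ring
  have h2 : ∫ x in E, Complex.exp (⟪x, e⟫ * Complex.I) =
      ∫ x in K, Complex.exp ((⟪e, x⟫ - c : ℝ) * Complex.I) := by
    have := congrArg (fun m : Measure ℝ => ∫ y : ℝ, Complex.exp (y * Complex.I) ∂m) hm
    rw [integral_map (Continuous.aemeasurable (by fun_prop))
        (Continuous.aestronglyMeasurable (by fun_prop)),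
      integral_map (Continuous.aemeasurable (by fun_prop))
        (Continuous.aestronglyMeasurable (by fun_prop))] at this
    simpa only [real_inner_comm] using this
  rw [h2]
  have h3 := hmp.setIntegral_preimage_emb (measurableEmbedding_subRight x₀)
    (fun x => Complex.exp ((⟪e, x⟫ - c : ℝ) * Complex.I)) K
  rw [← h3]
  refine integral_congr_ae (Filter.Eventually.of_forall fun x => ?_)
  simp only [inner_sub_right, real_inner_comm e x]
  rw [← hcx]
  congr 3
  ring

/-- Rigidity in the Wulff inequality. -/
lemma exists_restrict_eq_translate (hN : N ≠ 0) {K E : Set (EuclideanSpace ℝ (Fin N))}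
    (hKo : IsOpen K) (hKb : Bornology.IsBounded K) (hKc : Convex ℝ K) (hKne : K.Nonempty)
    (hE : MeasurableSet E) (hEK : volume.real E = volume.real K) (hEf : volume E < ⊤)
    (hM : ∀ σ, AdmissibleField K σ → ∫ x in E, vdiv σ x ≤ N * volume.real K) :
    ∃ x₀, volume.restrict E = volume.restrict {x | x - x₀ ∈ K} :=
  exists_restrict_eq_translate_of_distribution hKb hKo.measurableSet
    (ENNReal.toReal_pos (hKo.measure_pos _ hKne).ne' hKb.measure_lt_top.ne) hEf hEK
    fun _ he => exists_translate_distribution hN hKo hKb hKc hKne hE hEK hEf hM he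

end CharFun

section DualNorm

variable {N : ℕ} {H : EuclideanSpace ℝ (Fin N) → ℝ}

lemma IsAnisoNorm.continuous (hH : IsAnisoNorm H) : Continuous H :=
  continuousOn_univ.1 (hH.conv.continuousOn isOpen_univ)

lemma IsAnisoNorm.exists_norm_bounds (hH : IsAnisoNorm H) :
    ∃ c C : ℝ, 0 < c ∧ 0 < C ∧ ∀ ξ, c * ‖ξ‖ ≤ H ξ ∧ H ξ ≤ C * ‖ξ‖ := by
  have h0 : H 0 = 0 := by simpa using hH.hom 0 0
  rcases (sphere (0 : EuclideanSpace ℝ (Fin N)) 1).eq_empty_or_nonempty with hs | hs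
  · refine ⟨1, 1, one_pos, one_pos, fun ξ => ?_⟩
    have : ξ = 0 := by
      by_contra h
      have : ‖ξ‖⁻¹ • ξ ∈ sphere (0 : EuclideanSpace ℝ (Fin N)) 1 := by
        simp [norm_smul, inv_mul_cancel₀ (norm_ne_zero_iff.2 h)]
      rw [hs] at this
      exact this
    simp [this, h0]
  obtain ⟨a, ha, hmin⟩ := (isCompact_sphere (0 : EuclideanSpace ℝ (Fin N)) 1).exists_isMinOn hs
    hH.continuous.continuousOn
  obtain ⟨b, hb, hmax⟩ := (isCompact_sphere (0 : EuclideanSpace ℝ (Fin N)) 1).exists_isMaxOn hs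
    hH.continuous.continuousOn
  have hne : ∀ a ∈ sphere (0 : EuclideanSpace ℝ (Fin N)) 1, a ≠ 0 := by
    rintro a ha rfl
    simp at ha
  refine ⟨H a, H b, hH.pos a (hne a ha), hH.pos b (hne b hb), fun ξ => ?_⟩
  rcases eq_or_ne ξ 0 with rfl | hξ
  · simp [h0]
  have hn : 0 < ‖ξ‖ := norm_pos_iff.2 hξ
  have hm : ‖ξ‖⁻¹ • ξ ∈ sphere (0 : EuclideanSpace ℝ (Fin N)) 1 := by
    simp [norm_smul, inv_mul_cancel₀ hn.ne']
  have he : H ξ = H (‖ξ‖⁻¹ • ξ) * ‖ξ‖ := by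
    rw [hH.hom, abs_of_pos (inv_pos.2 hn)]
    field_simp
  rw [he]
  exact ⟨mul_le_mul_of_nonneg_right (hmin hm) hn.le, mul_le_mul_of_nonneg_right (hmax hm) hn.le⟩

lemma IsAnisoNorm.bddAbove_dualNorm (hH : IsAnisoNorm H) (x : EuclideanSpace ℝ (Fin N)) :
    BddAbove ((fun ξ => ⟪x, ξ⟫ / H ξ) '' {ξ : EuclideanSpace ℝ (Fin N) | ξ ≠ 0}) := by
  obtain ⟨c, C, hc, hC, h⟩ := hH.exists_norm_bounds
  refine ⟨‖x‖ / c, ?_⟩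
  rintro _ ⟨ξ, hξ, rfl⟩
  rw [div_le_div_iff₀ (hH.pos ξ hξ) hc]
  calc ⟪x, ξ⟫ * c ≤ ‖x‖ * ‖ξ‖ * c := by
        gcongr
        exact real_inner_le_norm x ξ
    _ = ‖x‖ * (c * ‖ξ‖) := by ring
    _ ≤ ‖x‖ * H ξ := by
        gcongr
        exact (h ξ).1

lemma IsAnisoNorm.div_le_dualNorm (hH : IsAnisoNorm H) (x : EuclideanSpace ℝ (Fin N))
    {ξ : EuclideanSpace ℝ (Fin N)} (hξ : ξ ≠ 0) : ⟪x, ξ⟫ / H ξ ≤ dualNorm H x :=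
  le_csSup (hH.bddAbove_dualNorm x) ⟨ξ, hξ, rfl⟩

/-- The dual norm is a norm equivalent to the Euclidean one. -/
lemma IsAnisoNorm.exists_seminorm_eq_dualNorm (hH : IsAnisoNorm H) (hN : N ≠ 0) :
    ∃ p : Seminorm ℝ (EuclideanSpace ℝ (Fin N)), ⇑p = dualNorm H ∧ Continuous p ∧
      ∃ c : ℝ, 0 < c ∧ ∀ x, c * ‖x‖ ≤ p x := by
  have : Nonempty (Fin N) := ⟨⟨0, Nat.pos_of_ne_zero hN⟩⟩
  obtain ⟨ξ₀, hξ₀⟩ := exists_ne (0 : EuclideanSpace ℝ (Fin N))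
  have hne : ∀ x : EuclideanSpace ℝ (Fin N),
      ((fun ξ => ⟪x, ξ⟫ / H ξ) '' {ξ : EuclideanSpace ℝ (Fin N) | ξ ≠ 0}).Nonempty :=
    fun x => ⟨_, ξ₀, hξ₀, rfl⟩
  obtain ⟨c, C, hc, hC, h⟩ := hH.exists_norm_bounds
  let p : Seminorm ℝ (EuclideanSpace ℝ (Fin N)) := Seminorm.ofSMulLE (dualNorm H)
    (by
      refine le_antisymm (csSup_le (hne 0) ?_) ?_
      · rintro _ ⟨ξ, hξ, rfl⟩
        simp
      · simpa using hH.div_le_dualNorm 0 hξ₀)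
    (fun x y => by
      refine csSup_le (hne _) ?_
      rintro _ ⟨ξ, hξ, rfl⟩
      simp only [inner_add_left, add_div]
      exact add_le_add (hH.div_le_dualNorm x hξ) (hH.div_le_dualNorm y hξ))
    (fun a x => by
      refine csSup_le (hne _) ?_
      rintro _ ⟨ξ, hξ, rfl⟩
      have h1 := hH.div_le_dualNorm x hξ
      have h2 := hH.div_le_dualNorm x (neg_ne_zero.2 hξ)
      have h3 : H (-ξ) = H ξ := by simpa using hH.hom (-1) ξ
      rw [h3, inner_neg_right, neg_div] at h2
      simp only [real_inner_smul_left, mul_div_assoc, Real.norm_eq_abs]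
      calc a * (⟪x, ξ⟫ / H ξ) ≤ |a * (⟪x, ξ⟫ / H ξ)| := le_abs_self _
        _ = |a| * |⟪x, ξ⟫ / H ξ| := abs_mul _ _
        _ ≤ |a| * dualNorm H x := by
          gcongr
          exact abs_le.2 ⟨by linarith, h1⟩)
  refine ⟨p, rfl, continuousOn_univ.1 (p.convexOn.continuousOn isOpen_univ), C⁻¹,
    inv_pos.2 hC, fun x => ?_⟩
  rcases eq_or_ne x 0 with rfl | hx
  · simp
  refine le_trans ?_ (hH.div_le_dualNorm x hx)
  have hn : 0 < ‖x‖ := norm_pos_iff.2 hx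
  rw [real_inner_self_eq_norm_sq, inv_mul_eq_div, div_le_div_iff₀ hC (hH.pos x hx)]
  nlinarith [mul_le_mul_of_nonneg_left (h x).2 hn.le]

end DualNorm

section Cone

variable {N : ℕ} {S : Set (EuclideanSpace ℝ (Fin N))}

lemma IsOpenConvexCone.smul_closure_mem (hS : IsOpenConvexCone S) {x : EuclideanSpace ℝ (Fin N)}
    (hx : x ∈ closure S) {t : ℝ} (ht : 0 < t) : t • x ∈ closure S :=
  map_mem_closure (continuous_const_smul t) hx fun _ hy => hS.2.2 _ hy t ht

lemma IsOpenConvexCone.add_closure_mem (hS : IsOpenConvexCone S) {x y : EuclideanSpace ℝ (Fin N)}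
    (hx : x ∈ S) (hy : y ∈ closure S) : x + y ∈ S := by
  have h1 : (1 / 2 : ℝ) • x + (1 / 2 : ℝ) • y ∈ interior S :=
    hS.2.1.combo_interior_closure_mem_interior (by rwa [hS.1.interior_eq]) hy (by norm_num)
      (by norm_num) (by norm_num)
  rw [hS.1.interior_eq] at h1
  have h2 := hS.2.2 _ h1 2 two_pos
  rwa [smul_add, smul_smul, smul_smul, mul_one_div_cancel two_ne_zero, one_smul, one_smul] at h2

lemma IsOpenConvexCone.mem_lineality_of_mem_closure (hS : IsOpenConvexCone S)
    {x : EuclideanSpace ℝ (Fin N)} (hx : x ∈ closure S) (hx' : -x ∈ closure S) :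
    x ∈ lineality S := by
  intro y hy t
  rcases lt_trichotomy t 0 with ht | rfl | ht
  · have := hS.add_closure_mem hy (hS.smul_closure_mem hx' (neg_pos.2 ht))
    rwa [smul_neg, neg_smul, neg_neg] at this
  · simpa using hy
  · exact hS.add_closure_mem hy (hS.smul_closure_mem hx ht)

lemma sub_mem_iff_of_mem_lineality {x₀ : EuclideanSpace ℝ (Fin N)} (hx₀ : x₀ ∈ lineality S)
    {x : EuclideanSpace ℝ (Fin N)} : x - x₀ ∈ S ↔ x ∈ S := by
  constructor
  · intro h
    simpa using hx₀ _ h 1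
  · intro h
    simpa [sub_eq_add_neg] using hx₀ _ h (-1)

end Cone

section
open scoped Convolution
open ContinuousLinearMap (lsmul)

section ConeCutoff

variable {N : ℕ} {S : Set (EuclideanSpace ℝ (Fin N))}

/-- A smooth cutoff supported in a cone and nondecreasing along the directions of the cone. -/
lemma IsOpenConvexCone.exists_cutoff (hS : IsOpenConvexCone S) {e : EuclideanSpace ℝ (Fin N)}
    (he : e ∈ S) : ∃ η : EuclideanSpace ℝ (Fin N) → ℝ, ContDiff ℝ 1 η ∧
      (∀ x, η x ∈ Icc (0 : ℝ) 1) ∧ tsupport η ⊆ S ∧ (∀ x, x - (2 : ℝ) • e ∈ S → η x = 1) ∧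
      ∀ x, ∀ v ∈ closure S, 0 ≤ fderiv ℝ η x v := by
  obtain ⟨ε, hε, hεS⟩ := Metric.isOpen_iff.1 hS.1 e he
  have hadd : ∀ x ∈ S, ∀ y ∈ S, x + y ∈ S := fun x hx y hy =>
    hS.add_closure_mem hx (subset_closure hy)
  let φ : ContDiffBump (0 : EuclideanSpace ℝ (Fin N)) := ⟨ε / 4, ε / 2, by positivity, by linarith⟩
  set A : Set (EuclideanSpace ℝ (Fin N)) := {x | x - e ∈ S} with hA
  have hAo : IsOpen A := hS.1.preimage (by fun_prop)
  set g : EuclideanSpace ℝ (Fin N) → ℝ := A.indicator fun _ => 1 with hg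
  have hgi : LocallyIntegrable g :=
    (locallyIntegrable_const (1 : ℝ)).indicator hAo.measurableSet
  have hgI : ∀ x, g x ∈ Icc (0 : ℝ) 1 := fun x => by
    by_cases hx : x ∈ A <;> simp [hg, hx]
  have hgm : ∀ x, ∀ v ∈ closure S, g x ≤ g (x + v) := by
    intro x v hv
    by_cases hx : x ∈ A
    · have : x + v ∈ A := by
        have := hS.add_closure_mem hx hv
        rwa [sub_add_eq_add_sub] at this
      simp [hg, hx, this]
    · rw [hg, indicator_of_notMem hx]
      exact (hgI _).1
  set η := φ.normed volume ⋆[lsmul ℝ ℝ, volume] g with hη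
  have hηc : ContDiff ℝ 1 η := φ.hasCompactSupport_normed.contDiff_convolution_left _
    φ.contDiff_normed hgi
  have hintg : ∀ x, Integrable (fun y => φ.normed volume y • g (x - y)) := fun x =>
    φ.hasCompactSupport_normed.convolutionExists_left (lsmul ℝ ℝ)
      (φ.continuous_normed (μ := volume)) hgi x
  have hηm : ∀ x, ∀ v ∈ closure S, η x ≤ η (x + v) := by
    intro x v hv
    refine integral_mono (hintg x) (hintg (x + v)) fun y => ?_
    have := hgm (x - y) v hv
    rw [sub_add_eq_add_sub] at this
    exact mul_le_mul_of_nonneg_left this (φ.nonneg_normed y)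
  refine ⟨η, hηc, fun x => convolution_normed_mem (convex_Icc 0 1) isClosed_Icc hgi hgI x, ?_, ?_,
    ?_⟩
  · intro x hx
    obtain ⟨z, hz, hxz⟩ := Metric.mem_closure_iff.1 hx (ε / 2) (by positivity)
    have : ∃ y ∈ ball z (ε / 2), y ∈ A := by
      by_contra! h
      refine hz ?_
      have h0 : ∀ y ∈ ball z (ε / 2), g y = 0 := fun y hy => indicator_of_notMem (h y hy) _
      have hzz := h0 z (mem_ball_self (by positivity))
      rw [hη, φ.normed_convolution_eq_right (x₀ := z) fun y hy => by rw [h0 y hy, hzz], hzz]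
    obtain ⟨y, hy, hyA⟩ := this
    have h1 : e + (x - y) ∈ S := by
      refine hεS ?_
      rw [mem_ball, dist_eq_norm, add_sub_cancel_left, ← dist_eq_norm]
      calc dist x y ≤ dist x z + dist z y := dist_triangle _ _ _
        _ < ε / 2 + ε / 2 := add_lt_add hxz (by rwa [dist_comm, ← mem_ball])
        _ = ε := by ring
    have := hadd _ hyA _ h1
    rwa [← add_assoc, sub_add_cancel, add_sub_cancel] at this
  · intro x hx
    have h1 : ∀ y ∈ ball x (ε / 2), g y = 1 := by
      intro y hy
      have h2 : e + (y - x) ∈ S := by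
        refine hεS ?_
        rw [mem_ball, dist_eq_norm, add_sub_cancel_left, ← dist_eq_norm]
        exact (mem_ball.1 hy).trans (by linarith)
      have h3 := hadd _ hx _ h2
      have h4 : x - (2 : ℝ) • e + (e + (y - x)) = y - e := by
        rw [two_smul]; abel
      rw [h4] at h3
      exact indicator_of_mem (show y ∈ A from h3) _
    have hxx := h1 x (mem_ball_self (by positivity))
    rw [hη, φ.normed_convolution_eq_right (x₀ := x) fun y hy => by rw [h1 y hy, hxx], hxx]
  · intro x v hv
    have hmono : Monotone fun t : ℝ => η (x + t • v) := by
      intro s t hst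
      rcases hst.eq_or_lt with rfl | hst
      · exact le_rfl
      have := hηm (x + s • v) _ (hS.smul_closure_mem hv (sub_pos.2 hst))
      rwa [add_assoc, ← add_smul, add_sub_cancel] at this
    have hd : HasDerivAt (fun t : ℝ => η (x + t • v)) (fderiv ℝ η x v) 0 := by
      have h1 : HasDerivAt (fun t : ℝ => x + t • v) v 0 := by
        simpa using ((hasDerivAt_id (0 : ℝ)).smul_const v).const_add x
      have h2 : HasFDerivAt η (fderiv ℝ η x) (x + (0 : ℝ) • v) := by
        simpa using (hηc.differentiable one_ne_zero x).hasFDerivAt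
      exact h2.comp_hasDerivAt 0 h1
    rw [← hd.deriv]
    exact hmono.deriv_nonneg

/-- The relative perimeter dominates the divergence integral of fields which, near the boundary of
the cone, point into the cone. -/
lemma ofReal_setIntegral_vdiv_le_periW (hS : IsOpenConvexCone S) (hSne : S.Nonempty)
    {E : Set (EuclideanSpace ℝ (Fin N))} (hE : MeasurableSet E) (hEf : volume (S ∩ E) < ⊤)
    (p : Seminorm ℝ (EuclideanSpace ℝ (Fin N)))
    {σ ζ : EuclideanSpace ℝ (Fin N) → EuclideanSpace ℝ (Fin N)} (hσ : ContDiff ℝ 1 σ)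
    (hσb : ∃ R, ∀ x, ‖σ x‖ ≤ R) (hσd : ∃ C, ∀ x, ‖fderiv ℝ σ x‖ ≤ C)
    (hσS : ∀ᵐ x ∂volume.restrict (S ∩ E), σ x ∈ closure S) (hζ : ContDiff ℝ 1 ζ)
    (hζc : HasCompactSupport ζ) (hζS : tsupport ζ ⊆ S)
    (hp : ∀ x, ∀ c ∈ Icc (0 : ℝ) 1, p (c • σ x + ζ x) ≤ 1) :
    ENNReal.ofReal (∫ x in S ∩ E, (vdiv σ x + vdiv ζ x)) ≤ periW p (fun _ => 1) E S := by
  obtain ⟨e, he⟩ := hSne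
  obtain ⟨R, hR⟩ := hσb
  obtain ⟨D, hD⟩ := hσd
  obtain ⟨C, hC0, hC⟩ := exists_cutoff N
  have hm : MeasurableSet (S ∩ E) := hS.1.measurableSet.inter hE
  have hfin : IsFiniteMeasure (volume.restrict (S ∩ E)) := ⟨by simpa using hEf⟩
  have hL : ∀ n : ℕ, (0 : ℝ) < n + 1 := fun n => by positivity
  choose χ hχ hχc hχI hχ1 hχd using fun n : ℕ => hC _ (hL n)
  choose η hη hηI hηS hη1 hηd using fun n : ℕ =>
    hS.exists_cutoff (hS.2.2 e he _ (inv_pos.2 (hL n)))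
  have hσc := continuous_vdiv hσ
  have hζc' := continuous_vdiv hζ
  obtain ⟨Z, hZ⟩ : ∃ Z, ∀ x, ‖vdiv ζ x‖ ≤ Z := by
    obtain ⟨Z, hZ⟩ := (hζc.fderiv ℝ).exists_bound_of_continuous
      (hζ.continuous_fderiv one_ne_zero)
    exact ⟨N * Z, fun x => (abs_vdiv_le ζ x).trans (by gcongr; exact hZ x)⟩
  have hσZ : ∀ x, ‖vdiv σ x‖ ≤ N * D := fun x =>
    (abs_vdiv_le σ x).trans (by gcongr; exact hD x)
  have hR0 : 0 ≤ R := (norm_nonneg _).trans (hR 0)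
  have hprod : ∀ n x, ‖χ n x * η n x‖ ≤ 1 := by
    intro n x
    rw [norm_mul, Real.norm_of_nonneg (hχI n x).1, Real.norm_of_nonneg (hηI n x).1]
    exact mul_le_one₀ (hχI n x).2 (hηI n x).1 (hηI n x).2
  set f : ℕ → EuclideanSpace ℝ (Fin N) → ℝ := fun n x =>
    χ n x * η n x * vdiv σ x + vdiv ζ x with hf
  have hfc : ∀ n, Continuous (f n) := fun n =>
    (((hχ n).continuous.mul (hη n).continuous).mul hσc).add hζc'
  have hfb : ∀ n x, ‖f n x‖ ≤ N * D + Z := by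
    intro n x
    refine (norm_add_le _ _).trans (add_le_add ?_ (hZ x))
    rw [norm_mul]
    exact (mul_le_of_le_one_left (norm_nonneg _) (hprod n x)).trans (hσZ x)
  have hfi : ∀ n, Integrable (f n) (volume.restrict (S ∩ E)) := fun n =>
    Measure.integrableOn_of_bounded (M := N * D + Z) hEf.ne (hfc n).aestronglyMeasurable
      (Filter.Eventually.of_forall (hfb n))
  have hlim : Filter.Tendsto (fun n => ∫ x in S ∩ E, f n x) Filter.atTop
      (𝓝 (∫ x in S ∩ E, (vdiv σ x + vdiv ζ x))) := by
    refine tendsto_integral_of_dominated_convergence (fun _ => N * D + Z)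
      (fun n => (hfc n).aestronglyMeasurable) (integrable_const _)
      (fun n => Filter.Eventually.of_forall (hfb n)) ?_
    refine ae_restrict_of_forall_mem hm fun x hx => ?_
    refine tendsto_const_nhds.congr' ?_
    have h1 : ∀ᶠ n : ℕ in Filter.atTop, x - (2 : ℝ) • (((n : ℝ) + 1)⁻¹ • e) ∈ S := by
      have ht : Filter.Tendsto (fun n : ℕ => x - (2 : ℝ) • (((n : ℝ) + 1)⁻¹ • e)) Filter.atTop
          (𝓝 (x - (2 : ℝ) • ((0 : ℝ) • e))) := by
        have := tendsto_one_div_add_atTop_nhds_zero_nat (𝕜 := ℝ)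
        simp only [one_div] at this
        exact tendsto_const_nhds.sub ((this.smul_const e).const_smul 2)
      refine ht.eventually (hS.1.mem_nhds ?_)
      simpa using hx.1
    have h2 : ∀ᶠ n : ℕ in Filter.atTop, ‖x‖ < (n : ℝ) + 1 := by
      filter_upwards [Filter.eventually_ge_atTop ⌈‖x‖⌉₊] with n hn
      exact (Nat.ceil_le.1 hn).trans_lt (lt_add_one _)
    filter_upwards [h1, h2] with n hn1 hn2
    simp only [hf]
    rw [hη1 n x hn1, hχ1 n x (by simpa using hn2)]
    simp
  have herr : Filter.Tendsto (fun n : ℕ => C / ((n : ℝ) + 1) * R * volume.real (S ∩ E))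
      Filter.atTop (𝓝 0) := by
    have := (tendsto_one_div_add_atTop_nhds_zero_nat (𝕜 := ℝ)).mul_const
      (C * R * volume.real (S ∩ E))
    rw [zero_mul] at this
    refine this.congr fun n => ?_
    ring
  have hlim' := hlim.sub herr
  rw [sub_zero] at hlim'
  refine le_of_tendsto' ((ENNReal.continuous_ofReal.tendsto _).comp hlim') fun n => ?_
  have hω : ContDiff ℝ 1 fun x => χ n x * η n x := (hχ n).mul (hη n)
  set τ : EuclideanSpace ℝ (Fin N) → EuclideanSpace ℝ (Fin N) := fun x =>
    (χ n x * η n x) • σ x + ζ x with hτ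
  have hτd : ContDiff ℝ 1 τ := (hω.smul hσ).add hζ
  have hτs : Function.support τ ⊆ (tsupport (χ n) ∩ tsupport (η n)) ∪ tsupport ζ := by
    intro x hx
    by_contra h
    rw [mem_union, mem_inter_iff, not_or, not_and_or] at h
    refine hx ?_
    simp only [hτ]
    rw [image_eq_zero_of_notMem_tsupport h.2]
    rcases h.1 with h | h <;> simp [image_eq_zero_of_notMem_tsupport h]
  have hτs' : tsupport τ ⊆ (tsupport (χ n) ∩ tsupport (η n)) ∪ tsupport ζ :=
    closure_minimal hτs (((isClosed_tsupport _).inter (isClosed_tsupport _)).union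
      (isClosed_tsupport _))
  have hτS : tsupport τ ⊆ S :=
    hτs'.trans (union_subset (inter_subset_right.trans (hηS n)) hζS)
  have hτc : HasCompactSupport τ :=
    (((hχc n).isCompact.inter_right (isClosed_tsupport _)).union hζc.isCompact).of_isClosed_subset
      (isClosed_tsupport _) hτs'
  have hτp : ∀ x, p (τ x) ≤ 1 := fun x => hp x _
    ⟨mul_nonneg (hχI n x).1 (hηI n x).1, mul_le_one₀ (hχI n x).2 (hηI n x).1 (hηI n x).2⟩
  refine le_trans ?_ (le_iSup₂ (f := fun σ (_ : σ ∈ {σ : EuclideanSpace ℝ (Fin N) →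
    EuclideanSpace ℝ (Fin N) | ContDiff ℝ 1 σ ∧ HasCompactSupport σ ∧ tsupport σ ⊆ S ∧
    ∀ x, p (σ x) ≤ 1}) => ENNReal.ofReal (∫ x in E, vdiv σ x)) τ ⟨hτd, hτc, hτS, hτp⟩)
  refine ENNReal.ofReal_le_ofReal ?_
  have hEq : ∫ x in E, vdiv τ x = ∫ x in S ∩ E, vdiv τ x := by
    refine setIntegral_eq_of_subset_of_forall_sdiff_eq_zero hE inter_subset_right fun x hx => ?_
    have : x ∉ tsupport τ := fun h => hx.2 ⟨hτS h, hx.1⟩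
    simp [vdiv, fderiv_of_notMem_tsupport ℝ this]
  rw [hEq]
  have hτi : Integrable (vdiv τ) (volume.restrict (S ∩ E)) :=
    ((continuous_vdiv hτd).integrable_of_hasCompactSupport (by
      refine (hτc.fderiv ℝ).mono fun x hx h => hx ?_
      have : fderiv ℝ τ x = 0 := h
      simp [vdiv, this])).integrableOn
  have hconst : C / ((n : ℝ) + 1) * R * volume.real (S ∩ E) =
      ∫ _ in S ∩ E, C / ((n : ℝ) + 1) * R := by
    rw [setIntegral_const, smul_eq_mul, mul_comm]
  change (∫ x in S ∩ E, f n x) - C / ((n : ℝ) + 1) * R * volume.real (S ∩ E) ≤ _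
  rw [hconst, ← integral_sub (hfi n) (integrable_const _)]
  refine integral_mono_ae ((hfi n).sub (integrable_const _)) hτi ?_
  filter_upwards [hσS] with x hx
  have e1 : vdiv τ x = f n x + (χ n x * fderiv ℝ (η n) x (σ x) +
      η n x * fderiv ℝ (χ n) x (σ x)) := by
    have hωx := hω.differentiable one_ne_zero x
    have hσx := hσ.differentiable one_ne_zero x
    rw [hτ, vdiv_add (hωx.fun_smul hσx) (hζ.differentiable one_ne_zero x), vdiv_smul hωx hσx,
      fderiv_fun_mul ((hχ n).differentiable one_ne_zero x) ((hη n).differentiable one_ne_zero x)]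
    simp [hf]
    ring
  have h1 : 0 ≤ χ n x * fderiv ℝ (η n) x (σ x) := mul_nonneg (hχI n x).1 (hηd n x _ hx)
  have h2 : ‖η n x * fderiv ℝ (χ n) x (σ x)‖ ≤ C / ((n : ℝ) + 1) * R := by
    rw [norm_mul, Real.norm_of_nonneg (hηI n x).1]
    refine (mul_le_of_le_one_left (norm_nonneg _) (hηI n x).2).trans ?_
    exact ((fderiv ℝ (χ n) x).le_opNorm _).trans
      (mul_le_mul (hχd n x) (hR x) (norm_nonneg _) (div_nonneg hC0 (hL n).le))
  have h3 := (abs_le.1 h2).1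
  rw [e1]
  linarith

end ConeCutoff

end

section Flow

variable {N : ℕ}

lemma ContinuousLinearMap.det_eq_matrix_det
    (L : EuclideanSpace ℝ (Fin N) →L[ℝ] EuclideanSpace ℝ (Fin N)) :
    L.det = (Matrix.of fun i j => L (EuclideanSpace.single j 1) i).det := by
  change LinearMap.det (L : EuclideanSpace ℝ (Fin N) →ₗ[ℝ] EuclideanSpace ℝ (Fin N)) = _
  rw [← LinearMap.det_toMatrix (EuclideanSpace.basisFun (Fin N) ℝ).toBasis]
  congr 1

/-- First order expansion of the determinant at the identity. -/
lemma exists_abs_det_id_add_ge {ε : ℝ} (hε : 0 < ε) : ∃ δ : ℝ, 0 < δ ∧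
    ∀ L : EuclideanSpace ℝ (Fin N) →L[ℝ] EuclideanSpace ℝ (Fin N), ‖L‖ ≤ δ →
      1 + (∑ i, L (EuclideanSpace.single i 1) i) - ε * ‖L‖ ≤
        |(ContinuousLinearMap.id ℝ _ + L).det| := by
  set d : (EuclideanSpace ℝ (Fin N) →L[ℝ] EuclideanSpace ℝ (Fin N)) → ℝ := fun L =>
    (ContinuousLinearMap.id ℝ _ + L).det with hd
  have hdet : ∀ L, d L = (1 + Matrix.of fun i j => L (EuclideanSpace.single j 1) i).det := by
    intro L
    rw [hd]
    simp only
    rw [ContinuousLinearMap.det_eq_matrix_det]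
    congr 1
    ext i j
    simp [Matrix.one_apply]
  have hdiff : Differentiable ℝ d := by
    have : d = fun L : EuclideanSpace ℝ (Fin N) →L[ℝ] EuclideanSpace ℝ (Fin N) =>
        ∑ σ : Equiv.Perm (Fin N), ((Equiv.Perm.sign σ : ℤ) : ℝ) *
          ∏ i, ((1 : Matrix (Fin N) (Fin N) ℝ) (σ i) i + L (EuclideanSpace.single i 1) (σ i)) := by
      funext L
      rw [hdet, Matrix.det_apply']
      simp
    rw [this]
    fun_prop
  have hderiv : ∀ L, fderiv ℝ d 0 L = ∑ i, L (EuclideanSpace.single i 1) i := by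
    intro L
    have h1 : HasDerivAt (fun t : ℝ => d (t • L)) (fderiv ℝ d 0 L) 0 := by
      have h2 : HasDerivAt (fun t : ℝ => t • L) L 0 := by
        simpa using (hasDerivAt_id (0 : ℝ)).smul_const L
      have h3 : HasFDerivAt d (fderiv ℝ d 0) ((0 : ℝ) • L) := by
        have e : (0 : ℝ) • L = 0 := zero_smul ℝ L
        exact e.symm ▸ (hdiff 0).hasFDerivAt
      exact h3.comp_hasDerivAt 0 h2
    set M : Matrix (Fin N) (Fin N) ℝ := Matrix.of fun i j => L (EuclideanSpace.single j 1) i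
    have h4 : (fun t : ℝ => d (t • L)) = fun t => 1 + M.trace * t +
        (Matrix.det (1 + (Polynomial.X : Polynomial ℝ) • M.map Polynomial.C)).divX.divX.eval t *
          t ^ 2 := by
      funext t
      rw [← Matrix.det_one_add_smul, hdet]
      congr 2
    rw [h4] at h1
    have h5 : HasDerivAt (fun t : ℝ => 1 + M.trace * t +
        (Matrix.det (1 + (Polynomial.X : Polynomial ℝ) • M.map Polynomial.C)).divX.divX.eval t *
          t ^ 2) M.trace 0 := by
      have := (((hasDerivAt_id (0 : ℝ)).const_mul M.trace).const_add 1).add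
        (((Matrix.det (1 + (Polynomial.X : Polynomial ℝ) •
          M.map Polynomial.C)).divX.divX.hasDerivAt 0).mul (hasDerivAt_pow 2 (0 : ℝ)))
      refine HasDerivAt.congr_deriv (f := _) this ?_
      simp
    rw [h1.unique h5]
    simp [Matrix.trace, M]
  have h0 : d 0 = 1 := by
    have : (Matrix.of fun i j => (0 : EuclideanSpace ℝ (Fin N) →L[ℝ] EuclideanSpace ℝ (Fin N))
        (EuclideanSpace.single j 1) i) = (0 : Matrix (Fin N) (Fin N) ℝ) := by
      ext i j
      simp
    rw [hdet, this, add_zero, Matrix.det_one]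
  have hlo := (hasFDerivAt_iff_isLittleO_nhds_zero.1 (hdiff 0).hasFDerivAt).def hε
  obtain ⟨δ, hδ, h⟩ := Metric.eventually_nhds_iff.1 hlo
  refine ⟨δ / 2, by positivity, fun L hL => ?_⟩
  have := h (y := L) (by rw [dist_zero_right]; linarith)
  rw [zero_add, h0, hderiv, Real.norm_eq_abs] at this
  have h2 := (abs_le.1 this).1
  exact le_trans (by linarith) (le_abs_self _)

/-- Flow estimate: pushing a Wulff ball along an admissible field enlarges its radius at unit
speed. -/
lemma setIntegral_vdiv_le_of_tsupport_subset {S : Set (EuclideanSpace ℝ (Fin N))} (hS : IsOpen S)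
    (p : Seminorm ℝ (EuclideanSpace ℝ (Fin N))) (hpc : Continuous p)
    {x₀ : EuclideanSpace ℝ (Fin N)} {k r : ℝ} (hr : 0 < r) (hk : 0 ≤ k)
    (hvol : ∀ s : ℝ, 0 < s → volume (S ∩ {x | p (x - x₀) < s}) = ENNReal.ofReal (s ^ N * k))
    {σ : EuclideanSpace ℝ (Fin N) → EuclideanSpace ℝ (Fin N)} (hσ : ContDiff ℝ 1 σ)
    (hσc : HasCompactSupport σ) (hσS : tsupport σ ⊆ S) (hσp : ∀ x, p (σ x) ≤ 1) :
    ∫ x in S ∩ {x | p (x - x₀) < r}, vdiv σ x ≤ N * r ^ (N - 1) * k := by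
  have hTo : ∀ s, IsOpen (S ∩ {x | p (x - x₀) < s}) := fun s =>
    hS.inter (isOpen_lt (by fun_prop) continuous_const)
  set T := S ∩ {x | p (x - x₀) < r} with hT
  have hTf : volume T < ⊤ := by rw [hvol r hr]; exact ENNReal.ofReal_lt_top
  have hTr : volume.real T = r ^ N * k := by
    rw [Measure.real, hvol r hr, ENNReal.toReal_ofReal (by positivity)]
  obtain ⟨M₀, hM₀⟩ := (hσc.fderiv ℝ).exists_bound_of_continuous
    (hσ.continuous_fderiv one_ne_zero)
  set M := max M₀ 1 with hM
  have hM1 : 0 < M := lt_of_lt_of_le one_pos (le_max_right _ _)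
  have hMd : ∀ x, ‖fderiv ℝ σ x‖ ≤ M := fun x => (hM₀ x).trans (le_max_left _ _)
  obtain ⟨R₀, hR₀⟩ := hσc.exists_bound_of_continuous hσ.continuous
  set R := max R₀ 1 with hR
  have hR1 : 0 < R := lt_of_lt_of_le one_pos (le_max_right _ _)
  have hRd : ∀ x, ‖σ x‖ ≤ R := fun x => (hR₀ x).trans (le_max_left _ _)
  obtain ⟨δ₁, hδ₁, hthick⟩ := hσc.isCompact.exists_thickening_subset_open hS hσS
  have hlip : ∀ x y, ‖σ x - σ y‖ ≤ M * ‖x - y‖ := fun x y =>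
    convex_univ.norm_image_sub_le_of_norm_fderiv_le
      (fun z _ => hσ.differentiable one_ne_zero z) (fun z _ => hMd z) (mem_univ y) (mem_univ x)
  have hdivi : Integrable (vdiv σ) (volume.restrict T) :=
    ((continuous_vdiv hσ).integrable_of_hasCompactSupport (by
      refine (hσc.fderiv ℝ).mono fun x hx h => hx ?_
      have : fderiv ℝ σ x = 0 := h
      simp [vdiv, this])).integrableOn
  have hfin : IsFiniteMeasure (volume.restrict T) := ⟨by simpa using hTf⟩
  have key : ∀ ε : ℝ, 0 < ε →
      ∫ x in T, vdiv σ x ≤ N * r ^ (N - 1) * k + ε * M * (r ^ N * k) := by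
    intro ε hε
    obtain ⟨δ₂, hδ₂, hdet⟩ := exists_abs_det_id_add_ge (N := N) hε
    have hev : ∀ᶠ t : ℝ in 𝓝[>] 0,
        ∫ x in T, vdiv σ x ≤ N * (r + t) ^ (N - 1) * k + ε * M * (r ^ N * k) := by
      have ht1 : ∀ᶠ t : ℝ in 𝓝[>] 0, t < min (1 / M) (min (δ₁ / R) (δ₂ / M)) :=
        Filter.Eventually.filter_mono nhdsWithin_le_nhds
          (eventually_lt_nhds (by positivity))
      filter_upwards [ht1, self_mem_nhdsWithin] with t ht ht0
      have ht0 : 0 < t := ht0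
      simp only [lt_min_iff, lt_div_iff₀ hM1, lt_div_iff₀ hR1] at ht
      obtain ⟨htM, htR, htδ⟩ := ht
      set Φ : EuclideanSpace ℝ (Fin N) → EuclideanSpace ℝ (Fin N) := fun x => x + t • σ x with hΦ
      have hinj : InjOn Φ T := by
        intro x _ y _ hxy
        have h1 : x - y = t • (σ y - σ x) := by
          simp only [hΦ] at hxy
          rw [smul_sub, sub_eq_sub_iff_add_eq_add, hxy, add_comm]
        have h2 : ‖x - y‖ ≤ t * M * ‖x - y‖ := by
          calc ‖x - y‖ = t * ‖σ y - σ x‖ := by rw [h1, norm_smul, Real.norm_of_nonneg ht0.le]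
            _ ≤ t * (M * ‖y - x‖) := by
                gcongr
                exact hlip y x
            _ = t * M * ‖x - y‖ := by rw [norm_sub_rev, mul_assoc]
        have h3 : ‖x - y‖ = 0 := by
          have := norm_nonneg (x - y)
          nlinarith
        exact sub_eq_zero.1 (norm_eq_zero.1 h3)
      have hder : ∀ x ∈ T, HasFDerivWithinAt Φ (ContinuousLinearMap.id ℝ _ + t • fderiv ℝ σ x)
          T x := fun x _ => ((hasFDerivAt_id x).add
            ((hσ.differentiable one_ne_zero x).hasFDerivAt.const_smul t)).hasFDerivWithinAt
      have hmaps : Φ '' T ⊆ S ∩ {x | p (x - x₀) < r + t} := by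
        rintro _ ⟨x, hx, rfl⟩
        refine ⟨?_, ?_⟩
        · by_cases h : x ∈ tsupport σ
          · refine hthick (Metric.mem_thickening_iff.2 ⟨x, h, ?_⟩)
            rw [dist_eq_norm, hΦ]
            simp only [add_sub_cancel_left, norm_smul, Real.norm_of_nonneg ht0.le]
            exact (mul_le_mul_of_nonneg_left (hRd x) ht0.le).trans_lt htR
          · simpa [hΦ, image_eq_zero_of_notMem_tsupport h] using hx.1
        · have h1 : Φ x - x₀ = (x - x₀) + t • σ x := by
            simp only [hΦ]
            abel
          show p (Φ x - x₀) < r + t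
          rw [h1]
          refine (map_add_le_add p _ _).trans_lt (add_lt_add_of_lt_of_le hx.2 ?_)
          rw [map_smul_eq_mul, Real.norm_of_nonneg ht0.le]
          exact mul_le_of_le_one_right ht0.le (hσp x)
      have hTm := (hTo r).measurableSet
      have himf : volume (Φ '' T) < ⊤ := (measure_mono hmaps).trans_lt (by
        rw [hvol (r + t) (by positivity)]; exact ENNReal.ofReal_lt_top)
      have hle : volume.real (Φ '' T) ≤ (r + t) ^ N * k := by
        have := measureReal_mono hmaps (μ := volume) (by
          rw [hvol (r + t) (by positivity)]; exact ENNReal.ofReal_ne_top)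
        rwa [measureReal_def volume (S ∩ _), hvol (r + t) (by positivity),
          ENNReal.toReal_ofReal (by positivity)] at this
      have hintg := integral_image_eq_integral_abs_det_fderiv_smul volume hTm hder hinj
        (fun _ => (1 : ℝ))
      have hii := (integrableOn_image_iff_integrableOn_abs_det_fderiv_smul volume hTm hder hinj
        (fun _ => (1 : ℝ))).1 (integrableOn_const himf.ne)
      simp only [smul_eq_mul, mul_one, integral_const, measureReal_restrict_apply_univ] at hintg hii
      rw [hintg] at hle
      have hge : ∫ x in T, (1 + t * vdiv σ x - ε * (t * M)) ≤
          ∫ x in T, |(ContinuousLinearMap.id ℝ _ + t • fderiv ℝ σ x).det| := by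
        refine integral_mono (((integrable_const _).add (hdivi.const_mul t)).sub
          (integrable_const _)) hii fun x => ?_
        have hn : ‖t • fderiv ℝ σ x‖ ≤ t * M := by
          rw [norm_smul, Real.norm_of_nonneg ht0.le]
          gcongr
          exact hMd x
        have h1 := hdet (t • fderiv ℝ σ x) (hn.trans htδ.le)
        have h2 : ∑ i, (t • fderiv ℝ σ x) (EuclideanSpace.single i 1) i = t * vdiv σ x := by
          simp [vdiv, Finset.mul_sum]
        rw [h2] at h1
        refine le_trans ?_ h1
        gcongr
      have hlhs : ∫ x in T, (1 + t * vdiv σ x - ε * (t * M)) =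
          r ^ N * k + t * (∫ x in T, vdiv σ x) - ε * (t * M) * (r ^ N * k) := by
        have hi : Integrable (fun x => 1 + t * vdiv σ x) (volume.restrict T) :=
          (integrable_const _).add (hdivi.const_mul t)
        rw [integral_sub hi (integrable_const _),
          integral_add (integrable_const _) (hdivi.const_mul t), integral_const_mul,
          integral_const, integral_const, measureReal_restrict_apply_univ, hTr]
        simp only [smul_eq_mul]
        ring
      have hpow := pow_sub_pow_le_mul hr.le (le_add_of_nonneg_right ht0.le : r ≤ r + t) N
      rw [add_sub_cancel_left] at hpow
      have hpow' := mul_le_mul_of_nonneg_right hpow hk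
      have hfinal : t * (∫ x in T, vdiv σ x) ≤
          t * (N * (r + t) ^ (N - 1) * k + ε * M * (r ^ N * k)) := by
        linarith
      exact le_of_mul_le_mul_left hfinal ht0
    have hcont : Filter.Tendsto
        (fun t : ℝ => N * (r + t) ^ (N - 1) * k + ε * M * (r ^ N * k)) (𝓝[>] 0)
        (𝓝 (N * r ^ (N - 1) * k + ε * M * (r ^ N * k))) := by
      have : Continuous fun t : ℝ => N * (r + t) ^ (N - 1) * k + ε * M * (r ^ N * k) := by
        fun_prop
      simpa using (this.tendsto 0).mono_left nhdsWithin_le_nhds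
    exact ge_of_tendsto hcont hev
  refine le_of_forall_pos_le_add fun ε hε => ?_
  have hd : 0 < M * (r ^ N * k) + 1 := by positivity
  refine (key (ε / (M * (r ^ N * k) + 1)) (by positivity)).trans ?_
  gcongr
  rw [mul_assoc, div_mul_eq_mul_div, div_le_iff₀ hd]
  nlinarith

end Flow

section Lineality

variable {N : ℕ}

/-- If a segment joins a point outside `closure T` to an interior point of `T`, then some bump
function near the segment detects the boundary of `T` in the direction of the segment. -/
lemma exists_integral_fderiv_neg {W T : Set (EuclideanSpace ℝ (Fin N))} (hWo : IsOpen W)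
    (hWc : Convex ℝ W) (hTf : volume T < ⊤)
    {a v : EuclideanSpace ℝ (Fin N)} {h : ℝ} (hh : 0 < h) (haW : a ∈ W) (haW' : a + h • v ∈ W)
    (ha : a ∉ closure T) (ha' : a + h • v ∈ interior T) :
    ∃ φ : EuclideanSpace ℝ (Fin N) → ℝ, ContDiff ℝ 1 φ ∧ HasCompactSupport φ ∧ tsupport φ ⊆ W ∧
      (∀ x, φ x ∈ Icc (0 : ℝ) 1) ∧ ∫ x in T, fderiv ℝ φ x v < 0 := by
  have hfin : IsFiniteMeasure (volume.restrict T) := ⟨by simpa using hTf⟩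
  obtain ⟨η, hη, hη1⟩ := Metric.nhds_basis_closedBall.mem_iff.1
    (Filter.inter_mem (hWo.mem_nhds haW) (isClosed_closure.isOpen_compl.mem_nhds ha))
  obtain ⟨η', hη', hη2⟩ := Metric.nhds_basis_closedBall.mem_iff.1
    (Filter.inter_mem (hWo.mem_nhds haW') (isOpen_interior.mem_nhds ha'))
  set ρ := min η η' with hρ
  have hρ0 : 0 < ρ := lt_min hη hη'
  set f : ContDiffBump a := ⟨ρ / 2, ρ, by positivity, by linarith⟩ with hf
  have hfd : ContDiff ℝ 1 f := f.contDiff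
  obtain ⟨C, hC⟩ := (f.hasCompactSupport.fderiv ℝ).exists_bound_of_continuous
    (hfd.continuous_fderiv one_ne_zero)
  have hfsupp : tsupport f = closedBall a ρ := f.tsupport_eq
  set g : ℝ → ℝ := fun t => ∫ x in T, f (x - t • v) with hg
  have hcf : ∀ t : ℝ, Continuous fun x => f (x - t • v) := fun t =>
    hfd.continuous.comp (by fun_prop)
  have hcfd : ∀ t : ℝ, Continuous fun x => -(fderiv ℝ f (x - t • v) v) := fun t =>
    (((hfd.continuous_fderiv one_ne_zero).comp (by fun_prop :
      Continuous fun x : EuclideanSpace ℝ (Fin N) => x - t • v)).clm_apply continuous_const).neg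
  have hintg : ∀ t : ℝ, Integrable (fun x => f (x - t • v)) (volume.restrict T) := fun t =>
    Integrable.of_bound (hcf t).aestronglyMeasurable 1 (Filter.Eventually.of_forall fun x => by
      rw [Real.norm_of_nonneg f.nonneg]
      exact f.le_one)
  have hgd : ∀ t, HasDerivAt g (∫ x in T, -(fderiv ℝ f (x - t • v) v)) t := by
    intro t
    refine (hasDerivAt_integral_of_dominated_loc_of_deriv_le (s := univ)
      (bound := fun _ => C * ‖v‖) (F' := fun t x => -(fderiv ℝ f (x - t • v) v)) Filter.univ_mem
      (Filter.Eventually.of_forall fun t => (hcf t).aestronglyMeasurable) (hintg t)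
      (hcfd t).aestronglyMeasurable (Filter.Eventually.of_forall fun x s _ => ?_)
      (integrable_const _) (Filter.Eventually.of_forall fun x s _ => ?_)).2
    · rw [norm_neg]
      exact (ContinuousLinearMap.le_opNorm _ _).trans
        (mul_le_mul_of_nonneg_right (hC _) (norm_nonneg _))
    · have h1 : HasDerivAt (fun s : ℝ => x - s • v) (-v) s := by
        have := ((hasDerivAt_id s).smul_const v).const_sub x
        simpa using this
      have h2 := ((hfd.differentiable one_ne_zero (x - s • v)).hasFDerivAt).comp_hasDerivAt s h1
      exact (by simpa using h2 : HasDerivAt (f ∘ fun s : ℝ => x - s • v) _ s)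
  have hg0 : g 0 = 0 := by
    refine setIntegral_eq_zero_of_forall_eq_zero fun x hx => ?_
    rw [zero_smul, sub_zero]
    refine image_eq_zero_of_notMem_tsupport fun hx' => ?_
    rw [hfsupp] at hx'
    exact (hη1 (closedBall_subset_closedBall (min_le_left _ _) hx')).2 (subset_closure hx)
  have hgh : 0 < g h := by
    refine (setIntegral_pos_iff_support_of_nonneg_ae
      (Filter.Eventually.of_forall fun x => f.nonneg) (hintg h)).2 ?_
    refine lt_of_lt_of_le ((isOpen_ball (x := a + h • v) (ε := ρ)).measure_pos volume
      ⟨_, mem_ball_self hρ0⟩) (measure_mono fun x hx => ⟨?_, ?_⟩)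
    · rw [Function.mem_support]
      refine (f.pos_of_mem_ball ?_).ne'
      rw [mem_ball, dist_eq_norm] at hx ⊢
      convert hx using 2
      abel
    · exact interior_subset (hη2 (closedBall_subset_closedBall (min_le_right _ _)
        (ball_subset_closedBall hx))).2
  obtain ⟨t, ht, htd⟩ := exists_hasDerivAt_eq_slope g _ hh
    (fun x _ => (hgd x).continuousAt.continuousWithinAt) (fun x _ => hgd x)
  have htr : ∀ x, HasFDerivAt (fun y => f (y - t • v)) (fderiv ℝ f (x - t • v)) x := fun x => by
    have := ((hfd.differentiable one_ne_zero (x - t • v)).hasFDerivAt).comp x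
      ((hasFDerivAt_id x).sub_const (t • v))
    exact this
  refine ⟨fun x => f (x - t • v), hfd.comp (by fun_prop), ?_, ?_, fun x => ⟨f.nonneg, f.le_one⟩,
    ?_⟩
  · exact f.hasCompactSupport.comp_homeomorph (Homeomorph.subRight (t • v))
  · have h1 : tsupport (fun x => f (x - t • v)) ⊆ closedBall (a + t • v) ρ := by
      refine closure_minimal (fun x hx => ?_) isClosed_closedBall
      have h2 : x - t • v ∈ tsupport f := subset_tsupport _ hx
      rw [hfsupp, mem_closedBall, dist_eq_norm] at h2
      rw [mem_closedBall, dist_eq_norm]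
      convert h2 using 2
      abel
    refine h1.trans fun x hx => ?_
    rw [mem_closedBall, dist_eq_norm] at hx
    set e := x - (a + t • v) with he
    have hb : ∀ b, ‖e‖ ≤ ρ → b + e ∈ closedBall b ρ := fun b he => by
      rwa [mem_closedBall, dist_eq_norm, add_sub_cancel_left]
    have e0 : a + e ∈ W := (hη1 (closedBall_subset_closedBall (min_le_left _ _) (hb _ hx))).1
    have e1 : a + h • v + e ∈ W :=
      (hη2 (closedBall_subset_closedBall (min_le_right _ _) (hb _ hx))).1
    have ht1 : t / h ≤ 1 := (div_le_one hh).2 ht.2.le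
    have := hWc e0 e1 (sub_nonneg.2 ht1) (div_nonneg ht.1.le hh.le) (by ring)
    convert this using 1
    have hx' : x = a + t • v + e := by rw [he]; abel
    rw [hx']
    have : t • v = (t / h) • (h • v) := by rw [smul_smul, div_mul_cancel₀ _ hh.ne']
    rw [this]
    module
  · have h3 : ∫ x in T, fderiv ℝ (fun y => f (y - t • v)) x v =
        -∫ x in T, -(fderiv ℝ f (x - t • v) v) := by
      rw [← integral_neg]
      refine integral_congr_ae (Filter.Eventually.of_forall fun x => ?_)
      simp [(htr x).fderiv]
    rw [h3, htd, hg0, sub_zero, sub_zero, neg_lt_zero]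
    positivity

end Lineality

section Lineality

variable {N : ℕ}

lemma isCompact_seminorm_sub_le (p : Seminorm ℝ (EuclideanSpace ℝ (Fin N))) (hpc : Continuous p)
    {c : ℝ} (hc : 0 < c) (hcp : ∀ x, c * ‖x‖ ≤ p x) (x₀ : EuclideanSpace ℝ (Fin N)) (r : ℝ) :
    IsCompact {x | p (x - x₀) ≤ r} := by
  refine Metric.isCompact_of_isClosed_isBounded
    (isClosed_le (by fun_prop) continuous_const) ?_
  refine (Metric.isBounded_closedBall (x := x₀) (r := r / c)).subset fun x hx => ?_
  rw [mem_closedBall, dist_eq_norm, le_div_iff₀ hc, mul_comm]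
  exact (hcp _).trans hx

lemma exists_seminorm_cutoff (p : Seminorm ℝ (EuclideanSpace ℝ (Fin N))) (hpc : Continuous p)
    {c : ℝ} (hc : 0 < c) (hcp : ∀ x, c * ‖x‖ ≤ p x) (x₀ : EuclideanSpace ℝ (Fin N)) {r R : ℝ}
    (hrR : r < R) :
    ∃ χ : EuclideanSpace ℝ (Fin N) → ℝ, ContDiff ℝ 1 χ ∧ HasCompactSupport χ ∧
      (∀ x, χ x ∈ Icc (0 : ℝ) 1) ∧ (∀ x, p (x - x₀) ≤ r → χ x = 1) ∧
      ∀ x, R ≤ p (x - x₀) → χ x = 0 := by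
  obtain ⟨f, hf0, hf1, hf⟩ := exists_contMDiffMap_zero_one_of_isClosed (n := 1)
    (modelWithCornersSelf ℝ (EuclideanSpace ℝ (Fin N)))
    (s := {x | R ≤ p (x - x₀)}) (t := {x | p (x - x₀) ≤ r})
    (isClosed_le continuous_const (by fun_prop)) (isClosed_le (by fun_prop) continuous_const)
    (Set.disjoint_left.2 fun x (h1 : R ≤ _) (h2 : _ ≤ r) => by linarith)
  refine ⟨f, f.contMDiff.contDiff, ?_, hf, fun x hx => hf1 hx, fun x hx => hf0 hx⟩
  refine HasCompactSupport.intro (isCompact_seminorm_sub_le p hpc hc hcp x₀ R) fun x hx => ?_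
  exact hf0 (show R ≤ p (x - x₀) from (not_le.1 hx).le)

lemma vdiv_congr_of_eventuallyEq
    {σ τ : EuclideanSpace ℝ (Fin N) → EuclideanSpace ℝ (Fin N)} {x : EuclideanSpace ℝ (Fin N)}
    (h : σ =ᶠ[𝓝 x] τ) : vdiv σ x = vdiv τ x := by
  simp only [vdiv, h.fderiv_eq]

lemma vdiv_smul_sub (s : ℝ) (x₀ x : EuclideanSpace ℝ (Fin N)) :
    vdiv (fun y => s • (y - x₀)) x = N * s := by
  have h : HasFDerivAt (fun y : EuclideanSpace ℝ (Fin N) => s • (y - x₀))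
      (s • ContinuousLinearMap.id ℝ _) x := ((hasFDerivAt_id x).sub_const x₀).const_smul s
  simp [vdiv, h.fderiv]

/-- A truncated Wulff ball with centre in the closure of the cone and smallest possible relative
perimeter is centred on the lineality space. -/
lemma mem_lineality_of_periW_le {S : Set (EuclideanSpace ℝ (Fin N))} (hS : IsOpenConvexCone S)
    (hSne : S.Nonempty) (p : Seminorm ℝ (EuclideanSpace ℝ (Fin N))) (hpc : Continuous p)
    {c : ℝ} (hc : 0 < c) (hcp : ∀ x, c * ‖x‖ ≤ p x) {E : Set (EuclideanSpace ℝ (Fin N))}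
    (hE : MeasurableSet E) (hEf : volume (S ∩ E) < ⊤) {x₀ : EuclideanSpace ℝ (Fin N)} {r : ℝ}
    (hr : 0 < r)
    (hT : volume.restrict (S ∩ E) = volume.restrict {x | x - x₀ ∈ S ∩ {y | p y < r}})
    (hper : periW p (fun _ => 1) E S ≤ ENNReal.ofReal (N * volume.real (S ∩ E) / r)) :
    x₀ ∈ lineality S := by
  set T := {x : EuclideanSpace ℝ (Fin N) | x - x₀ ∈ S ∩ {y | p y < r}} with hTdef
  have hTo : IsOpen T := (hS.1.inter (isOpen_lt hpc continuous_const)).preimage (by fun_prop)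
  have hTm := hTo.measurableSet
  have hm : MeasurableSet (S ∩ E) := hS.1.measurableSet.inter hE
  have hTvol : volume T = volume (S ∩ E) := by
    have := congrArg (fun μ => μ univ) hT
    simpa using this.symm
  have hTf : volume T < ⊤ := hTvol ▸ hEf
  have hfin : IsFiniteMeasure (volume.restrict T) := ⟨by simpa using hTf⟩
  obtain ⟨y₀, hy₀⟩ := hSne
  have hx₀ : x₀ ∈ closure S := by
    by_contra hx
    have hnull : volume (T ∩ (closure S)ᶜ) = 0 := by
      have h1 := congrArg (fun μ => μ (closure S)ᶜ) hT
      simp only [Measure.restrict_apply isClosed_closure.measurableSet.compl] at h1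
      rw [inter_comm, ← h1]
      convert measure_empty (μ := volume)
      ext z
      simp only [mem_inter_iff, mem_compl_iff, mem_empty_iff_false, iff_false]
      exact fun h => h.1 (subset_closure h.2.1)
    have hopen : IsOpen (T ∩ (closure S)ᶜ) := hTo.inter isClosed_closure.isOpen_compl
    have htend : Filter.Tendsto (fun t : ℝ => x₀ + t • y₀) (𝓝[>] 0) (𝓝 x₀) := by
      have : Continuous fun t : ℝ => x₀ + t • y₀ := by fun_prop
      simpa using (this.tendsto 0).mono_left nhdsWithin_le_nhds
    have htend2 : Filter.Tendsto (fun t : ℝ => p (t • y₀)) (𝓝[>] 0) (𝓝 0) := by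
      have : Continuous fun t : ℝ => p (t • y₀) := by fun_prop
      simpa using (this.tendsto 0).mono_left nhdsWithin_le_nhds
    have hev := (htend.eventually (isClosed_closure.isOpen_compl.mem_nhds hx)).and
      ((htend2.eventually (gt_mem_nhds hr)).and self_mem_nhdsWithin)
    obtain ⟨t, ht1, ht2, ht3⟩ := hev.exists
    refine (hopen.measure_pos volume ⟨x₀ + t • y₀, ⟨?_, ht1⟩⟩).ne' hnull
    show x₀ + t • y₀ - x₀ ∈ S ∩ {y | p y < r}
    rw [add_sub_cancel_left]
    exact ⟨hS.2.2 _ hy₀ t ht3, ht2⟩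
  refine hS.mem_lineality_of_mem_closure hx₀ ?_
  by_contra hneg
  obtain ⟨y, hy, hyx⟩ : ∃ y ∈ S, y - x₀ ∉ closure S := by
    by_contra! hall
    refine hneg ?_
    have htend : Filter.Tendsto (fun t : ℝ => t • y₀ - x₀) (𝓝[>] 0) (𝓝 (-x₀)) := by
      have : Continuous fun t : ℝ => t • y₀ - x₀ := by fun_prop
      simpa using (this.tendsto 0).mono_left nhdsWithin_le_nhds
    refine isClosed_closure.mem_of_tendsto htend ?_
    filter_upwards [self_mem_nhdsWithin] with t ht
    exact hall _ (hS.2.2 _ hy₀ t ht)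
  obtain ⟨μ, hμ1, hμ2, hμ3, hμ⟩ : ∃ μ : ℝ, μ < 1 ∧ p (μ • y) < r / 2 ∧
      p (μ • (y - x₀)) < r / 2 ∧ 0 < μ := by
    have h1 : ∀ z, ∀ᶠ t : ℝ in 𝓝[>] 0, p (t • z) < r / 2 := fun z => by
      have : Continuous fun t : ℝ => p (t • z) := by fun_prop
      have h2 : Filter.Tendsto (fun t : ℝ => p (t • z)) (𝓝[>] 0) (𝓝 0) := by
        simpa using (this.tendsto 0).mono_left nhdsWithin_le_nhds
      exact h2.eventually (gt_mem_nhds (by positivity))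
    have h3 : ∀ᶠ t : ℝ in 𝓝[>] 0, t < 1 :=
      nhdsWithin_le_nhds (gt_mem_nhds one_pos)
    exact (h3.and ((h1 y).and ((h1 (y - x₀)).and self_mem_nhdsWithin))).exists
  have hμy : μ • y ∈ S := hS.2.2 _ hy μ hμ
  have e1 : x₀ + μ • (y - x₀) + μ • x₀ = x₀ + μ • y := by module
  obtain ⟨φ, hφ, hφc, hφW, hφI, hφT⟩ := exists_integral_fderiv_neg
    (W := S ∩ {x | p (x - x₀) < r / 2}) (T := T) (a := x₀ + μ • (y - x₀)) (v := x₀) (h := μ)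
    (hS.1.inter (isOpen_lt (by fun_prop) continuous_const))
    (hS.2.1.inter (by
      have : {x | p (x - x₀) < r / 2} = p.ball x₀ (r / 2) := by
        ext x
        simp [Seminorm.mem_ball]
      rw [this]
      exact p.convex_ball _ _)) hTf hμ
    ⟨by
      have : x₀ + μ • (y - x₀) = μ • y + (1 - μ) • x₀ := by module
      rw [this]
      exact hS.add_closure_mem hμy (hS.smul_closure_mem hx₀ (by linarith)),
      by
        show p (x₀ + μ • (y - x₀) - x₀) < r / 2
        rwa [add_sub_cancel_left]⟩
    (by
      rw [e1]
      refine ⟨by rw [add_comm]; exact hS.add_closure_mem hμy hx₀, ?_⟩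
      show p (x₀ + μ • y - x₀) < r / 2
      rwa [add_sub_cancel_left])
    (fun hcl => by
      have h1 : closure T ⊆ {x | x - x₀ ∈ closure S} :=
        closure_minimal (fun x hx => subset_closure hx.1)
          (isClosed_closure.preimage (f := fun x => x - x₀) (by fun_prop))
      have h2 : x₀ + μ • (y - x₀) - x₀ ∈ closure S := h1 hcl
      rw [add_sub_cancel_left] at h2
      have h3 := hS.smul_closure_mem h2 (inv_pos.2 hμ)
      rw [smul_smul, inv_mul_cancel₀ hμ.ne', one_smul] at h3
      exact hyx h3)
    (by
      rw [e1, hTo.interior_eq]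
      show x₀ + μ • y - x₀ ∈ S ∩ {y | p y < r}
      rw [add_sub_cancel_left]
      exact ⟨hμy, show p (μ • y) < r by linarith⟩)
  set κ : ℝ := 1 / (2 * (p x₀ + 1)) with hκ
  have hp0 : 0 ≤ p x₀ := apply_nonneg p x₀
  have hκ0 : 0 < κ := by positivity
  have hκp : κ * p x₀ ≤ 1 / 2 := by
    rw [hκ, div_mul_eq_mul_div, div_le_div_iff₀ (by positivity) two_pos]
    linarith
  set G : ℝ := -(κ * ∫ x in T, fderiv ℝ φ x x₀) with hG
  have hG0 : 0 < G := neg_pos.2 (mul_neg_of_pos_of_neg hκ0 hφT)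
  set V : ℝ := volume.real (S ∩ E) with hV
  have hVT : volume.real T = V := by rw [hV, Measure.real, Measure.real, hTvol]
  have hV0 : 0 ≤ V := measureReal_nonneg
  have main : ∀ ε : ℝ, 0 < ε → N * V / (r * (1 + ε)) + G ≤ N * V / r := by
    intro ε hε
    obtain ⟨χ, hχ, hχc, hχI, hχ1, hχ0⟩ := exists_seminorm_cutoff p hpc hc hcp x₀
      (r := r) (R := r * (1 + ε)) (by nlinarith)
    set s : ℝ := 1 / (r * (1 + ε)) with hs
    have hs0 : 0 < s := by positivity
    have hsr : s * (r * (1 + ε)) = 1 := by rw [hs]; field_simp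
    have hsr' : s * r ≤ 1 := by
      rw [← hsr]
      gcongr
      nlinarith
    have hσ : ContDiff ℝ 1 fun x : EuclideanSpace ℝ (Fin N) => χ x • (s • (x - x₀)) :=
      hχ.smul (by fun_prop)
    have hσc : HasCompactSupport fun x : EuclideanSpace ℝ (Fin N) => χ x • (s • (x - x₀)) :=
      hχc.smul_right
    have hζ : ContDiff ℝ 1 fun x : EuclideanSpace ℝ (Fin N) => φ x • (-(κ • x₀)) :=
      hφ.smul contDiff_const
    have hζv : ∀ x, vdiv (fun x => φ x • (-(κ • x₀))) x = -(κ * fderiv ℝ φ x x₀) := fun x => by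
      rw [vdiv_smul (hφ.differentiable one_ne_zero x) (differentiableAt_const _), vdiv_const]
      simp
    have hσv : ∀ x ∈ T, vdiv (fun x => χ x • (s • (x - x₀))) x = N * s := fun x hx => by
      rw [← vdiv_smul_sub s x₀ x]
      refine vdiv_congr_of_eventuallyEq ?_
      filter_upwards [hTo.mem_nhds hx] with z hz
      rw [hχ1 z (le_of_lt hz.2), one_smul]
    have hsub : tsupport (fun x => φ x • (-(κ • x₀))) ⊆ tsupport φ :=
      closure_mono fun x hx h => hx (by simp [h])
    have hle := ofReal_setIntegral_vdiv_le_periW hS ⟨y₀, hy₀⟩ hE hEf p hσ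
      (hσc.exists_bound_of_continuous hσ.continuous)
      ((hσc.fderiv ℝ).exists_bound_of_continuous (hσ.continuous_fderiv one_ne_zero))
      (by
        rw [hT]
        refine ae_restrict_of_forall_mem hTm fun x hx => ?_
        rw [hχ1 x (le_of_lt hx.2), one_smul]
        exact hS.smul_closure_mem (subset_closure hx.1) hs0) hζ hφc.smul_right
      (hsub.trans (hφW.trans inter_subset_left))
      (fun x t ht => by
        have hσle : p (t • χ x • s • (x - x₀)) ≤ s * p (x - x₀) := by
          simp only [map_smul_eq_mul, Real.norm_eq_abs, abs_of_nonneg ht.1,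
            abs_of_nonneg (hχI x).1, abs_of_pos hs0]
          have h1 : 0 ≤ s * p (x - x₀) := mul_nonneg hs0.le (apply_nonneg p _)
          exact (mul_le_of_le_one_left (mul_nonneg (hχI x).1 h1) ht.2).trans
            (mul_le_of_le_one_left h1 (hχI x).2)
        by_cases hx : x ∈ tsupport φ
        · have h1 : p (x - x₀) < r / 2 := (hφW hx).2
          have h2 : p (φ x • -(κ • x₀)) ≤ 1 / 2 := by
            rw [map_smul_eq_mul, map_neg_eq_map, map_smul_eq_mul, Real.norm_of_nonneg (hφI x).1,
              Real.norm_of_nonneg hκ0.le]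
            exact (mul_le_of_le_one_left (by positivity) (hφI x).2).trans hκp
          refine (map_add_le_add p _ _).trans ?_
          have : s * p (x - x₀) ≤ s * (r / 2) := by gcongr
          linarith
        · rw [image_eq_zero_of_notMem_tsupport hx, zero_smul, add_zero]
          by_cases hx' : p (x - x₀) ≤ r * (1 + ε)
          · refine hσle.trans ?_
            rw [← hsr]
            gcongr
          · rw [hχ0 x (not_le.1 hx').le, zero_smul, smul_zero, map_zero]
            exact zero_le_one)
    have hcont : Continuous fun x => fderiv ℝ φ x x₀ :=
      (hφ.continuous_fderiv one_ne_zero).clm_apply continuous_const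
    have hintg : Integrable (fun x => -(κ * fderiv ℝ φ x x₀)) (volume.restrict T) := by
      refine (((hcont.integrable_of_hasCompactSupport ?_).const_mul κ).neg).integrableOn
      exact (hφc.fderiv ℝ).mono fun x hx h => hx (by
        have h : fderiv ℝ φ x = 0 := h
        simp [h])
    have hval : ∫ x in S ∩ E, (vdiv (fun x => χ x • (s • (x - x₀))) x +
        vdiv (fun x => φ x • (-(κ • x₀))) x) = N * V / (r * (1 + ε)) + G := by
      rw [hT, setIntegral_congr_fun (g := fun x => N * s + -(κ * fderiv ℝ φ x x₀)) hTm
        (fun x hx => by simp only [hσv x hx, hζv]), integral_add (integrable_const _) hintg,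
        integral_neg, integral_const_mul κ, integral_const, measureReal_restrict_apply_univ, hVT,
        smul_eq_mul, hG, hs]
      ring
    rw [hval] at hle
    exact (ENNReal.ofReal_le_ofReal_iff (by positivity)).1 (hle.trans hper)
  have hlim : Filter.Tendsto (fun ε : ℝ => N * V / (r * (1 + ε)) + G) (𝓝[>] 0)
      (𝓝 (N * V / r + G)) := by
    have h1 : ContinuousAt (fun ε : ℝ => N * V / (r * (1 + ε)) + G) 0 := by
      refine ContinuousAt.add (ContinuousAt.div continuousAt_const (by fun_prop) ?_)
        continuousAt_const
      simpa using hr.ne'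
    have h2 := h1.tendsto.mono_left (nhdsWithin_le_nhds (s := Ioi 0))
    simpa using h2
  have := le_of_tendsto hlim (by
    filter_upwards [self_mem_nhdsWithin] with ε hε using main ε hε)
  linarith

end Lineality

section Perimeter

variable {N : ℕ} {S : Set (EuclideanSpace ℝ (Fin N))}

lemma volume_sub_mem_seminorm_lt (hS : IsOpenConvexCone S)
    (p : Seminorm ℝ (EuclideanSpace ℝ (Fin N))) (hKf : volume (S ∩ {y | p y < 1}) < ⊤)
    (x₀ : EuclideanSpace ℝ (Fin N)) {s : ℝ} (hs : 0 < s) :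
    volume {x | x - x₀ ∈ S ∩ {y | p y < s}} =
      ENNReal.ofReal (s ^ N * volume.real (S ∩ {y | p y < 1})) := by
  have h1 : {x | x - x₀ ∈ S ∩ {y | p y < s}} =
      (fun x => x + -x₀) ⁻¹' (s • (S ∩ {y | p y < 1})) := by
    ext x
    simp only [mem_preimage, mem_smul_set_iff_inv_smul_mem₀ hs.ne', Set.mem_ofPred_eq,
      ← sub_eq_add_neg, mem_inter_iff, map_smul_eq_mul, Real.norm_of_nonneg (inv_pos.2 hs).le,
      inv_mul_lt_iff₀ hs, mul_one]
    refine and_congr_left fun _ => ⟨fun h => hS.2.2 _ h _ (inv_pos.2 hs), fun h => ?_⟩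
    have := hS.2.2 _ h s hs
    rwa [smul_smul, mul_inv_cancel₀ hs.ne', one_smul] at this
  rw [h1, measure_preimage_add_right, Measure.addHaar_smul_of_nonneg _ hs.le,
    ENNReal.ofReal_mul (by positivity), Measure.real, ENNReal.ofReal_toReal hKf.ne]
  simp

lemma inter_seminorm_sub_lt_eq {x₀ : EuclideanSpace ℝ (Fin N)} (hx₀ : x₀ ∈ lineality S)
    (p : Seminorm ℝ (EuclideanSpace ℝ (Fin N))) (s : ℝ) :
    S ∩ {x | p (x - x₀) < s} = {x | x - x₀ ∈ S ∩ {y | p y < s}} := by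
  ext x
  exact and_congr_left fun _ => (sub_mem_iff_of_mem_lineality hx₀).symm

lemma setIntegral_vdiv_inter_eq {σ : EuclideanSpace ℝ (Fin N) → EuclideanSpace ℝ (Fin N)}
    {E : Set (EuclideanSpace ℝ (Fin N))} (hE : MeasurableSet E) (hσS : tsupport σ ⊆ S) :
    ∫ x in E, vdiv σ x = ∫ x in S ∩ E, vdiv σ x := by
  refine setIntegral_eq_of_subset_of_forall_sdiff_eq_zero hE inter_subset_right fun x hx => ?_
  have : fderiv ℝ σ x = 0 := fderiv_of_notMem_tsupport ℝ fun h => hx.2 ⟨hσS h, hx.1⟩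
  simp [vdiv, this]

lemma periW_le_of_restrict_eq (hS : IsOpenConvexCone S)
    (p : Seminorm ℝ (EuclideanSpace ℝ (Fin N))) (hpc : Continuous p)
    (hKf : volume (S ∩ {y | p y < 1}) < ⊤) {E : Set (EuclideanSpace ℝ (Fin N))}
    (hE : MeasurableSet E) {x₀ : EuclideanSpace ℝ (Fin N)} (hx₀ : x₀ ∈ lineality S) {r : ℝ}
    (hr : 0 < r)
    (hEr : volume.restrict (S ∩ E) = volume.restrict (S ∩ {x | p (x - x₀) < r})) :
    periW p (fun _ => 1) E S ≤
      ENNReal.ofReal (N * r ^ (N - 1) * volume.real (S ∩ {y | p y < 1})) := by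
  refine iSup₂_le fun σ hσ => ENNReal.ofReal_le_ofReal ?_
  obtain ⟨hσ, hσc, hσS, hσp⟩ := hσ
  rw [setIntegral_vdiv_inter_eq hE hσS, hEr]
  refine setIntegral_vdiv_le_of_tsupport_subset hS.1 p hpc hr measureReal_nonneg
    (fun s hs => ?_) hσ hσc hσS hσp
  rw [inter_seminorm_sub_lt_eq hx₀, volume_sub_mem_seminorm_lt hS p hKf x₀ hs]

lemma AdmissibleField.ofReal_setIntegral_vdiv_le_periW (hS : IsOpenConvexCone S)
    (hSne : S.Nonempty) (p : Seminorm ℝ (EuclideanSpace ℝ (Fin N)))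
    (hKb : Bornology.IsBounded (S ∩ {y | p y < 1})) {E : Set (EuclideanSpace ℝ (Fin N))}
    (hE : MeasurableSet E) (hEf : volume (S ∩ E) < ⊤)
    {σ : EuclideanSpace ℝ (Fin N) → EuclideanSpace ℝ (Fin N)}
    (hσ : AdmissibleField (S ∩ {y | p y < 1}) σ) :
    ENNReal.ofReal (∫ x in S ∩ E, vdiv σ x) ≤ periW p (fun _ => 1) E S := by
  obtain ⟨R, hR⟩ := hKb.exists_norm_le
  have h := _root_.ofReal_setIntegral_vdiv_le_periW (ζ := fun _ => 0) hS hSne hE hEf p hσ.contDiff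
    ⟨R, fun x => hR _ (hσ.mem x)⟩ hσ.bounded
    (Filter.Eventually.of_forall fun x => subset_closure (hσ.mem x).1) contDiff_const
    HasCompactSupport.zero (by
      have : tsupport (fun _ : EuclideanSpace ℝ (Fin N) => (0 : EuclideanSpace ℝ (Fin N))) = ∅ :=
        tsupport_eq_empty_iff.2 rfl
      rw [this]
      exact empty_subset _)
    (fun x c hc => by
      rw [add_zero, map_smul_eq_mul, Real.norm_of_nonneg hc.1]
      exact (mul_le_of_le_one_left (apply_nonneg p _) hc.2).trans (le_of_lt (hσ.mem x).2))
  simpa only [vdiv_const, add_zero] using h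

/-- The anisotropic isoperimetric inequality in a convex cone. -/
lemma ofReal_le_periW (hN : N ≠ 0) (hS : IsOpenConvexCone S) (hSne : S.Nonempty)
    (p : Seminorm ℝ (EuclideanSpace ℝ (Fin N))) (hpc : Continuous p)
    (hKb : Bornology.IsBounded (S ∩ {y | p y < 1})) {k : ℝ} (hk : 0 < k)
    (hKk : volume (S ∩ {y | p y < 1}) = ENNReal.ofReal (k ^ N))
    {E : Set (EuclideanSpace ℝ (Fin N))} (hE : MeasurableSet E) {a : ℝ} (ha : 0 < a)
    (hEa : volume (S ∩ E) = ENNReal.ofReal (a ^ N)) :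
    ENNReal.ofReal (N * k * a ^ (N - 1)) ≤ periW p (fun _ => 1) E S := by
  by_cases htop : periW p (fun _ => 1) E S = ⊤
  · rw [htop]
    exact le_top
  rw [ENNReal.ofReal_le_iff_le_toReal htop]
  refine le_of_forall_pos_le_add fun ε hε => ?_
  have hc : Convex ℝ (S ∩ {y | p y < 1}) := hS.2.1.inter (by
    rw [← p.ball_zero_eq]
    exact p.convex_ball _ _)
  obtain ⟨σ, hσ, hle⟩ := exists_admissibleField_le_integral_vdiv hN
    (hS.1.inter (isOpen_lt hpc continuous_const)) hKb hc hk hKk (hS.1.measurableSet.inter hE) ha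
    hEa hε
  have := (ENNReal.ofReal_le_iff_le_toReal htop).1
    (hσ.ofReal_setIntegral_vdiv_le_periW hS hSne p hKb hE (hEa ▸ ENNReal.ofReal_lt_top))
  linarith

/-- Sets attaining equality in the isoperimetric inequality are truncated Wulff balls. -/
lemma exists_restrict_eq_of_periW_le (hN : N ≠ 0) (hS : IsOpenConvexCone S) (hSne : S.Nonempty)
    (p : Seminorm ℝ (EuclideanSpace ℝ (Fin N))) (hpc : Continuous p)
    {c : ℝ} (hc : 0 < c) (hcp : ∀ x, c * ‖x‖ ≤ p x)
    {E : Set (EuclideanSpace ℝ (Fin N))} (hE : MeasurableSet E) {r : ℝ} (hr : 0 < r)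
    (hEr : volume (S ∩ E) = ENNReal.ofReal (r ^ N * volume.real (S ∩ {y | p y < 1})))
    (hper : periW p (fun _ => 1) E S ≤ ENNReal.ofReal (N * volume.real (S ∩ E) / r)) :
    ∃ x₀ ∈ lineality S,
      volume.restrict (S ∩ E) = volume.restrict (S ∩ {x | p (x - x₀) < r}) := by
  have hb : ∀ s, Bornology.IsBounded (S ∩ {y | p y < s}) := fun s => by
    have h := (isCompact_seminorm_sub_le p hpc hc hcp 0 s).isBounded
    refine h.subset fun x hx => ?_
    show p (x - 0) ≤ s
    rw [sub_zero]
    exact le_of_lt hx.2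
  have hEf : volume (S ∩ E) < ⊤ := hEr ▸ ENNReal.ofReal_lt_top
  have hconv : Convex ℝ (S ∩ {y | p y < r}) := hS.2.1.inter (by
    rw [← p.ball_zero_eq]
    exact p.convex_ball _ _)
  have hKo : IsOpen (S ∩ {y | p y < r}) := hS.1.inter (isOpen_lt hpc continuous_const)
  have hne : (S ∩ {y | p y < r}).Nonempty := by
    obtain ⟨y, hy⟩ := hSne
    have hy0 : 0 ≤ p y := apply_nonneg p y
    have ht : 0 < r / (p y + 1) := by positivity
    refine ⟨(r / (p y + 1)) • y, hS.2.2 _ hy _ ht, ?_⟩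
    show p _ < r
    rw [map_smul_eq_mul, Real.norm_of_nonneg ht.le, div_mul_eq_mul_div,
      div_lt_iff₀ (by positivity)]
    nlinarith
  have hvol := volume_sub_mem_seminorm_lt hS p (hb 1).measure_lt_top 0 hr
  simp only [sub_zero, Set.ofPred_mem_eq] at hvol
  have hEK : volume.real (S ∩ E) = volume.real (S ∩ {y | p y < r}) := by
    rw [Measure.real, Measure.real, hEr, hvol]
  obtain ⟨x₀, hx₀⟩ := exists_restrict_eq_translate hN hKo (hb r) hconv hne
    (hS.1.measurableSet.inter hE) hEK hEf fun σ hσ => by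
      have hσ' : AdmissibleField (S ∩ {y | p y < 1}) fun x => r⁻¹ • σ x := by
        refine ⟨hσ.contDiff.const_smul _, fun x => ⟨hS.2.2 _ (hσ.mem x).1 _ (inv_pos.2 hr), ?_⟩, ?_⟩
        · show p _ < 1
          rw [map_smul_eq_mul, Real.norm_of_nonneg (inv_pos.2 hr).le, inv_mul_lt_iff₀ hr, mul_one]
          exact (hσ.mem x).2
        · obtain ⟨C, hC⟩ := hσ.bounded
          refine ⟨r⁻¹ * C, fun x => ?_⟩
          rw [fderiv_fun_const_smul (hσ.contDiff.differentiable one_ne_zero x), norm_smul,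
            Real.norm_of_nonneg (inv_pos.2 hr).le]
          gcongr
          exact hC x
      have h := (hσ'.ofReal_setIntegral_vdiv_le_periW hS hSne p (hb 1) hE hEf).trans hper
      have hnn : 0 ≤ N * volume.real (S ∩ E) / r :=
        div_nonneg (mul_nonneg N.cast_nonneg measureReal_nonneg) hr.le
      rw [ENNReal.ofReal_le_ofReal_iff hnn, integral_congr_ae (Filter.Eventually.of_forall fun x =>
        vdiv_const_smul r⁻¹ (hσ.contDiff.differentiable one_ne_zero x)), integral_const_mul,
        div_eq_inv_mul, hEK] at h
      exact le_of_mul_le_mul_left h (inv_pos.2 hr)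
  have hlin := mem_lineality_of_periW_le hS hSne p hpc hc hcp hE hEf hr hx₀ hper
  exact ⟨x₀, hlin, by rw [hx₀, inter_seminorm_sub_lt_eq hlin]⟩

lemma measure_sdiff_union_sdiff_eq_zero_iff {α : Type*} [MeasurableSpace α] {μ : Measure α}
    {A B : Set α} (hA : MeasurableSet A) (hB : MeasurableSet B) :
    μ ((A \ B) ∪ (B \ A)) = 0 ↔ μ.restrict A = μ.restrict B := by
  refine ⟨fun h => Measure.restrict_congr_set (measure_symmDiff_eq_zero_iff.1 h), fun h => ?_⟩
  refine measure_union_null ?_ ?_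
  · have := congrArg (fun ν => ν Bᶜ) h
    simp only [Measure.restrict_apply hB.compl, compl_inter_self, measure_empty] at this
    rwa [inter_comm, ← sdiff_eq] at this
  · have := congrArg (fun ν => ν Aᶜ) h
    simp only [Measure.restrict_apply hA.compl, compl_inter_self, measure_empty] at this
    rw [inter_comm, ← sdiff_eq] at this
    exact this.symm

lemma ofReal_pow_rpow_sub_one_div (hN : N ≠ 0) {a : ℝ} (ha : 0 < a) :
    ENNReal.ofReal (a ^ N) ^ (((N : ℝ) - 1) / N) = ENNReal.ofReal (a ^ (N - 1)) := by
  have hN' : (N : ℝ) ≠ 0 := Nat.cast_ne_zero.2 hN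
  rw [ENNReal.ofReal_rpow_of_pos (by positivity), ← Real.rpow_natCast, ← Real.rpow_mul ha.le,
    mul_div_cancel₀ _ hN', ← Real.rpow_natCast, Nat.cast_sub (Nat.one_le_iff_ne_zero.2 hN),
    Nat.cast_one]

end Perimeter

end

/-- characterization of the equality case in the anisotropic
isoperimetric inequality in convex cones (Theorem 4.3 of the paper).
The condition "`x₀ ∈ ℝ^k × {0}` after a rotation with `Σ = ℝ^k × Σ̃`, `Σ̃` containing
no lines" is expressed invariantly as `x₀ ∈ lineality S`. -/
theorem anisotropic_isoperimetric_equality_characterization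
    {N : ℕ} (hN : 2 ≤ N)
    (H : EuclideanSpace ℝ (Fin N) → ℝ)
    (hH : IsAnisoNorm H) (hHell : UniformlyElliptic H)
    (S : Set (EuclideanSpace ℝ (Fin N))) (hS : IsOpenConvexCone S)
    (E : Set (EuclideanSpace ℝ (Fin N))) (hE : MeasurableSet E)
    (hEpos : 0 < volume (S ∩ E)) (hEfin : volume (S ∩ E) < ⊤)
    (hPfin : periW (dualNorm H) (fun _ => (1:ℝ)) E S < ⊤) :
    (periW (dualNorm H) (fun _ => (1:ℝ)) E S *
        volume (S ∩ {y | dualNorm H y < 1}) ^ (((N : ℝ) - 1) / N) =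
      periW (dualNorm H) (fun _ => (1:ℝ)) {y | dualNorm H y < 1} S *
        volume (S ∩ E) ^ (((N : ℝ) - 1) / N)) ↔
    ∃ r : ℝ, 0 < r ∧ ∃ x₀ ∈ lineality S,
      volume (((S ∩ E) \ (S ∩ {x | dualNorm H (x - x₀) < r})) ∪
        ((S ∩ {x | dualNorm H (x - x₀) < r}) \ (S ∩ E))) = 0 := by
  have hN0 : N ≠ 0 := by omega
  obtain ⟨p, hp, hpc, c, hc, hcp⟩ := hH.exists_seminorm_eq_dualNorm hN0
  rw [← hp]
  have hSne : S.Nonempty := by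
    rw [nonempty_iff_ne_empty]
    rintro rfl
    simp at hEpos
  have hKb : Bornology.IsBounded (S ∩ {y | p y < 1}) :=
    (isCompact_seminorm_sub_le p hpc hc hcp 0 1).isBounded.subset fun x hx => by
      show p (x - 0) ≤ 1
      rw [sub_zero]
      exact le_of_lt hx.2
  have hBm : MeasurableSet {y | p y < 1} := (isOpen_lt hpc continuous_const).measurableSet
  have hKf := hKb.measure_lt_top (μ := volume)
  have hKpos : 0 < volume (S ∩ {y | p y < 1}) := by
    obtain ⟨y, hy⟩ := hSne
    have hy0 : 0 ≤ p y := apply_nonneg p y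
    have ht : 0 < 1 / (p y + 1) := by positivity
    refine (hS.1.inter (isOpen_lt hpc continuous_const)).measure_pos _
      ⟨(1 / (p y + 1)) • y, hS.2.2 _ hy _ ht, ?_⟩
    show p _ < 1
    rw [map_smul_eq_mul, Real.norm_of_nonneg ht.le, div_mul_eq_mul_div,
      div_lt_iff₀ (by positivity)]
    linarith
  obtain ⟨k, hk, hKk⟩ : ∃ k : ℝ, 0 < k ∧ volume (S ∩ {y | p y < 1}) = ENNReal.ofReal (k ^ N) :=
    ⟨_, Real.rpow_pos_of_pos (ENNReal.toReal_pos hKpos.ne' hKf.ne) _,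
      ofReal_pow_rpow_inv hN0 hKf.ne⟩
  obtain ⟨a, ha, hEa⟩ : ∃ a : ℝ, 0 < a ∧ volume (S ∩ E) = ENNReal.ofReal (a ^ N) :=
    ⟨_, Real.rpow_pos_of_pos (ENNReal.toReal_pos hEpos.ne' hEfin.ne) _,
      ofReal_pow_rpow_inv hN0 hEfin.ne⟩
  have hKr : volume.real (S ∩ {y | p y < 1}) = k ^ N := by
    rw [Measure.real, hKk, ENNReal.toReal_ofReal (by positivity)]
  have hEr : volume.real (S ∩ E) = a ^ N := by
    rw [Measure.real, hEa, ENNReal.toReal_ofReal (by positivity)]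
  have hzero : (0 : EuclideanSpace ℝ (Fin N)) ∈ lineality S := fun x hx t => by simpa using hx
  have hpow : ∀ b : ℝ, b ^ N = b * b ^ (N - 1) := fun b => (mul_pow_sub_one hN0 b).symm
  have hPB : periW p (fun _ => 1) {y | p y < 1} S = ENNReal.ofReal (N * k * k ^ (N - 1)) := by
    refine le_antisymm ?_ (ofReal_le_periW hN0 hS hSne p hpc hKb hk hKk hBm hk hKk)
    have := periW_le_of_restrict_eq hS p hpc hKf hBm hzero one_pos (by simp only [sub_zero])
    rwa [one_pow, mul_one, hKr, hpow, ← mul_assoc] at this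
  have hPE := ofReal_le_periW hN0 hS hSne p hpc hKb hk hKk hE ha hEa
  have hsymm : ∀ r x₀, volume (((S ∩ E) \ (S ∩ {x | p (x - x₀) < r})) ∪
      ((S ∩ {x | p (x - x₀) < r}) \ (S ∩ E))) = 0 ↔
      volume.restrict (S ∩ E) = volume.restrict (S ∩ {x | p (x - x₀) < r}) := fun r x₀ =>
    measure_sdiff_union_sdiff_eq_zero_iff (hS.1.measurableSet.inter hE)
      (hS.1.inter (isOpen_lt (by fun_prop) continuous_const)).measurableSet
  have heq : periW p (fun _ => 1) E S * ENNReal.ofReal (k ^ (N - 1)) =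
      ENNReal.ofReal (N * k * k ^ (N - 1)) * ENNReal.ofReal (a ^ (N - 1)) ↔
      periW p (fun _ => 1) E S = ENNReal.ofReal (N * k * a ^ (N - 1)) := by
    have h1 : ENNReal.ofReal (N * k * k ^ (N - 1)) * ENNReal.ofReal (a ^ (N - 1)) =
        ENNReal.ofReal (N * k * a ^ (N - 1)) * ENNReal.ofReal (k ^ (N - 1)) := by
      rw [← ENNReal.ofReal_mul (by positivity), ← ENNReal.ofReal_mul (by positivity)]
      congr 1
      ring
    rw [h1]
    exact ENNReal.mul_left_inj (by simpa using pow_pos hk _) ENNReal.ofReal_ne_top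
  rw [hPB, hKk, hEa, ofReal_pow_rpow_sub_one_div hN0 hk, ofReal_pow_rpow_sub_one_div hN0 ha, heq]
  simp only [hsymm]
  constructor
  · intro h
    have hr : 0 < a / k := div_pos ha hk
    have hrk : (a / k) ^ N * k ^ N = a ^ N := by rw [← mul_pow, div_mul_cancel₀ _ hk.ne']
    obtain ⟨x₀, hx₀, hres⟩ := exists_restrict_eq_of_periW_le hN0 hS hSne p hpc hc hcp hE hr
      (by rw [hKr, hrk, hEa]) (by
        rw [h, hEr, hpow a]
        refine le_of_eq (congrArg _ ?_)
        field_simp)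
    exact ⟨a / k, hr, x₀, hx₀, hres⟩
  · rintro ⟨r, hr, x₀, hx₀, hres⟩
    refine le_antisymm ?_ hPE
    have hvol : volume (S ∩ E) = ENNReal.ofReal (r ^ N * k ^ N) := by
      have := congrArg (fun ν => ν univ) hres
      simp only [Measure.restrict_apply_univ] at this
      rw [this, inter_seminorm_sub_lt_eq hx₀,
        volume_sub_mem_seminorm_lt hS p hKf x₀ hr, hKr]
    have har : a = r * k := by
      rw [hEa, ← mul_pow, ENNReal.ofReal_eq_ofReal_iff (by positivity) (by positivity)] at hvol
      exact (pow_left_inj₀ ha.le (by positivity) hN0).1 hvol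
    have := periW_le_of_restrict_eq hS p hpc hKf hE hx₀ hr hres
    refine this.trans (le_of_eq (congrArg _ ?_))
    rw [hKr, har, hpow k, mul_pow]
    ring
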